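/- Existence and uniqueness for the stationary generalized Dirichlet problem: let h ∈ C(Ω̄) and k ∈ C(∂Ω). Assume either (m > 0 and λ > 0) or (m > 1, λ = 0, and S(Ω,h,k,0) admits a bounded strict subsolution). Then there exists a unique continuous viscosity solution of the generalized boundary-value problem S(Ω,h,k,λ). -/

import Mathlib

open Set Filter Topology Metric MeasureTheory

noncomputable section

/-- Euclidean space `ℝ^N`. -/
abbrev Euc (N : ℕ) : Type := EuclideanSpace ℝ (Fin N)

/-- The Laplacian of `φ` at `x`, computed as the trace of the second derivative
in the standard orthonormal basis of `ℝ^N`. -/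
noncomputable def lapl {N : ℕ} (φ : Euc N → ℝ) (x : Euc N) : ℝ :=
  ∑ i : Fin N,
    iteratedFDeriv ℝ 2 φ x ![EuclideanSpace.single i 1, EuclideanSpace.single i 1]

/-- `Ω` is a domain with `C²` boundary: it is the sublevel set of a `C²`
defining function whose gradient does not vanish on the boundary. -/
def HasC2Boundary {N : ℕ} (Ω : Set (Euc N)) : Prop :=
  ∃ ρ : Euc N → ℝ, ContDiff ℝ 2 ρ ∧ Ω = {x | ρ x < 0} ∧
    frontier Ω = {x | ρ x = 0} ∧ ∀ x ∈ frontier Ω, gradient ρ x ≠ 0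

/-- The stationary operator `−Δφ(x) + |Dφ(x)|^m + λ r − h(x)` evaluated with the
value `r` of the (sub/super)solution at `x`. -/
noncomputable def statOp {N : ℕ} (h : Euc N → ℝ) (lam m : ℝ)
    (φ : Euc N → ℝ) (r : ℝ) (x : Euc N) : ℝ :=
  -lapl φ x + ‖gradient φ x‖ ^ m + lam * r - h x

/-- Viscosity subsolution of the generalized Dirichlet problem
`S(Ω,h,k,λ)`: `−Δw + |Dw|^m + λ w = h` in `Ω`, `w = k` on `∂Ω`. -/
def IsStatSub {N : ℕ} (Ω : Set (Euc N)) (h k : Euc N → ℝ) (lam m : ℝ)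
    (u : Euc N → ℝ) : Prop :=
  UpperSemicontinuousOn u (closure Ω) ∧
  ∀ φ : Euc N → ℝ, ContDiff ℝ 2 φ → ∀ x₀ ∈ closure Ω,
    IsLocalMaxOn (u - φ) (closure Ω) x₀ →
      (x₀ ∈ Ω → statOp h lam m φ (u x₀) x₀ ≤ 0) ∧
      (x₀ ∈ frontier Ω → min (statOp h lam m φ (u x₀) x₀) (u x₀ - k x₀) ≤ 0)

/-- Viscosity supersolution of the generalized Dirichlet problem `S(Ω,h,k,λ)`. -/
def IsStatSuper {N : ℕ} (Ω : Set (Euc N)) (h k : Euc N → ℝ) (lam m : ℝ)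
    (v : Euc N → ℝ) : Prop :=
  LowerSemicontinuousOn v (closure Ω) ∧
  ∀ φ : Euc N → ℝ, ContDiff ℝ 2 φ → ∀ x₀ ∈ closure Ω,
    IsLocalMinOn (v - φ) (closure Ω) x₀ →
      (x₀ ∈ Ω → 0 ≤ statOp h lam m φ (v x₀) x₀) ∧
      (x₀ ∈ frontier Ω → 0 ≤ max (statOp h lam m φ (v x₀) x₀) (v x₀ - k x₀))

/-- The parabolic operator
`φ_t(x,t) − Δφ(·,t)(x) + |Dφ(·,t)(x)|^m + λ r − f(x)`. -/
noncomputable def parOp {N : ℕ} (f : Euc N → ℝ) (lam m : ℝ)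
    (φ : Euc N × ℝ → ℝ) (r : ℝ) (x : Euc N) (t : ℝ) : ℝ :=
  deriv (fun s => φ (x, s)) t - lapl (fun y => φ (y, t)) x
    + ‖gradient (fun y => φ (y, t)) x‖ ^ m + lam * r - f x

/-- Viscosity subsolution of the generalized initial-boundary value problem
`E(Ω,f,g,u₀,λ)` on the time interval `[0,T]`:
`u_t − Δu + |Du|^m + λ u = f` in `Ω × (0,T]`, `u = g` on `∂Ω × (0,T]`,
`u(·,0) = u₀` on `closure Ω`. -/
def IsParSub {N : ℕ} (Ω : Set (Euc N)) (f g u₀ : Euc N → ℝ) (lam m T : ℝ)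
    (u : Euc N → ℝ → ℝ) : Prop :=
  UpperSemicontinuousOn (fun p : Euc N × ℝ => u p.1 p.2) (closure Ω ×ˢ Ico 0 T) ∧
  (∀ x ∈ closure Ω, u x 0 ≤ u₀ x) ∧
  ∀ φ : Euc N × ℝ → ℝ, ContDiff ℝ 2 φ → ∀ x₀ : Euc N, ∀ t₀ : ℝ,
    (x₀, t₀) ∈ closure Ω ×ˢ Ioc 0 T →
    IsLocalMaxOn (fun p : Euc N × ℝ => u p.1 p.2 - φ p) (closure Ω ×ˢ Ioc 0 T) (x₀, t₀) →
      (x₀ ∈ Ω → parOp f lam m φ (u x₀ t₀) x₀ t₀ ≤ 0) ∧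
      (x₀ ∈ frontier Ω →
        min (parOp f lam m φ (u x₀ t₀) x₀ t₀) (u x₀ t₀ - g x₀) ≤ 0)

/-- Viscosity supersolution of `E(Ω,f,g,u₀,λ)` on the time interval `[0,T]`. -/
def IsParSuper {N : ℕ} (Ω : Set (Euc N)) (f g u₀ : Euc N → ℝ) (lam m T : ℝ)
    (v : Euc N → ℝ → ℝ) : Prop :=
  LowerSemicontinuousOn (fun p : Euc N × ℝ => v p.1 p.2) (closure Ω ×ˢ Icc 0 T) ∧
  (∀ x ∈ closure Ω, u₀ x ≤ v x 0) ∧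
  ∀ φ : Euc N × ℝ → ℝ, ContDiff ℝ 2 φ → ∀ x₀ : Euc N, ∀ t₀ : ℝ,
    (x₀, t₀) ∈ closure Ω ×ˢ Ioc 0 T →
    IsLocalMinOn (fun p : Euc N × ℝ => v p.1 p.2 - φ p) (closure Ω ×ˢ Ioc 0 T) (x₀, t₀) →
      (x₀ ∈ Ω → 0 ≤ parOp f lam m φ (v x₀ t₀) x₀ t₀) ∧
      (x₀ ∈ frontier Ω →
        0 ≤ max (parOp f lam m φ (v x₀ t₀) x₀ t₀) (v x₀ t₀ - g x₀))

/-- A continuous viscosity solution, global in time, of `E(Ω,f,g,u₀,λ)`. -/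
def IsGlobalParSol {N : ℕ} (Ω : Set (Euc N)) (f g u₀ : Euc N → ℝ) (lam m : ℝ)
    (u : Euc N → ℝ → ℝ) : Prop :=
  ContinuousOn (fun p : Euc N × ℝ => u p.1 p.2) (closure Ω ×ˢ Ici 0) ∧
  ∀ T > (0 : ℝ), IsParSub Ω f g u₀ lam m T u ∧ IsParSuper Ω f g u₀ lam m T u

open scoped Classical in
/-- Redefinition of a parabolic subsolution on the lateral boundary by its
`limsup` from inside `Ω × (0,T]`. -/
noncomputable def uscExtPar {N : ℕ} (Ω : Set (Euc N)) (T : ℝ)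
    (u : Euc N → ℝ → ℝ) : Euc N → ℝ → ℝ :=
  fun z t => if z ∈ Ω then u z t
    else limsup (fun p : Euc N × ℝ => u p.1 p.2) (𝓝[Ω ×ˢ Ioc 0 T] (z, t))

open scoped Classical in
/-- Redefinition of a stationary subsolution on the boundary by its `limsup`
from inside `Ω`. -/
noncomputable def uscExtStat {N : ℕ} (Ω : Set (Euc N))
    (u : Euc N → ℝ) : Euc N → ℝ :=
  fun z => if z ∈ Ω then u z else limsup u (𝓝[Ω] z)

/-- Continuous viscosity solution of the state constraint problem
`−Δw + |Dw|^m + λ w = h` in `Ω`, `−Δw + |Dw|^m + λ w ≥ h` on `∂Ω`. -/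
def IsSCSolution {N : ℕ} (Ω : Set (Euc N)) (h : Euc N → ℝ) (lam m : ℝ)
    (w : Euc N → ℝ) : Prop :=
  ContinuousOn w (closure Ω) ∧
  (∀ φ : Euc N → ℝ, ContDiff ℝ 2 φ → ∀ x₀ ∈ Ω, IsLocalMaxOn (w - φ) Ω x₀ →
      statOp h lam m φ (w x₀) x₀ ≤ 0) ∧
  (∀ φ : Euc N → ℝ, ContDiff ℝ 2 φ → ∀ x₀ ∈ closure Ω,
      IsLocalMinOn (w - φ) (closure Ω) x₀ → 0 ≤ statOp h lam m φ (w x₀) x₀)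

/-- Continuous viscosity subsolution of `−Δu + |Du|^m ≤ h` in `Ω`
(no boundary condition). -/
def IsIntSub {N : ℕ} (Ω : Set (Euc N)) (h : Euc N → ℝ) (m : ℝ)
    (u : Euc N → ℝ) : Prop :=
  ∀ φ : Euc N → ℝ, ContDiff ℝ 2 φ → ∀ x₀ ∈ Ω, IsLocalMaxOn (u - φ) Ω x₀ →
    statOp h 0 m φ (u x₀) x₀ ≤ 0

/-- Hölder continuity with exponent `α` on a set. -/
def HolderOnCl {N : ℕ} (α : ℝ) (s : Set (Euc N)) (w : Euc N → ℝ) : Prop :=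
  ∃ C > (0 : ℝ), ∀ x ∈ s, ∀ y ∈ s, |w x - w y| ≤ C * ‖x - y‖ ^ α

/-- Local Lipschitz continuity inside `Ω`. -/
def LocLipIn {N : ℕ} (Ω : Set (Euc N)) (w : Euc N → ℝ) : Prop :=
  ∀ x ∈ Ω, ∃ ε > (0 : ℝ), ∃ K : ℝ, 0 ≤ K ∧
    ∀ y ∈ ball x ε ∩ Ω, ∀ z ∈ ball x ε ∩ Ω, |w y - w z| ≤ K * ‖y - z‖

/-- A piecewise `C¹` path parametrized on `[0,1]`. -/
def IsPWC1Path {N : ℕ} (γ : ℝ → Euc N) : Prop :=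
  ContinuousOn γ (Icc 0 1) ∧
  ∃ n : ℕ, ∃ τ : Fin (n + 1) → ℝ, StrictMono τ ∧ τ 0 = 0 ∧ τ (Fin.last n) = 1 ∧
    ∀ i : Fin n, ContDiffOn ℝ 1 γ (Icc (τ i.castSucc) (τ i.succ))

/-- The length of a path on `[0,1]`. -/
noncomputable def pathLen {N : ℕ} (γ : ℝ → Euc N) : ℝ :=
  ∫ t in (0 : ℝ)..1, ‖derivWithin γ (Icc (0 : ℝ) 1) t‖

/-- The geodesic-type distance inside `closure S` via piecewise `C¹` paths. -/
noncomputable def dTilde {N : ℕ} (S : Set (Euc N)) (x y : Euc N) : ℝ :=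
  sInf {L : ℝ | ∃ γ : ℝ → Euc N, IsPWC1Path γ ∧ γ 0 = x ∧ γ 1 = y ∧
    MapsTo γ (Icc 0 1) (closure S) ∧ L = pathLen γ}

/-- The inner parallel set `Ω_δ = {x ∈ Ω : dist(x,∂Ω) > δ}`. -/
def innerSet {N : ℕ} (Ω : Set (Euc N)) (δ : ℝ) : Set (Euc N) :=
  {x ∈ Ω | δ < infDist x (frontier Ω)}

end

/-! ### Calculus for the Laplacian -/

lemma lapl_eq_fderiv_fderiv {N : ℕ} (φ : Euc N → ℝ) (x : Euc N) :
    lapl φ x = ∑ i : Fin N, fderiv ℝ (fderiv ℝ φ) x (EuclideanSpace.single i 1)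
      (EuclideanSpace.single i 1) := by
  simp [lapl, iteratedFDeriv_two_apply]

lemma norm_gradient_eq {N : ℕ} (φ : Euc N → ℝ) (x : Euc N) :
    ‖gradient φ x‖ = ‖fderiv ℝ φ x‖ := by
  simp [gradient]

lemma lapl_congr {N : ℕ} {φ ψ : Euc N → ℝ} {x : Euc N} (h : φ =ᶠ[𝓝 x] ψ) :
    lapl φ x = lapl ψ x := by
  rw [lapl_eq_fderiv_fderiv, lapl_eq_fderiv_fderiv, h.fderiv.fderiv_eq]

lemma ContDiffAt.differentiableAt_fderiv_two {N : ℕ} {φ : Euc N → ℝ} {x : Euc N}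
    (h : ContDiffAt ℝ 2 φ x) : DifferentiableAt ℝ (fderiv ℝ φ) x :=
  (h.fderiv_right (m := 1) (by norm_num)).differentiableAt (by norm_num)

lemma ContDiffAt.eventually_differentiableAt_two {N : ℕ} {φ : Euc N → ℝ} {x : Euc N}
    (h : ContDiffAt ℝ 2 φ x) : ∀ᶠ y in 𝓝 x, DifferentiableAt ℝ φ y :=
  (h.eventually (by simp)).mono fun _ hy => hy.differentiableAt (by norm_num)

lemma lapl_add {N : ℕ} {φ ψ : Euc N → ℝ} {x : Euc N} (hφ : ContDiffAt ℝ 2 φ x)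
    (hψ : ContDiffAt ℝ 2 ψ x) : lapl (fun y => φ y + ψ y) x = lapl φ x + lapl ψ x := by
  have : fderiv ℝ (fun y => φ y + ψ y) =ᶠ[𝓝 x] fun y => fderiv ℝ φ y + fderiv ℝ ψ y := by
    filter_upwards [hφ.eventually_differentiableAt_two, hψ.eventually_differentiableAt_two]
      with y h1 h2 using fderiv_fun_add h1 h2
  simp only [lapl_eq_fderiv_fderiv]
  rw [this.fderiv_eq, fderiv_fun_add hφ.differentiableAt_fderiv_two
    hψ.differentiableAt_fderiv_two, ← Finset.sum_add_distrib]
  rfl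

lemma lapl_const_mul {N : ℕ} (c : ℝ) {φ : Euc N → ℝ} {x : Euc N} (hφ : ContDiffAt ℝ 2 φ x) :
    lapl (fun y => c * φ y) x = c * lapl φ x := by
  have : fderiv ℝ (fun y => c * φ y) =ᶠ[𝓝 x] fun y => c • fderiv ℝ φ y := by
    filter_upwards [hφ.eventually_differentiableAt_two] with y h1 using fderiv_const_mul h1 c
  simp only [lapl_eq_fderiv_fderiv]
  rw [this.fderiv_eq, fderiv_fun_const_smul hφ.differentiableAt_fderiv_two, Finset.mul_sum]
  rfl

lemma lapl_neg {N : ℕ} {φ : Euc N → ℝ} {x : Euc N} (hφ : ContDiffAt ℝ 2 φ x) :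
    lapl (fun y => -φ y) x = -lapl φ x := by
  simpa using lapl_const_mul (-1) hφ

lemma lapl_const {N : ℕ} (c : ℝ) (x : Euc N) : lapl (fun _ => c) x = 0 := by
  have : fderiv ℝ (fun _ : Euc N => c) = fun _ => 0 := by ext; simp
  simp [lapl_eq_fderiv_fderiv, this]

lemma lapl_sub {N : ℕ} {φ ψ : Euc N → ℝ} {x : Euc N} (hφ : ContDiffAt ℝ 2 φ x)
    (hψ : ContDiffAt ℝ 2 ψ x) : lapl (fun y => φ y - ψ y) x = lapl φ x - lapl ψ x := by
  simp only [sub_eq_add_neg]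
  rw [lapl_add hφ hψ.neg, lapl_neg hψ]

lemma lapl_comp_add_right {N : ℕ} (φ : Euc N → ℝ) (a x : Euc N) :
    lapl (fun y => φ (y + a)) x = lapl φ (x + a) := by
  simp [lapl, iteratedFDeriv_comp_add_right]

lemma gradient_comp_add_right {N : ℕ} (φ : Euc N → ℝ) (a x : Euc N) :
    gradient (fun y => φ (y + a)) x = gradient φ (x + a) := by
  simp [gradient, fderiv_comp_add_right]

lemma gradient_add {N : ℕ} {φ ψ : Euc N → ℝ} {x : Euc N} (hφ : DifferentiableAt ℝ φ x)
    (hψ : DifferentiableAt ℝ ψ x) :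
    gradient (fun y => φ y + ψ y) x = gradient φ x + gradient ψ x := by
  simp [gradient, fderiv_fun_add hφ hψ]

lemma gradient_neg {N : ℕ} (φ : Euc N → ℝ) (x : Euc N) :
    gradient (fun y => -φ y) x = -gradient φ x := by
  simp [gradient, fderiv_fun_neg]

lemma gradient_const_mul {N : ℕ} (c : ℝ) {φ : Euc N → ℝ} {x : Euc N}
    (hφ : DifferentiableAt ℝ φ x) :
    gradient (fun y => c * φ y) x = c • gradient φ x := by
  simp [gradient, fderiv_const_mul hφ]

lemma gradient_sub {N : ℕ} {φ ψ : Euc N → ℝ} {x : Euc N} (hφ : DifferentiableAt ℝ φ x)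
    (hψ : DifferentiableAt ℝ ψ x) :
    gradient (fun y => φ y - ψ y) x = gradient φ x - gradient ψ x := by
  simp [gradient, fderiv_fun_sub hφ hψ]

lemma ContDiff.continuous_lapl {N : ℕ} {φ : Euc N → ℝ} (h : ContDiff ℝ 2 φ) :
    Continuous (lapl φ) := by
  have h1 : Continuous (fderiv ℝ (fderiv ℝ φ)) :=
    (h.fderiv_right (m := 1) (by norm_num)).continuous_fderiv (by norm_num)
  have : lapl φ = fun x => ∑ i : Fin N, fderiv ℝ (fderiv ℝ φ) x (EuclideanSpace.single i 1)
      (EuclideanSpace.single i 1) := funext fun x => lapl_eq_fderiv_fderiv φ x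
  rw [this]
  fun_prop

lemma ContDiff.continuous_gradient {N : ℕ} {φ : Euc N → ℝ} (h : ContDiff ℝ 2 φ) :
    Continuous (gradient φ) := by
  have h1 : Continuous (fderiv ℝ φ) := h.continuous_fderiv (by norm_num)
  exact (InnerProductSpace.toDual ℝ (Euc N)).symm.continuous.comp h1

/-- Second-order necessary condition at a local maximum. -/
lemma IsLocalMax.lapl_nonpos {N : ℕ} {φ : Euc N → ℝ} {x : Euc N} (h : IsLocalMax φ x)
    (hφ : ContDiffAt ℝ 2 φ x) : lapl φ x ≤ 0 := by
  rw [lapl_eq_fderiv_fderiv]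
  refine Finset.sum_nonpos fun i _ => ?_
  set e : Euc N := EuclideanSpace.single i 1
  set g : ℝ → ℝ := fun t => φ (x + t • e) with hg
  have hline : ∀ t : ℝ, HasDerivAt (fun t : ℝ => x + t • e) e t := fun t => by
    simpa using ((hasDerivAt_id t).smul_const e).const_add x
  have hcont : Tendsto (fun t : ℝ => x + t • e) (𝓝 0) (𝓝 x) := by
    simpa using (hline 0).continuousAt.tendsto
  have hd : deriv g =ᶠ[𝓝 0] fun t => fderiv ℝ φ (x + t • e) e := by
    filter_upwards [hcont.eventually hφ.eventually_differentiableAt_two] with t ht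
    exact (ht.hasFDerivAt.comp_hasDerivAt t (hline t)).deriv
  have hdd : deriv (deriv g) 0 = fderiv ℝ (fderiv ℝ φ) x e e := by
    rw [hd.deriv_eq]
    have h1 : HasFDerivAt (fderiv ℝ φ) (fderiv ℝ (fderiv ℝ φ) x) (x + (0 : ℝ) • e) := by
      simpa using hφ.differentiableAt_fderiv_two.hasFDerivAt
    have h2 := h1.comp_hasDerivAt (0 : ℝ) (hline 0)
    exact (h2.clm_apply (hasDerivAt_const (0 : ℝ) e)).deriv.trans (by simp)
  have hmax : IsLocalMax g 0 := by
    have := hcont.eventually h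
    filter_upwards [this] with t ht
    simpa [hg] using ht
  by_contra! hpos
  rw [← hdd] at hpos
  have hc : ContinuousAt g 0 := by
    have : ContinuousAt φ (x + (0 : ℝ) • e) := by simpa using hφ.continuousAt
    exact ContinuousAt.comp (f := fun t : ℝ => x + t • e) this (hline 0).continuousAt
  have hmin := isLocalMin_of_deriv_deriv_pos hpos hmax.deriv_eq_zero hc
  have heq : g =ᶠ[𝓝 0] fun _ => g 0 := by
    filter_upwards [hmax, hmin] with t h1 h2 using le_antisymm h1 h2
  have : deriv (deriv g) 0 = 0 := by
    rw [heq.deriv.deriv_eq]; simp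
  linarith

lemma gradient_eq_and_lapl_le_of_isLocalMax {N : ℕ} {f φ : Euc N → ℝ} {x : Euc N}
    (h : IsLocalMax (f - φ) x) (hf : ContDiffAt ℝ 2 f x) (hφ : ContDiffAt ℝ 2 φ x) :
    gradient φ x = gradient f x ∧ lapl f x ≤ lapl φ x := by
  have h1 := h.fderiv_eq_zero
  have h2 := h.lapl_nonpos (hf.sub hφ)
  rw [show (f - φ) = fun y => f y - φ y from rfl] at h1 h2
  rw [lapl_sub hf hφ] at h2
  rw [fderiv_fun_sub (hf.differentiableAt (by norm_num)) (hφ.differentiableAt (by norm_num)),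
    sub_eq_zero] at h1
  exact ⟨by simp [gradient, h1], by linarith⟩

lemma sum_fderiv_sq {N : ℕ} (f : Euc N → ℝ) (x : Euc N) :
    ∑ i : Fin N, (fderiv ℝ f x (EuclideanSpace.single i 1)) ^ 2 = ‖gradient f x‖ ^ 2 := by
  rw [EuclideanSpace.norm_sq_eq]
  refine Finset.sum_congr rfl fun i _ => ?_
  rw [← inner_gradient_left, EuclideanSpace.inner_single_right]
  simp

/-- Chain rule for the Laplacian. -/
lemma lapl_comp {N : ℕ} {f : Euc N → ℝ} {x : Euc N} {ψ ψ' : ℝ → ℝ} {ψ'' : ℝ}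
    (hf : ContDiffAt ℝ 2 f x) (hψ : ∀ᶠ s in 𝓝 (f x), HasDerivAt ψ (ψ' s) s)
    (hψ' : HasDerivAt ψ' ψ'' (f x)) :
    lapl (fun y => ψ (f y)) x = ψ' (f x) * lapl f x + ψ'' * ‖gradient f x‖ ^ 2 := by
  have h1 : fderiv ℝ (fun y => ψ (f y)) =ᶠ[𝓝 x] fun y => ψ' (f y) • fderiv ℝ f y := by
    filter_upwards [hf.continuousAt.eventually hψ, hf.eventually_differentiableAt_two]
      with y hy1 hy2
    exact (hy1.comp_hasFDerivAt y hy2.hasFDerivAt).fderiv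
  have h2 : HasFDerivAt (fun y => ψ' (f y)) (ψ'' • fderiv ℝ f x) x :=
    hψ'.comp_hasFDerivAt x (hf.differentiableAt (by norm_num)).hasFDerivAt
  have h3 := h2.fun_smul hf.differentiableAt_fderiv_two.hasFDerivAt
  rw [lapl_eq_fderiv_fderiv, h1.fderiv_eq, HasFDerivAt.fderiv h3, lapl_eq_fderiv_fderiv,
    ← sum_fderiv_sq, Finset.mul_sum, Finset.mul_sum, ← Finset.sum_add_distrib]
  refine Finset.sum_congr rfl fun i _ => ?_
  simp
  ring

lemma gradient_comp {N : ℕ} {f : Euc N → ℝ} {x : Euc N} {ψ : ℝ → ℝ} {ψ' : ℝ}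
    (hf : DifferentiableAt ℝ f x) (hψ : HasDerivAt ψ ψ' (f x)) :
    gradient (fun y => ψ (f y)) x = ψ' • gradient f x := by
  have : fderiv ℝ (fun y => ψ (f y)) x = ψ' • fderiv ℝ f x :=
    (hψ.comp_hasFDerivAt x hf.hasFDerivAt).fderiv
  simp [gradient, this]

lemma contDiff_norm_sub_sq {N : ℕ} (z : Euc N) {n : WithTop ℕ∞} :
    ContDiff ℝ n (fun y : Euc N => ‖y - z‖ ^ 2) :=
  (contDiff_id.sub contDiff_const).norm_sq ℝ

lemma fderiv_norm_sub_sq {N : ℕ} (z x : Euc N) :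
    fderiv ℝ (fun y : Euc N => ‖y - z‖ ^ 2) x = (2 : ℝ) • innerSL ℝ (x - z) := by
  have := ((hasFDerivAt_id x).sub_const z).norm_sq
  rw [HasFDerivAt.fderiv (f := fun y : Euc N => ‖y - z‖ ^ 2) this]
  ext; simp

lemma gradient_norm_sub_sq {N : ℕ} (z x : Euc N) :
    gradient (fun y : Euc N => ‖y - z‖ ^ 2) x = (2 : ℝ) • (x - z) := by
  apply ext_inner_right ℝ
  intro v
  rw [inner_gradient_left, fderiv_norm_sub_sq]
  simp [inner_smul_left, inner_sub_left]

lemma lapl_norm_sub_sq {N : ℕ} (z x : Euc N) :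
    lapl (fun y : Euc N => ‖y - z‖ ^ 2) x = 2 * N := by
  have h : fderiv ℝ (fun y : Euc N => ‖y - z‖ ^ 2) =
      fun y => (2 : ℝ) • (innerSL ℝ y - innerSL ℝ z) := by
    ext1 y; rw [fderiv_norm_sub_sq, map_sub]
  have h2 : HasFDerivAt (fun y : Euc N => (2 : ℝ) • (innerSL ℝ y - innerSL ℝ z))
      ((2 : ℝ) • (innerSL ℝ : Euc N →L[ℝ] Euc N →L[ℝ] ℝ)) x :=
    ((innerSL ℝ : Euc N →L[ℝ] Euc N →L[ℝ] ℝ).hasFDerivAt.sub_const _).const_smul (2 : ℝ)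
  rw [lapl_eq_fderiv_fderiv, h, h2.fderiv]
  have h3 : ∀ v : Euc N, ((2 : ℝ) • (innerSL ℝ : Euc N →L[ℝ] Euc N →L[ℝ] ℝ)) v v
      = 2 * inner ℝ v v := fun v => rfl
  simp only [h3]
  simp [mul_comm]

/-- Every function that is `C²` near a point agrees near this point with a global `C²` function. -/
lemma exists_contDiff_eventuallyEq {N : ℕ} {φ : Euc N → ℝ} {x : Euc N}
    (h : ContDiffAt ℝ 2 φ x) : ∃ ψ : Euc N → ℝ, ContDiff ℝ 2 ψ ∧ ψ =ᶠ[𝓝 x] φ := by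
  obtain ⟨r, hr, hr'⟩ := Metric.eventually_nhds_iff_ball.1 (h.eventually (by simp))
  let b : ContDiffBump x := ⟨r / 4, r / 2, by positivity, by linarith⟩
  refine ⟨fun y => b y * φ y, ?_, ?_⟩
  · rw [contDiff_iff_contDiffAt]
    intro y
    by_cases hy : y ∈ ball x r
    · exact b.contDiffAt.mul (hr' y hy)
    · have hy' : ∀ᶠ w in 𝓝 y, r / 2 < dist w x := by
        have : r / 2 < dist y x := by
          simp only [mem_ball, not_lt] at hy; linarith
        exact (continuous_id.dist continuous_const).continuousAt.eventually_const_lt this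
      refine (contDiffAt_const (c := (0 : ℝ))).congr_of_eventuallyEq ?_
      filter_upwards [hy'] with w hw
      rw [b.zero_of_le_dist hw.le, zero_mul]
  · filter_upwards [b.eventuallyEq_one] with y hy
    rw [hy, Pi.one_apply, one_mul]

lemma contDiff_norm_sub_pow_four {N : ℕ} (z : Euc N) {n : WithTop ℕ∞} :
    ContDiff ℝ n (fun y : Euc N => (‖y - z‖ ^ 2) ^ 2) :=
  (contDiff_norm_sub_sq z).pow 2

lemma lapl_norm_sub_pow_four {N : ℕ} (z : Euc N) :
    lapl (fun y : Euc N => (‖y - z‖ ^ 2) ^ 2) z = 0 := by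
  rw [lapl_comp (ψ := fun s => s ^ 2) (ψ' := fun s => 2 * s) (ψ'' := 2)
    (contDiff_norm_sub_sq z).contDiffAt
    (Eventually.of_forall fun s => by simpa using hasDerivAt_pow 2 s)
    (by simpa using (hasDerivAt_id _).const_mul (2 : ℝ))]
  simp [gradient_norm_sub_sq]

lemma gradient_norm_sub_pow_four {N : ℕ} (z : Euc N) :
    gradient (fun y : Euc N => (‖y - z‖ ^ 2) ^ 2) z = 0 := by
  rw [gradient_comp (ψ := fun s => s ^ 2) (ψ' := 2 * ‖z - z‖ ^ 2)
    (contDiff_norm_sub_sq (n := 2) z |>.differentiable (by norm_num) |>.differentiableAt)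
    (by simpa only [Nat.cast_ofNat, Nat.add_one_sub_one, pow_one] using
      hasDerivAt_pow 2 (‖z - z‖ ^ 2))]
  simp

/-! ### Polynomials and the Dirichlet problem on balls -/

/-- The function on `ℝ^N` defined by a polynomial. -/
noncomputable def polyFun {N : ℕ} (p : MvPolynomial (Fin N) ℝ) (x : Euc N) : ℝ :=
  MvPolynomial.eval (fun i => x i) p

lemma contDiff_polyFun {N : ℕ} (p : MvPolynomial (Fin N) ℝ) : ContDiff ℝ 2 (polyFun p) := by
  induction p using MvPolynomial.induction_on with
  | C a =>
    have : polyFun (N := N) (MvPolynomial.C a) = fun _ => a := by ext; simp [polyFun]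
    rw [this]; exact contDiff_const
  | add p q hp hq =>
    have : polyFun (p + q) = fun x => polyFun p x + polyFun q x := by ext x; simp [polyFun]
    rw [this]; exact hp.add hq
  | mul_X p i hp =>
    have : polyFun (p * MvPolynomial.X i) = fun x => polyFun p x * x i := by
      ext x; simp [polyFun]
    rw [this]
    exact hp.mul (by fun_prop)

lemma fderiv_polyFun {N : ℕ} (p : MvPolynomial (Fin N) ℝ) (i : Fin N) (x : Euc N) :
    fderiv ℝ (polyFun p) x (EuclideanSpace.single i 1) =
      polyFun (MvPolynomial.pderiv i p) x := by
  induction p using MvPolynomial.induction_on with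
  | C a =>
    have : polyFun (N := N) (MvPolynomial.C a) = fun _ => a := by ext; simp [polyFun]
    rw [this]; simp [polyFun]
  | add p q hp hq =>
    have : polyFun (p + q) = fun x => polyFun p x + polyFun q x := by ext x; simp [polyFun]
    rw [this, fderiv_fun_add ((contDiff_polyFun p).differentiable (by norm_num) x)
      ((contDiff_polyFun q).differentiable (by norm_num) x)]
    simp only [add_apply, hp, hq]
    simp [polyFun]
  | mul_X p j hp =>
    have : polyFun (p * MvPolynomial.X j) = fun x => polyFun p x * x j := by
      ext x; simp [polyFun]
    have hj : HasFDerivAt (fun x : Euc N => x j) (EuclideanSpace.proj j : Euc N →L[ℝ] ℝ) x :=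
      (EuclideanSpace.proj j : Euc N →L[ℝ] ℝ).hasFDerivAt
    have h2 := ((contDiff_polyFun p).differentiable (by norm_num) x).hasFDerivAt.fun_mul hj
    rw [this, h2.fderiv]
    simp only [add_apply, smul_apply, hp, smul_eq_mul,
      MvPolynomial.pderiv_mul, MvPolynomial.pderiv_X]
    by_cases hij : j = i
    · subst hij; simp [polyFun]; ring
    · simp [polyFun, hij]; ring

/-- The Laplacian of a polynomial. -/
noncomputable def polyLapl (N : ℕ) : MvPolynomial (Fin N) ℝ →ₗ[ℝ] MvPolynomial (Fin N) ℝ :=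
  ∑ i : Fin N, (MvPolynomial.pderiv i).toLinearMap ∘ₗ (MvPolynomial.pderiv i).toLinearMap

lemma lapl_polyFun {N : ℕ} (p : MvPolynomial (Fin N) ℝ) (x : Euc N) :
    lapl (polyFun p) x = polyFun (polyLapl N p) x := by
  have h : polyFun (polyLapl N p) x =
      ∑ i : Fin N, polyFun (MvPolynomial.pderiv i (MvPolynomial.pderiv i p)) x := by
    simp [polyFun, polyLapl]
  rw [h, lapl_eq_fderiv_fderiv]
  refine Finset.sum_congr rfl fun i _ => ?_
  rw [← fderiv_polyFun, ← funext (fun y => fderiv_polyFun p i y)]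
  have h1 := (contDiff_polyFun p).contDiffAt (x := x) |>.differentiableAt_fderiv_two.hasFDerivAt
  have h2 := h1.clm_apply (hasFDerivAt_const (EuclideanSpace.single i (1 : ℝ)) x)
  rw [h2.fderiv]
  simp

lemma totalDegree_pderiv_le {σ : Type*} (i : σ) (p : MvPolynomial σ ℝ) :
    (MvPolynomial.pderiv i p).totalDegree ≤ p.totalDegree - 1 := by
  classical
  conv_lhs => rw [p.as_sum, map_sum]
  refine MvPolynomial.totalDegree_finsetSum_le fun s hs => ?_
  rw [MvPolynomial.pderiv_monomial]
  by_cases h0 : s i = 0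
  · simp [h0]
  · refine (MvPolynomial.totalDegree_monomial_le _ _).trans ?_
    have h1 : s.sum (fun _ e => e) ≤ p.totalDegree := MvPolynomial.le_totalDegree hs
    have h2 : Finsupp.degree (s - Finsupp.single i 1) + 1 = Finsupp.degree s := by
      have : s - Finsupp.single i 1 + Finsupp.single i 1 = s := by
        ext j; by_cases hj : i = j
        · subst hj; simp; omega
        · simp [hj]
      conv_rhs => rw [← this, map_add]
      simp
    have h3 : ∀ t : σ →₀ ℕ, t.sum (fun _ e => e) = Finsupp.degree t := fun t => rfl
    simp only [h3] at h1 ⊢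
    have h4 : ((s - Finsupp.single i 1).sum fun _ => id) =
      Finsupp.degree (s - Finsupp.single i 1) := rfl
    omega

lemma totalDegree_polyLapl_le {N : ℕ} (p : MvPolynomial (Fin N) ℝ) :
    (polyLapl N p).totalDegree ≤ p.totalDegree - 2 := by
  simp only [polyLapl, LinearMap.sum_apply]
  refine MvPolynomial.totalDegree_finsetSum_le fun i _ => ?_
  have h1 := totalDegree_pderiv_le i (MvPolynomial.pderiv i p)
  have h2 := totalDegree_pderiv_le i p
  exact h1.trans (by omega)

/-- Weak maximum principle on a ball for functions with positive Laplacian. -/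
lemma le_of_lapl_pos_of_le_sphere {N : ℕ} {F : Euc N → ℝ} (hF : ContDiff ℝ 2 F)
    {x₀ : Euc N} {r b : ℝ} (hr : 0 ≤ r) (hpos : ∀ x ∈ ball x₀ r, 0 < lapl F x)
    (hb : ∀ x ∈ sphere x₀ r, F x ≤ b) : ∀ x ∈ closedBall x₀ r, F x ≤ b := by
  obtain ⟨y, hy, hmax⟩ := (isCompact_closedBall x₀ r).exists_isMaxOn
    (nonempty_closedBall.2 hr) hF.continuous.continuousOn
  have hyb : y ∈ sphere x₀ r := by
    by_contra hns
    have hyball : y ∈ ball x₀ r := by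
      rw [← ball_union_sphere] at hy
      exact hy.resolve_right hns
    have : IsLocalMax F y := hmax.isLocalMax (mem_of_superset (isOpen_ball.mem_nhds hyball)
      ball_subset_closedBall)
    exact absurd (this.lapl_nonpos hF.contDiffAt) (not_le.2 (hpos y hyball))
  exact fun x hx => (hmax hx).trans (hb y hyb)

lemma le_of_lapl_ge_of_le_sphere {N : ℕ} (hN : 1 ≤ N) {F : Euc N → ℝ} (hF : ContDiff ℝ 2 F)
    {x₀ : Euc N} {r b c : ℝ} (hr : 0 ≤ r) (hpos : ∀ x ∈ ball x₀ r, 2 * N * c ≤ lapl F x)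
    (hb : ∀ x ∈ sphere x₀ r, F x ≤ b) :
    ∀ x ∈ closedBall x₀ r, F x ≤ b - c * (r ^ 2 - ‖x - x₀‖ ^ 2) := by
  intro x hx
  have hN' : (0 : ℝ) < N := by exact_mod_cast hN
  refine le_of_forall_pos_le_add fun ε hε => ?_
  set δ := ε / (r ^ 2 + 1)
  have hδ : 0 < δ := by positivity
  have hq := contDiff_norm_sub_sq (n := 2) x₀
  have h := le_of_lapl_pos_of_le_sphere (F := fun y => F y + (δ - c) * ‖y - x₀‖ ^ 2)
    (hF.add (contDiff_const.mul hq)) (x₀ := x₀) (r := r) (b := b + (δ - c) * r ^ 2) hr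
    (fun y hy => by
      rw [lapl_add hF.contDiffAt (contDiff_const.mul hq).contDiffAt,
        lapl_const_mul _ hq.contDiffAt, lapl_norm_sub_sq]
      have := hpos y hy
      have : 0 < 2 * N * δ := by positivity
      linarith)
    (fun y hy => by
      have h1 : ‖y - x₀‖ = r := by simpa [dist_eq_norm] using hy
      simp only [h1]
      linarith [hb y hy]) x hx
  have h2 : δ * r ^ 2 ≤ ε := by
    have : δ * (r ^ 2 + 1) = ε := by simp only [δ]; field_simp
    nlinarith
  have h3 : 0 ≤ δ * ‖x - x₀‖ ^ 2 := by positivity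
  nlinarith

/-- The polynomial `r² - |x - x₀|²`. -/
noncomputable def ballPoly {N : ℕ} (x₀ : Euc N) (r : ℝ) : MvPolynomial (Fin N) ℝ :=
  MvPolynomial.C (r ^ 2) - ∑ i : Fin N, (MvPolynomial.X i - MvPolynomial.C (x₀ i)) ^ 2

lemma polyFun_ballPoly {N : ℕ} (x₀ : Euc N) (r : ℝ) (x : Euc N) :
    polyFun (ballPoly x₀ r) x = r ^ 2 - ‖x - x₀‖ ^ 2 := by
  simp [polyFun, ballPoly, EuclideanSpace.norm_sq_eq]

lemma totalDegree_ballPoly_le {N : ℕ} (x₀ : Euc N) (r : ℝ) :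
    (ballPoly x₀ r).totalDegree ≤ 2 := by
  refine (MvPolynomial.totalDegree_sub _ _).trans (max_le
    (by rw [MvPolynomial.totalDegree_C]; omega) ?_)
  refine MvPolynomial.totalDegree_finsetSum_le fun i _ => ?_
  refine (MvPolynomial.totalDegree_pow _ _).trans ?_
  have : (MvPolynomial.X i - MvPolynomial.C (x₀ i) : MvPolynomial (Fin N) ℝ).totalDegree ≤ 1 :=
    (MvPolynomial.totalDegree_sub _ _).trans (by simp)
  omega

lemma eq_zero_of_polyFun_eq_zero_on_ball {N : ℕ} {q : MvPolynomial (Fin N) ℝ} {x₀ : Euc N}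
    {r : ℝ} (hr : 0 < r) (h : ∀ x ∈ ball x₀ r, polyFun q x = 0) : q = 0 := by
  have hcont : Continuous (fun y : Fin N → ℝ => (WithLp.toLp 2 y : Euc N)) :=
    PiLp.continuous_toLp 2 _
  have hopen : IsOpen ((fun y : Fin N → ℝ => (WithLp.toLp 2 y : Euc N)) ⁻¹' ball x₀ r) :=
    isOpen_ball.preimage hcont
  obtain ⟨δ, hδ, hsub⟩ := Metric.isOpen_iff.1 hopen (fun i => x₀ i) (by simpa using hr)
  rw [ball_pi _ hδ] at hsub
  refine MvPolynomial.funext_set (fun i => ball (x₀ i) δ) (fun i => ?_) fun y hy => ?_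
  · rw [Real.ball_eq_Ioo]; exact Set.Ioo_infinite (by linarith)
  · have := h _ (hsub hy)
    simpa [polyFun] using this

/-- Solvability of the Poisson problem on a ball in the space of polynomials. -/
lemma exists_polyLapl_ballPoly_mul {N : ℕ} (hN : 1 ≤ N) (x₀ : Euc N) {r : ℝ} (hr : 0 < r)
    (f : MvPolynomial (Fin N) ℝ) : ∃ q, polyLapl N (ballPoly x₀ r * q) = f := by
  let T : MvPolynomial (Fin N) ℝ →ₗ[ℝ] MvPolynomial (Fin N) ℝ :=
    polyLapl N ∘ₗ LinearMap.mulLeft ℝ (ballPoly x₀ r)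
  let V := MvPolynomial.restrictTotalDegree (Fin N) ℝ f.totalDegree
  have hTV : ∀ q ∈ V, T q ∈ V := by
    intro q hq
    rw [MvPolynomial.mem_restrictTotalDegree] at hq ⊢
    refine (totalDegree_polyLapl_le _).trans ?_
    have h1 := MvPolynomial.totalDegree_mul (ballPoly x₀ r) q
    have h2 := totalDegree_ballPoly_le x₀ r
    simp only [LinearMap.mulLeft_apply]
    omega
  have hinj : ∀ q, T q = 0 → q = 0 := by
    intro q hq
    apply eq_zero_of_polyFun_eq_zero_on_ball (x₀ := x₀) hr
    intro x hx
    have hlap : ∀ y, lapl (polyFun (ballPoly x₀ r * q)) y = 0 := by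
      intro y
      rw [lapl_polyFun]
      have : polyLapl N (ballPoly x₀ r * q) = 0 := hq
      simp [this, polyFun]
    have hmul : ∀ y, polyFun (ballPoly x₀ r * q) y = (r ^ 2 - ‖y - x₀‖ ^ 2) * polyFun q y := by
      intro y
      rw [← polyFun_ballPoly]; simp [polyFun]
    have hzero : ∀ y ∈ sphere x₀ r, polyFun (ballPoly x₀ r * q) y = 0 := by
      intro y hy
      have h1 : ‖y - x₀‖ = r := by simpa [dist_eq_norm] using hy
      rw [hmul, h1]; simp
    have hup := le_of_lapl_ge_of_le_sphere hN (contDiff_polyFun (ballPoly x₀ r * q)) hr.le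
      (c := 0) (fun y _ => by rw [hlap]; simp) (fun y hy => (hzero y hy).le) x
      (ball_subset_closedBall hx)
    have hdn := le_of_lapl_ge_of_le_sphere hN (contDiff_polyFun (ballPoly x₀ r * q)).neg hr.le
      (c := 0) (b := 0) (fun y _ => by
        rw [lapl_neg (contDiff_polyFun _).contDiffAt, hlap]; simp)
      (fun y hy => by simp [hzero y hy]) x (ball_subset_closedBall hx)
    have hx0 : polyFun (ballPoly x₀ r * q) x = 0 := by
      simp at hup hdn; linarith
    rw [hmul] at hx0
    have hlt : ‖x - x₀‖ < r := by simpa [dist_eq_norm] using hx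
    have : 0 < r ^ 2 - ‖x - x₀‖ ^ 2 := by nlinarith [norm_nonneg (x - x₀)]
    exact (mul_eq_zero.1 hx0).resolve_left this.ne'
  have hinj' : Function.Injective (T.restrict hTV) := by
    rw [← LinearMap.ker_eq_bot, LinearMap.ker_eq_bot']
    rintro ⟨q, hq⟩ h
    ext1
    exact hinj q (congrArg Subtype.val h)
  obtain ⟨⟨q, _⟩, hq⟩ := (LinearMap.injective_iff_surjective.1 hinj')
    ⟨f, (MvPolynomial.mem_restrictTotalDegree _ _ _).2 le_rfl⟩
  exact ⟨q, congrArg Subtype.val hq⟩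

lemma exists_polyFun_approx {N : ℕ} {K : Set (Euc N)} (hK : IsCompact K) {f : Euc N → ℝ}
    (hf : ContinuousOn f K) {ε : ℝ} (hε : 0 < ε) :
    ∃ p : MvPolynomial (Fin N) ℝ, ∀ x ∈ K, |polyFun p x - f x| < ε := by
  have : CompactSpace K := isCompact_iff_compactSpace.1 hK
  let coord : Fin N → C(K, ℝ) := fun i =>
    ⟨fun x => (x : Euc N) i, by fun_prop⟩
  let A : Subalgebra ℝ C(K, ℝ) := (MvPolynomial.aeval coord).range
  have hsep : A.SeparatesPoints := by
    intro x y hxy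
    have : ∃ i, (x : Euc N) i ≠ (y : Euc N) i := by
      by_contra! hc
      exact hxy (Subtype.ext (by ext i; exact hc i))
    obtain ⟨i, hi⟩ := this
    exact ⟨coord i, ⟨coord i, ⟨MvPolynomial.X i, by simp⟩, rfl⟩, hi⟩
  obtain ⟨⟨g, p, hp⟩, hg⟩ := ContinuousMap.exists_mem_subalgebra_near_continuous_of_separatesPoints
    A hsep (fun x : K => f x) (continuousOn_iff_continuous_domRestrict.1 hf) ε hε
  refine ⟨p, fun x hx => ?_⟩
  have h1 := hg ⟨x, hx⟩
  have h2 : g ⟨x, hx⟩ = polyFun p x := by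
    rw [← hp]
    have : ∀ p : MvPolynomial (Fin N) ℝ,
        (MvPolynomial.aeval coord p) ⟨x, hx⟩ = polyFun p x := by
      intro p
      induction p using MvPolynomial.induction_on with
      | C a => simp [polyFun]
      | add p q hp hq => simp [hp, hq, polyFun]
      | mul_X p i hp => simp [hp, polyFun, coord]
    exact this p
  simpa [h2, Real.norm_eq_abs] using h1

/-- A continuous function on a sphere is uniformly close to the boundary values of a function with
prescribed constant Laplacian. -/
lemma exists_contDiff_lapl_eq_const {N : ℕ} (hN : 1 ≤ N) {x₀ : Euc N} {r : ℝ} (hr : 0 < r)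
    {f : Euc N → ℝ} (hf : ContinuousOn f (sphere x₀ r)) (c : ℝ) {ε : ℝ} (hε : 0 < ε) :
    ∃ H : Euc N → ℝ, ContDiff ℝ 2 H ∧ (∀ x, lapl H x = c) ∧
      ∀ x ∈ sphere x₀ r, f x ≤ H x ∧ H x ≤ f x + ε := by
  obtain ⟨p, hp⟩ := exists_polyFun_approx (isCompact_sphere x₀ r) hf (half_pos hε)
  let p' := p + MvPolynomial.C (ε / 2)
  obtain ⟨q, hq⟩ := exists_polyLapl_ballPoly_mul hN x₀ hr (MvPolynomial.C c - polyLapl N p')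
  refine ⟨polyFun (p' + ballPoly x₀ r * q), contDiff_polyFun _, fun x => ?_, fun x hx => ?_⟩
  · rw [lapl_polyFun, map_add, hq]
    simp [polyFun]
  · have h1 : ‖x - x₀‖ = r := by simpa [dist_eq_norm] using hx
    have h2 : polyFun (p' + ballPoly x₀ r * q) x = polyFun p x + ε / 2 := by
      have : polyFun (p' + ballPoly x₀ r * q) x =
          polyFun p x + ε / 2 + polyFun (ballPoly x₀ r) x * polyFun q x := by
        simp [polyFun, p']
      rw [this, polyFun_ballPoly, h1]; ring
    have := abs_lt.1 (hp x hx)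
    rw [h2]
    constructor <;> linarith

/-- If continuous functions satisfy `-Δ f j ≤ c j` in the viscosity sense in a ball and a positive
combination of them has a maximum at the center, then the same combination of the `c j` is
nonnegative. -/
lemma sum_nonneg_of_viscosity_lapl {N : ℕ} (hN : 1 ≤ N) {J : Type*} [Fintype J] [Nonempty J]
    {x₀ : Euc N} {r : ℝ} (hr : 0 < r) (f : J → Euc N → ℝ) (c μ : J → ℝ) (hμ : ∀ j, 0 < μ j)
    (hf : ∀ j, ContinuousOn (f j) (closedBall x₀ r))
    (hvisc : ∀ j, ∀ φ : Euc N → ℝ, ContDiff ℝ 2 φ → ∀ x ∈ ball x₀ r,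
      IsLocalMax (f j - φ) x → -lapl φ x ≤ c j)
    (hmax : ∀ x ∈ closedBall x₀ r, ∑ j, μ j * f j x ≤ ∑ j, μ j * f j x₀) :
    0 ≤ ∑ j, μ j * c j := by
  by_contra! hneg
  have hN' : (0 : ℝ) < N := by exact_mod_cast hN
  set S := ∑ j, μ j with hS
  have hSpos : 0 < S := Finset.sum_pos (fun j _ => hμ j) Finset.univ_nonempty
  set C := ∑ j, μ j * c j with hC
  set κ := -C / (2 * S) with hκ
  have hκpos : 0 < κ := div_pos (by linarith) (by linarith)
  have hsum : ∑ j, μ j * (c j + κ) = C / 2 := by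
    simp only [mul_add, Finset.sum_add_distrib, ← Finset.sum_mul]
    rw [← hS, ← hC, hκ]; field_simp; ring
  set ε := -C * r ^ 2 / (8 * N * S) with hεd
  have hε : 0 < ε := div_pos (mul_pos (by linarith) (by positivity)) (by positivity)
  choose H hH1 hH2 hH3 using fun j => exists_contDiff_lapl_eq_const hN hr
    ((hf j).mono sphere_subset_closedBall) (-(c j + κ)) hε
  have hle : ∀ j, f j x₀ ≤ H j x₀ := by
    intro j
    obtain ⟨y, hy, hymax⟩ := (isCompact_closedBall x₀ r).exists_isMaxOn
      (nonempty_closedBall.2 hr.le) ((hf j).sub (hH1 j).continuous.continuousOn)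
    have hyb : y ∈ sphere x₀ r := by
      by_contra hns
      have hyball : y ∈ ball x₀ r := by
        rw [← ball_union_sphere] at hy
        exact hy.resolve_right hns
      have : IsLocalMax (f j - H j) y := hymax.isLocalMax
        (mem_of_superset (isOpen_ball.mem_nhds hyball) ball_subset_closedBall)
      have := hvisc j _ (hH1 j) y hyball this
      rw [hH2] at this
      linarith
    have h1 : (f j - H j) x₀ ≤ (f j - H j) y := hymax (mem_closedBall_self hr.le)
    have h2 := (hH3 j y hyb).1
    simp only [Pi.sub_apply] at h1
    linarith
  have hfin : ∀ s : Finset J, ContDiff ℝ 2 (fun y => ∑ j ∈ s, μ j * H j y) ∧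
      ∀ x, lapl (fun y => ∑ j ∈ s, μ j * H j y) x = -∑ j ∈ s, μ j * (c j + κ) := by
    classical
    intro s
    induction s using Finset.induction_on with
    | empty => simpa using ⟨contDiff_const, fun x => lapl_const 0 x⟩
    | insert a s ha ih =>
      have h1 : ContDiff ℝ 2 (fun y => μ a * H a y) := contDiff_const.mul (hH1 a)
      simp only [Finset.sum_insert ha]
      refine ⟨h1.add ih.1, fun x => ?_⟩
      rw [lapl_add h1.contDiffAt ih.1.contDiffAt, ih.2, lapl_const_mul _ (hH1 a).contDiffAt, hH2]
      ring
  obtain ⟨hG1, hG2⟩ := hfin Finset.univ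
  have hkey := le_of_lapl_ge_of_le_sphere hN hG1 (x₀ := x₀) (r := r)
    (b := ∑ j, μ j * f j x₀ + ε * S) (c := -C / (4 * N)) hr.le
    (fun x _ => by rw [hG2, hsum]; apply le_of_eq; field_simp; ring)
    (fun x hx => by
      calc ∑ j, μ j * H j x ≤ ∑ j, μ j * (f j x + ε) := Finset.sum_le_sum fun j _ =>
            mul_le_mul_of_nonneg_left (hH3 j x hx).2 (hμ j).le
        _ = ∑ j, μ j * f j x + ε * S := by
            simp only [mul_add, Finset.sum_add_distrib, ← Finset.sum_mul, ← hS]; ring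
        _ ≤ _ := by
            have := hmax x (sphere_subset_closedBall hx)
            linarith)
    x₀ (mem_closedBall_self hr.le)
  have h1 : ∑ j, μ j * f j x₀ ≤ ∑ j, μ j * H j x₀ := Finset.sum_le_sum fun j _ =>
    mul_le_mul_of_nonneg_left (hle j) (hμ j).le
  have h2 : ε * S = -C * r ^ 2 / (8 * N) := by rw [hεd]; field_simp
  have h3 : -C / (4 * N) * (r ^ 2 - ‖x₀ - x₀‖ ^ 2) = 2 * (-C * r ^ 2 / (8 * N)) := by
    simp; field_simp; ring
  have h4 : 0 < -C * r ^ 2 / (8 * N) := div_pos (mul_pos (by linarith) (by positivity))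
    (by positivity)
  linarith

/-! ### Sup-convolutions and the maximum principle for sums -/

lemma UpperSemicontinuousOn.pos_mul {α : Type*} [TopologicalSpace α] {f : α → ℝ} {s : Set α}
    (hf : UpperSemicontinuousOn f s) {c : ℝ} (hc : 0 < c) :
    UpperSemicontinuousOn (fun x => c * f x) s := by
  intro x hx y hy
  have h1 : f x < y / c := by rw [lt_div_iff₀ hc]; linarith
  filter_upwards [hf x hx _ h1] with z hz
  rw [lt_div_iff₀ hc] at hz
  linarith

lemma sum_mul_norm_sub_sq {E J : Type*} [NormedAddCommGroup E] [InnerProductSpace ℝ E] [Fintype J]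
    (μ : J → ℝ) {m : E} (y : J → E) (hm : (∑ j, μ j) • m = ∑ j, μ j • y j) (x : E) :
    ∑ j, μ j * ‖x - y j‖ ^ 2 =
      ∑ j, μ j * ‖m - y j‖ ^ 2 + (∑ j, μ j) * ‖x - m‖ ^ 2 := by
  have h1 : ∀ j, μ j * ‖x - y j‖ ^ 2 =
      μ j * ‖m - y j‖ ^ 2 + 2 * inner ℝ (x - m) (μ j • (m - y j)) + μ j * ‖x - m‖ ^ 2 := by
    intro j
    have : x - y j = (x - m) + (m - y j) := by abel
    rw [this, norm_add_sq_real, inner_smul_right]; ring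
  simp_rw [h1]
  rw [Finset.sum_add_distrib, Finset.sum_add_distrib, ← Finset.mul_sum, ← inner_sum,
    ← Finset.sum_mul]
  have h2 : ∑ j, μ j • (m - y j) = 0 := by
    simp_rw [smul_sub]
    rw [Finset.sum_sub_distrib, ← hm, Finset.sum_smul, sub_self]
  rw [h2, inner_zero_right]; ring

lemma IsCompact.eventually_norm_sub_sq_sub_lt {E : Type*} [NormedAddCommGroup E] {A : Set E}
    (hA : IsCompact A) (K : ℝ) (x₀ : E) {γ : ℝ} (hγ : 0 < γ) :
    ∀ᶠ x in 𝓝 x₀, ∀ y ∈ A, |K * ‖x - y‖ ^ 2 - K * ‖x₀ - y‖ ^ 2| < γ := by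
  refine hA.eventually_forall_of_forall_eventually fun y _ => ?_
  have hc : Continuous fun q : E × E => |K * ‖q.1 - q.2‖ ^ 2 - K * ‖x₀ - q.2‖ ^ 2| := by fun_prop
  exact hc.continuousAt.eventually_lt continuousAt_const (by simpa using hγ)

lemma eventually_maximizer_near {E : Type*} [NormedAddCommGroup E] {A : Set E} (hA : IsCompact A)
    {f : E → ℝ} (hf : UpperSemicontinuousOn f A) (K : ℝ) {x₀ y₀ : E} (hy₀ : y₀ ∈ A)
    (hmax : ∀ y ∈ A, f y - K * ‖x₀ - y‖ ^ 2 ≤ f y₀ - K * ‖x₀ - y₀‖ ^ 2)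
    (huniq : ∀ y ∈ A, (∀ y' ∈ A, f y' - K * ‖x₀ - y'‖ ^ 2 ≤ f y - K * ‖x₀ - y‖ ^ 2) → y = y₀)
    {δ : ℝ} (hδ : 0 < δ) :
    ∀ᶠ x in 𝓝 x₀, ∀ Y ∈ A, (∀ y ∈ A, f y - K * ‖x - y‖ ^ 2 ≤ f Y - K * ‖x - Y‖ ^ 2) →
      dist Y y₀ < δ ∧ |f Y - f y₀| < δ := by
  have hpen : UpperSemicontinuousOn (fun y => f y - K * ‖x₀ - y‖ ^ 2) A := by
    simp_rw [sub_eq_add_neg]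
    exact hf.add (Continuous.continuousOn (by fun_prop)).upperSemicontinuousOn
  have near : ∀ d > 0, ∀ᶠ x in 𝓝 x₀, ∀ Y ∈ A,
      (∀ y ∈ A, f y - K * ‖x - y‖ ^ 2 ≤ f Y - K * ‖x - Y‖ ^ 2) → dist Y y₀ < d := by
    intro d hd
    rcases (A \ ball y₀ d).eq_empty_or_nonempty with he | hne
    · refine Eventually.of_forall fun x Y hY _ => ?_
      have := Set.sdiff_eq_empty.1 he hY
      simpa using this
    obtain ⟨y₁, hy₁, hy₁max⟩ := UpperSemicontinuousOn.exists_isMaxOn hne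
      (hA.diff isOpen_ball) (hpen.mono sdiff_subset)
    have hlt : f y₁ - K * ‖x₀ - y₁‖ ^ 2 < f y₀ - K * ‖x₀ - y₀‖ ^ 2 := by
      refine lt_of_le_of_ne (hmax y₁ hy₁.1) fun he => ?_
      have : y₁ = y₀ := huniq y₁ hy₁.1 fun y' hy' => (hmax y' hy').trans he.ge
      exact hy₁.2 (this ▸ mem_ball_self hd)
    filter_upwards [hA.eventually_norm_sub_sq_sub_lt K x₀ (half_pos (sub_pos.2 hlt))]
      with x hx Y hY hYmax
    by_contra hcon
    have h1 : f Y - K * ‖x₀ - Y‖ ^ 2 ≤ f y₁ - K * ‖x₀ - y₁‖ ^ 2 := hy₁max ⟨hY, hcon⟩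
    have h2 := abs_lt.1 (hx Y hY)
    have h3 := abs_lt.1 (hx y₀ hy₀)
    have h4 := hYmax y₀ hy₀
    linarith
  obtain ⟨d₁, hd₁, hd₁f⟩ := Metric.eventually_nhds_iff.1
    (eventually_nhdsWithin_iff.1 (hf y₀ hy₀ (f y₀ + δ) (by linarith)))
  have hc : ContinuousAt (fun q : E × E => K * ‖q.1 - q.2‖ ^ 2 - K * ‖q.1 - y₀‖ ^ 2) (x₀, y₀) := by
    fun_prop
  have hc' : ∀ᶠ q in 𝓝 (x₀, y₀), -δ < K * ‖q.1 - q.2‖ ^ 2 - K * ‖q.1 - y₀‖ ^ 2 :=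
    continuousAt_const.eventually_lt hc (by simpa using hδ)
  rw [nhds_prod_eq] at hc'
  obtain ⟨pa, hpa, pb, hpb, hpab⟩ := Filter.eventually_prod_iff.1 hc'
  obtain ⟨d₂, hd₂, hd₂f⟩ := Metric.eventually_nhds_iff.1 hpb
  filter_upwards [near (min δ (min d₁ d₂)) (by positivity), hpa] with x hx hxa Y hY hYmax
  have hd := hx Y hY hYmax
  rw [lt_min_iff, lt_min_iff] at hd
  refine ⟨hd.1, abs_lt.2 ⟨?_, ?_⟩⟩
  · have := hpab hxa (hd₂f hd.2.2)
    have h4 := hYmax y₀ hy₀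
    simp only at this
    linarith
  · have := hd₁f hd.2.1 hY
    linarith

/-- At a maximum point of the penalized sum, the viscosity inequalities may be added. -/
lemma sum_nonneg_of_penalized_max {N : ℕ} (hN : 1 ≤ N) {J : Type*} [Fintype J] [Nonempty J]
    {A O : J → Set (Euc N)} (hA : ∀ j, IsCompact (A j)) (hO : ∀ j, IsOpen (O j))
    {f : J → Euc N → ℝ} (hf : ∀ j, UpperSemicontinuousOn (f j) (A j))
    {μ : J → ℝ} (hμ : ∀ j, 0 < μ j) {Q : J → Euc N → ℝ → Euc N → ℝ}
    (hQ : ∀ j, Continuous fun q : Euc N × ℝ × Euc N => Q j q.1 q.2.1 q.2.2)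
    (hvisc : ∀ j, ∀ y ∈ A j ∩ O j, ∀ φ, ContDiff ℝ 2 φ → IsLocalMaxOn (f j - φ) (A j) y →
      -lapl φ y ≤ Q j y (f j y) (gradient φ y))
    {K : ℝ} (hK : 0 < K) {x₀ : Euc N} {y₀ : J → Euc N} (hy₀ : ∀ j, y₀ j ∈ A j ∩ O j)
    (hmax : ∀ x, ∀ y : J → Euc N, (∀ j, y j ∈ A j) →
      ∑ j, μ j * (f j (y j) - K * ‖x - y j‖ ^ 2) ≤
        ∑ j, μ j * (f j (y₀ j) - K * ‖x₀ - y₀ j‖ ^ 2)) :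
    ∑ j, μ j • ((2 * K) • (y₀ j - x₀)) = 0 ∧
      0 ≤ ∑ j, μ j * Q j (y₀ j) (f j (y₀ j)) ((2 * K) • (y₀ j - x₀)) := by
  classical
  have hμs : 0 < ∑ j, μ j := Finset.sum_pos (fun j _ => hμ j) Finset.univ_nonempty
  have center : ∀ y : J → Euc N, (∀ j, y j ∈ A j) →
      (∀ x, ∑ j, μ j * (f j (y j) - K * ‖x - y j‖ ^ 2) ≤
        ∑ j, μ j * (f j (y j) - K * ‖x₀ - y j‖ ^ 2)) →
      (∑ j, μ j) • x₀ = ∑ j, μ j • y j := by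
    intro y _ hx
    set m := (∑ j, μ j)⁻¹ • ∑ j, μ j • y j with hm
    have hm' : (∑ j, μ j) • m = ∑ j, μ j • y j := by rw [hm, smul_inv_smul₀ hμs.ne']
    have h1 := hx m
    simp_rw [mul_sub, Finset.sum_sub_distrib, mul_left_comm _ K, ← Finset.mul_sum] at h1
    rw [sum_mul_norm_sub_sq μ y hm' x₀] at h1
    have h2 : K * ((∑ j, μ j) * ‖x₀ - m‖ ^ 2) ≤ 0 := by nlinarith
    have h3 : ‖x₀ - m‖ = 0 := by
      by_contra h0
      have : 0 < ‖x₀ - m‖ := lt_of_le_of_ne (norm_nonneg _) (Ne.symm h0)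
      have : 0 < K * ((∑ j, μ j) * ‖x₀ - m‖ ^ 2) := by positivity
      linarith
    rw [← hm', sub_eq_zero.1 (norm_eq_zero.1 h3)]
  have hy₀A : ∀ j, y₀ j ∈ A j := fun j => (hy₀ j).1
  have hcenter := center y₀ hy₀A fun x => hmax x y₀ hy₀A
  have update_max : ∀ i, ∀ y ∈ A i, f i (y₀ i) - K * ‖x₀ - y₀ i‖ ^ 2 ≤ f i y - K * ‖x₀ - y‖ ^ 2 →
      ∑ j, μ j * (f j (y₀ j) - K * ‖x₀ - y₀ j‖ ^ 2) ≤
      ∑ j, μ j * (f j (Function.update y₀ i y j) - K * ‖x₀ - Function.update y₀ i y j‖ ^ 2) := by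
    intro i y _ h
    refine Finset.sum_le_sum fun j _ => ?_
    by_cases hj : j = i
    · subst hj; simpa using mul_le_mul_of_nonneg_left h (hμ j).le
    · simp [hj]
  have update_mem : ∀ i, ∀ y ∈ A i, ∀ j, Function.update y₀ i y j ∈ A j := by
    intro i y hy j
    by_cases hj : j = i
    · subst hj; simpa using hy
    · simpa [hj] using hy₀A j
  have max_i : ∀ i, ∀ y ∈ A i, f i y - K * ‖x₀ - y‖ ^ 2 ≤ f i (y₀ i) - K * ‖x₀ - y₀ i‖ ^ 2 := by
    intro i y hy
    by_contra! hcon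
    have h1 := hmax x₀ _ (update_mem i y hy)
    refine absurd h1 (not_le.2 (Finset.sum_lt_sum (fun j _ => ?_) ⟨i, Finset.mem_univ i, ?_⟩))
    · by_cases hj : j = i
      · subst hj; simpa using mul_le_mul_of_nonneg_left hcon.le (hμ j).le
      · simp [hj]
    · simpa using mul_lt_mul_of_pos_left hcon (hμ i)
  have uniq : ∀ i, ∀ y ∈ A i, (∀ y' ∈ A i, f i y' - K * ‖x₀ - y'‖ ^ 2 ≤ f i y - K * ‖x₀ - y‖ ^ 2) →
      y = y₀ i := by
    intro i y hy hymax
    have h1 := update_max i y hy (hymax _ (hy₀A i))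
    have h2 := center _ (update_mem i y hy) fun x => (hmax x _ (update_mem i y hy)).trans h1
    rw [hcenter] at h2
    have h3 : ∑ j, μ j • (y₀ j - Function.update y₀ i y j) = 0 := by
      simp_rw [smul_sub]; rw [Finset.sum_sub_distrib, h2, sub_self]
    rw [Finset.sum_eq_single i (fun j _ hj => by simp [hj]) (by simp)] at h3
    have h4 := (smul_eq_zero.1 h3).resolve_left (hμ i).ne'
    simpa using (sub_eq_zero.1 h4).symm
  refine ⟨?_, ?_⟩
  · have : ∀ j, μ j • ((2 * K) • (y₀ j - x₀)) = (2 * K) • (μ j • y₀ j - μ j • x₀) := by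
      intro j; rw [smul_comm, smul_sub]
    simp_rw [this]
    rw [← Finset.smul_sum, Finset.sum_sub_distrib, ← hcenter, Finset.sum_smul, sub_self, smul_zero]
  have exY : ∀ j x, ∃ Y ∈ A j, ∀ y ∈ A j, f j y - K * ‖x - y‖ ^ 2 ≤ f j Y - K * ‖x - Y‖ ^ 2 := by
    intro j x
    have hpen : UpperSemicontinuousOn (fun y => f j y - K * ‖x - y‖ ^ 2) (A j) := by
      simp_rw [sub_eq_add_neg]
      exact (hf j).add (Continuous.continuousOn (by fun_prop)).upperSemicontinuousOn
    obtain ⟨Y, hY, hYm⟩ := UpperSemicontinuousOn.exists_isMaxOn ⟨_, hy₀A j⟩ (hA j) hpen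
    exact ⟨Y, hY, fun y hy => hYm hy⟩
  choose Y hYA hYmax using exY
  set g : J → Euc N → ℝ := fun j x => f j (Y j x) - K * ‖x - Y j x‖ ^ 2 with hg
  have hgcont : ∀ j, Continuous (g j) := by
    intro j
    rw [continuous_iff_continuousAt]
    intro x
    rw [Metric.continuousAt_iff']
    intro γ hγ
    filter_upwards [(hA j).eventually_norm_sub_sq_sub_lt K x hγ] with x' hx'
    rw [Real.dist_eq, abs_lt]
    have h1 := abs_lt.1 (hx' _ (hYA j x))
    have h2 := abs_lt.1 (hx' _ (hYA j x'))
    have h3 := hYmax j x _ (hYA j x')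
    have h4 := hYmax j x' _ (hYA j x)
    simp only [hg]
    constructor <;> linarith
  refine le_of_forall_pos_le_add fun η hη => ?_
  set c : J → ℝ := fun j => Q j (y₀ j) (f j (y₀ j)) ((2 * K) • (y₀ j - x₀)) + η / ∑ j, μ j with hc
  have near : ∀ j, ∀ᶠ x in 𝓝 x₀, Y j x ∈ O j ∧
      Q j (Y j x) (f j (Y j x)) ((2 * K) • (Y j x - x)) ≤ c j := by
    intro j
    have tY : Tendsto (fun x => (x, Y j x, f j (Y j x))) (𝓝 x₀) (𝓝 (x₀, y₀ j, f j (y₀ j))) := by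
      refine tendsto_id.prodMk_nhds (Tendsto.prodMk_nhds ?_ ?_)
      · refine Metric.tendsto_nhds.2 fun δ hδ => ?_
        filter_upwards [eventually_maximizer_near (hA j) (hf j) K (hy₀A j) (max_i j) (uniq j) hδ]
          with x hx using (hx _ (hYA j x) (hYmax j x)).1
      · refine Metric.tendsto_nhds.2 fun δ hδ => ?_
        filter_upwards [eventually_maximizer_near (hA j) (hf j) K (hy₀A j) (max_i j) (uniq j) hδ]
          with x hx using (hx _ (hYA j x) (hYmax j x)).2
    have hcont : Continuous fun q : Euc N × Euc N × ℝ =>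
        Q j q.2.1 q.2.2 ((2 * K) • (q.2.1 - q.1)) :=
      (hQ j).comp (by fun_prop : Continuous fun q : Euc N × Euc N × ℝ =>
        (q.2.1, q.2.2, (2 * K) • (q.2.1 - q.1)))
    have h1 := (hcont.tendsto (x₀, y₀ j, f j (y₀ j))).comp tY
    have h2 := h1.eventually_lt_const (u := c j) (by
      simp only [hc]; have : 0 < η / ∑ j, μ j := by positivity
      linarith)
    have h3 : ∀ᶠ x in 𝓝 x₀, Y j x ∈ O j :=
      ((continuous_fst.tendsto _).comp ((continuous_snd.tendsto _).comp tY)).eventually_mem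
        ((hO j).mem_nhds (hy₀ j).2)
    filter_upwards [h2, h3] with x hx hx' using ⟨hx', hx.le⟩
  obtain ⟨r, hr, hball⟩ := Metric.eventually_nhds_iff_ball.1 (eventually_all.2 near)
  have key := sum_nonneg_of_viscosity_lapl hN (x₀ := x₀) hr g c μ hμ
    (fun j => (hgcont j).continuousOn) ?_ ?_
  · simp only [hc, mul_add, Finset.sum_add_distrib, ← Finset.sum_mul] at key
    rwa [mul_div_cancel₀ _ hμs.ne'] at key
  · intro j φ hφ x hx hloc
    obtain ⟨hYO, hYQ⟩ := hball x hx j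
    have hgrad : gradient φ x = (2 * K) • (Y j x - x) := by
      have hmx : IsLocalMax ((fun x' => (-K) * ‖x' - Y j x‖ ^ 2) - φ) x := by
        filter_upwards [hloc] with x' hx'
        have := hYmax j x' _ (hYA j x)
        simp only [hg, Pi.sub_apply] at hx' ⊢
        linarith
      have hsm : ContDiff ℝ 2 fun x' : Euc N => ‖x' - Y j x‖ ^ 2 := contDiff_norm_sub_sq _
      rw [(gradient_eq_and_lapl_le_of_isLocalMax hmx (contDiff_const.mul hsm).contDiffAt
        hφ.contDiffAt).1, gradient_const_mul _ (hsm.differentiable (by norm_num) x),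
        gradient_norm_sub_sq]
      module
    have hloc' : IsLocalMaxOn (f j - fun y => φ (y + (x - Y j x))) (A j) (Y j x) := by
      have ht : Tendsto (fun y => y + (x - Y j x)) (𝓝[A j] (Y j x)) (𝓝 x) := by
        have : Continuous fun y => y + (x - Y j x) := by fun_prop
        have h1 := this.tendsto (Y j x)
        rw [add_sub_cancel] at h1
        exact h1.mono_left nhdsWithin_le_nhds
      filter_upwards [ht.eventually hloc, self_mem_nhdsWithin] with y hy hyA
      have h1 := hYmax j (y + (x - Y j x)) y hyA
      have h2 : y + (x - Y j x) - y = x - Y j x := by abel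
      rw [h2] at h1
      simp only [hg, Pi.sub_apply, add_sub_cancel] at hy ⊢
      linarith
    have h1 := hvisc j (Y j x) ⟨hYA j x, hYO⟩ _ (hφ.comp (by fun_prop)) hloc'
    simp only [lapl_comp_add_right, gradient_comp_add_right, Function.comp_def, add_sub_cancel,
      hgrad] at h1
    exact h1.trans hYQ
  · intro x _
    have h1 := hmax x (fun j => Y j x) fun j => hYA j x
    refine h1.trans (Finset.sum_le_sum fun j _ => ?_)
    exact mul_le_mul_of_nonneg_left (hYmax j x₀ _ (hy₀A j)) (hμ j).le

/-- The maximum principle for sums of upper semicontinuous viscosity subsolutions. -/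
lemma exists_sum_viscosity_nonneg {N : ℕ} (hN : 1 ≤ N) {J : Type*} [Fintype J] [Nonempty J]
    {A O : J → Set (Euc N)} (hA : ∀ j, IsCompact (A j)) (hO : ∀ j, IsOpen (O j))
    {f : J → Euc N → ℝ} (hf : ∀ j, UpperSemicontinuousOn (f j) (A j))
    {μ : J → ℝ} (hμ : ∀ j, 0 < μ j) {Q : J → Euc N → ℝ → Euc N → ℝ}
    (hQ : ∀ j, Continuous fun q : Euc N × ℝ × Euc N => Q j q.1 q.2.1 q.2.2)
    (hvisc : ∀ j, ∀ y ∈ A j ∩ O j, ∀ φ, ContDiff ℝ 2 φ → IsLocalMaxOn (f j - φ) (A j) y →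
      -lapl φ y ≤ Q j y (f j y) (gradient φ y))
    {x₀ : Euc N} (hx₀ : ∀ j, x₀ ∈ A j)
    (hmem : ∀ z, (∀ j, z ∈ A j) → (∀ x, (∀ j, x ∈ A j) → ∑ j, μ j * f j x ≤ ∑ j, μ j * f j z) →
      ∀ j, z ∈ O j)
    {δ : ℝ} (hδ : 0 < δ) :
    ∃ z, (∀ j, z ∈ A j) ∧ (∀ x, (∀ j, x ∈ A j) → ∑ j, μ j * f j x ≤ ∑ j, μ j * f j z) ∧
      ∃ y p : J → Euc N, (∀ j, y j ∈ A j) ∧ (∀ j, dist (y j) z < δ) ∧ ∑ j, μ j • p j = 0 ∧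
        ∑ j, μ j * f j z ≤ ∑ j, μ j * f j (y j) ∧
        0 ≤ ∑ j, μ j * Q j (y j) (f j (y j)) (p j) := by
  classical
  have hμs : 0 < ∑ j, μ j := Finset.sum_pos (fun j _ => hμ j) Finset.univ_nonempty
  set B : Set (J → Euc N) := Set.pi univ A with hB
  have hBc : IsCompact B := isCompact_univ_pi hA
  have hBne : B.Nonempty := ⟨fun _ => x₀, fun j _ => hx₀ j⟩
  have hsum : UpperSemicontinuousOn (fun y : J → Euc N => ∑ j, μ j * f j (y j)) B := by
    refine upperSemicontinuousOn_sum fun j _ => ?_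
    exact UpperSemicontinuousOn.comp ((hf j).pos_mul (hμ j)) (g := fun y : J → Euc N => y j)
      (by fun_prop) fun y hy => hy j (mem_univ j)
  set ctr : (J → Euc N) → Euc N := fun y => (∑ j, μ j)⁻¹ • ∑ j, μ j • y j with hctr
  have hctr' : ∀ y, (∑ j, μ j) • ctr y = ∑ j, μ j • y j := fun y => by
    rw [hctr, smul_inv_smul₀ hμs.ne']
  have expand : ∀ (K : ℝ) (x : Euc N) (y : J → Euc N),
      ∑ j, μ j * (f j (y j) - K * ‖x - y j‖ ^ 2) =
        ∑ j, μ j * f j (y j) - K * ∑ j, μ j * ‖x - y j‖ ^ 2 := by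
    intro K x y
    simp_rw [mul_sub, Finset.sum_sub_distrib, mul_left_comm _ K, ← Finset.mul_sum]
  have exmax : ∀ n : ℕ, ∃ y ∈ B, ∀ x, ∀ y' : J → Euc N, (∀ j, y' j ∈ A j) →
      ∑ j, μ j * (f j (y' j) - (n + 1 : ℝ) * ‖x - y' j‖ ^ 2) ≤
        ∑ j, μ j * (f j (y j) - (n + 1 : ℝ) * ‖ctr y - y j‖ ^ 2) := by
    intro n
    have husc : UpperSemicontinuousOn (fun y : J → Euc N => ∑ j, μ j * f j (y j) +
        -((n + 1 : ℝ) * ∑ j, μ j * ‖ctr y - y j‖ ^ 2)) B :=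
      hsum.add (Continuous.continuousOn (by simp only [hctr]; fun_prop)).upperSemicontinuousOn
    obtain ⟨y, hy, hymax⟩ := UpperSemicontinuousOn.exists_isMaxOn hBne hBc husc
    refine ⟨y, hy, fun x y' hy' => ?_⟩
    have h1 : (∑ j, μ j * f j (y' j) + -((n + 1 : ℝ) * ∑ j, μ j * ‖ctr y' - y' j‖ ^ 2)) ≤
      ∑ j, μ j * f j (y j) + -((n + 1 : ℝ) * ∑ j, μ j * ‖ctr y - y j‖ ^ 2) :=
      hymax fun j _ => hy' j
    rw [expand, expand, sum_mul_norm_sub_sq μ y' (hctr' y') x]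
    have : 0 ≤ (n + 1 : ℝ) * ((∑ j, μ j) * ‖x - ctr y'‖ ^ 2) := by positivity
    linarith
  choose y hyB hymax using exmax
  have hyA : ∀ n j, y n j ∈ A j := fun n j => hyB n j (mem_univ j)
  have hval : ∀ (n : ℕ) x, (∀ j, x ∈ A j) →
      ∑ j, μ j * f j x + (n + 1 : ℝ) * ∑ j, μ j * ‖ctr (y n) - y n j‖ ^ 2 ≤
        ∑ j, μ j * f j (y n j) := by
    intro n x hx
    have h1 := hymax n x (fun _ => x) hx
    rw [expand, expand] at h1
    simp only [sub_self, norm_zero] at h1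
    simp at h1
    linarith
  obtain ⟨yM, hyM, hyMmax⟩ := UpperSemicontinuousOn.exists_isMaxOn hBne hBc hsum
  set C := ∑ j, μ j * f j (yM j) - ∑ j, μ j * f j x₀ with hC
  have hpen : ∀ n : ℕ, (n + 1 : ℝ) * ∑ j, μ j * ‖ctr (y n) - y n j‖ ^ 2 ≤ C := by
    intro n
    have h1 : ∑ j, μ j * f j (y n j) ≤ ∑ j, μ j * f j (yM j) := hyMmax (hyB n)
    have h2 := hval n x₀ hx₀
    linarith
  have hS : Tendsto (fun n => ∑ j, μ j * ‖ctr (y n) - y n j‖ ^ 2) atTop (𝓝 0) := by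
    refine squeeze_zero (fun n => Finset.sum_nonneg fun j _ => ?_) (fun n => ?_)
      (tendsto_const_nhds.div_atTop (tendsto_natCast_atTop_atTop.atTop_add
        (tendsto_const_nhds (x := (1 : ℝ)))) : Tendsto (fun n : ℕ => C / ((n : ℝ) + 1)) atTop (𝓝 0))
    · have := (hμ j).le; positivity
    · rw [le_div_iff₀ (by positivity), mul_comm]; exact hpen n
  obtain ⟨y', hy'B, σ, hσ, hlim⟩ := hBc.tendsto_subseq hyB
  have hctrc : Continuous ctr := by simp only [hctr]; fun_prop
  set z := ctr y' with hz
  have hS' : ∑ j, μ j * ‖ctr y' - y' j‖ ^ 2 = 0 := by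
    have hc : Continuous fun y : J → Euc N => ∑ j, μ j * ‖ctr y - y j‖ ^ 2 := by fun_prop
    exact tendsto_nhds_unique ((hc.tendsto y').comp hlim) (hS.comp hσ.tendsto_atTop)
  have hzy : ∀ j, y' j = z := by
    intro j
    have h1 := (Finset.sum_eq_zero_iff_of_nonneg (fun j _ => by
      have := (hμ j).le; positivity)).1 hS' j (Finset.mem_univ j)
    have h2 : ‖ctr y' - y' j‖ = 0 := by
      simpa using (mul_eq_zero.1 h1).resolve_left (hμ j).ne'
    exact (sub_eq_zero.1 (norm_eq_zero.1 h2)).symm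
  have hzA : ∀ j, z ∈ A j := fun j => hzy j ▸ hy'B j (mem_univ j)
  have hzmax : ∀ x, (∀ j, x ∈ A j) → ∑ j, μ j * f j x ≤ ∑ j, μ j * f j z := by
    intro x hx
    by_contra! hcon
    have h1 := hsum y' hy'B (∑ j, μ j * f j x) (by simpa only [hzy] using hcon)
    have ht : Tendsto (y ∘ σ) atTop (𝓝[B] y') :=
      tendsto_nhdsWithin_iff.2 ⟨hlim, Eventually.of_forall fun n => hyB _⟩
    obtain ⟨n, hn⟩ := (ht.eventually h1).exists
    have h2 := hval (σ n) x hx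
    have h3 : 0 ≤ ((σ n : ℝ) + 1) * ∑ j, μ j * ‖ctr (y (σ n)) - y (σ n) j‖ ^ 2 :=
      mul_nonneg (by positivity) (Finset.sum_nonneg fun j _ => by have := (hμ j).le; positivity)
    simp only [Function.comp_apply] at hn
    linarith
  have hnear : ∀ᶠ n in atTop, ∀ j, y (σ n) j ∈ O j ∧ dist (y (σ n) j) z < δ := by
    refine eventually_all.2 fun j => ?_
    have hj : Tendsto (fun n => y (σ n) j) atTop (𝓝 z) := by
      have := (tendsto_pi_nhds.1 hlim) j
      rwa [hzy j] at this
    exact (hj.eventually_mem ((hO j).mem_nhds (hmem z hzA hzmax j))).and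
      (Metric.tendsto_nhds.1 hj δ hδ)
  obtain ⟨n, hn⟩ := hnear.exists
  have key := sum_nonneg_of_penalized_max hN hA hO hf hμ hQ hvisc (K := (σ n : ℝ) + 1)
    (by positivity) (fun j => ⟨hyA (σ n) j, (hn j).1⟩) (hymax (σ n))
  refine ⟨z, hzA, hzmax, y (σ n), _, hyA _, fun j => (hn j).2, key.1, ?_, key.2⟩
  have h2 := hval (σ n) z hzA
  have h3 : 0 ≤ ((σ n : ℝ) + 1) * ∑ j, μ j * ‖ctr (y (σ n)) - y (σ n) j‖ ^ 2 :=
    mul_nonneg (by positivity) (Finset.sum_nonneg fun j _ => by have := (hμ j).le; positivity)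
  linarith

/-! ### Viscosity inequalities with local test functions -/

lemma statOp_congr {N : ℕ} {h φ ψ : Euc N → ℝ} {lam m r : ℝ} {x : Euc N} (hφ : φ =ᶠ[𝓝 x] ψ) :
    statOp h lam m φ r x = statOp h lam m ψ r x := by
  rw [statOp, statOp, lapl_congr hφ, norm_gradient_eq, norm_gradient_eq, hφ.fderiv_eq]

lemma IsLocalMaxOn.sub_congr {N : ℕ} {u φ ψ : Euc N → ℝ} {s : Set (Euc N)} {x : Euc N}
    (h : IsLocalMaxOn (u - φ) s x) (hφ : ψ =ᶠ[𝓝 x] φ) : IsLocalMaxOn (u - ψ) s x := by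
  filter_upwards [h, hφ.filter_mono nhdsWithin_le_nhds] with y hy hy'
  simpa [hy', hφ.self_of_nhds] using hy

lemma IsLocalMinOn.sub_congr {N : ℕ} {u φ ψ : Euc N → ℝ} {s : Set (Euc N)} {x : Euc N}
    (h : IsLocalMinOn (u - φ) s x) (hφ : ψ =ᶠ[𝓝 x] φ) : IsLocalMinOn (u - ψ) s x := by
  filter_upwards [h, hφ.filter_mono nhdsWithin_le_nhds] with y hy hy'
  simpa [hy', hφ.self_of_nhds] using hy

lemma IsStatSub.of_contDiffAt {N : ℕ} {Ω : Set (Euc N)} {h k u φ : Euc N → ℝ} {lam m : ℝ}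
    (hu : IsStatSub Ω h k lam m u) {x : Euc N} (hφ : ContDiffAt ℝ 2 φ x) (hx : x ∈ closure Ω)
    (hmax : IsLocalMaxOn (u - φ) (closure Ω) x) :
    (x ∈ Ω → statOp h lam m φ (u x) x ≤ 0) ∧
      (x ∈ frontier Ω → min (statOp h lam m φ (u x) x) (u x - k x) ≤ 0) := by
  obtain ⟨ψ, hψ, hψφ⟩ := exists_contDiff_eventuallyEq hφ
  rw [← statOp_congr hψφ]
  exact hu.2 ψ hψ x hx (hmax.sub_congr hψφ)

lemma IsStatSuper.of_contDiffAt {N : ℕ} {Ω : Set (Euc N)} {h k v φ : Euc N → ℝ} {lam m : ℝ}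
    (hv : IsStatSuper Ω h k lam m v) {x : Euc N} (hφ : ContDiffAt ℝ 2 φ x) (hx : x ∈ closure Ω)
    (hmin : IsLocalMinOn (v - φ) (closure Ω) x) :
    (x ∈ Ω → 0 ≤ statOp h lam m φ (v x) x) ∧
      (x ∈ frontier Ω → 0 ≤ max (statOp h lam m φ (v x) x) (v x - k x)) := by
  obtain ⟨ψ, hψ, hψφ⟩ := exists_contDiff_eventuallyEq hφ
  rw [← statOp_congr hψφ]
  exact hv.2 ψ hψ x hx (hmin.sub_congr hψφ)

lemma mem_or_mem_frontier_of_mem_closure {X : Type*} [TopologicalSpace X] {s : Set X} {x : X}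
    (hx : x ∈ closure s) : x ∈ s ∨ x ∈ frontier s := by
  rwa [closure_eq_self_union_frontier] at hx

/-! ### A priori bounds and barriers -/

lemma IsStatSub.exists_upper_bound {N : ℕ} (hN : 1 ≤ N) {Ω : Set (Euc N)}
    (hΩb : Bornology.IsBounded Ω) {h k : Euc N → ℝ} (hh : Continuous h) (hk : Continuous k)
    {lam m : ℝ} (hlam : 0 ≤ lam) :
    ∃ C : ℝ, ∀ u, IsStatSub Ω h k lam m u → ∀ x ∈ closure Ω, u x ≤ C := by
  have hc : IsCompact (closure Ω) := hΩb.isCompact_closure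
  obtain ⟨R, hR⟩ := hc.exists_bound_of_continuousOn (f := fun x : Euc N => x) (by fun_prop)
  obtain ⟨H, hH⟩ := hc.exists_bound_of_continuousOn hh.continuousOn
  obtain ⟨K, hK⟩ := hc.exists_bound_of_continuousOn hk.continuousOn
  set A := |H| + 1 with hA
  have hApos : 0 < A := by positivity
  refine ⟨|K| + A * R ^ 2, fun u hu x hx => ?_⟩
  set φ : Euc N → ℝ := fun y => (-A) * ‖y - 0‖ ^ 2 with hφ
  have hφc : ContDiff ℝ 2 φ := contDiff_const.mul (contDiff_norm_sub_sq 0)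
  have husc : UpperSemicontinuousOn (fun y => u y + -φ y) (closure Ω) :=
    hu.1.add hφc.continuous.neg.continuousOn.upperSemicontinuousOn
  obtain ⟨y, hy, hymax⟩ := UpperSemicontinuousOn.exists_isMaxOn ⟨x, hx⟩ hc husc
  have hloc : IsLocalMaxOn (u - φ) (closure Ω) y := by
    filter_upwards [hymax.localize] with y' hy'
    simpa only [Pi.sub_apply, ← sub_eq_add_neg] using hy'
  have hlap : lapl φ y = -A * (2 * N) := by
    rw [hφ, lapl_const_mul _ (contDiff_norm_sub_sq 0).contDiffAt, lapl_norm_sub_sq]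
  have huy : u y ≤ |K| := by
    have hop : statOp h lam m φ (u y) y ≤ 0 → u y ≤ |K| := by
      intro hop
      by_contra! hcon
      have h1 : 0 ≤ lam * u y := mul_nonneg hlam ((abs_nonneg _).trans hcon.le)
      have h2 : 0 ≤ ‖gradient φ y‖ ^ m := by positivity
      have h3 : h y ≤ |H| := (le_abs_self _).trans ((hH y hy).trans (le_abs_self _))
      have h4 : (1 : ℝ) ≤ N := by exact_mod_cast hN
      rw [statOp, hlap] at hop
      nlinarith
    obtain ⟨hin, hbd⟩ := hu.2 φ hφc y hy hloc
    rcases mem_or_mem_frontier_of_mem_closure hy with hyΩ | hyF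
    · exact hop (hin hyΩ)
    · rcases min_le_iff.1 (hbd hyF) with h1 | h1
      · exact hop h1
      · have := (le_abs_self _).trans ((hK y hy).trans (le_abs_self _))
        linarith
  have h1 : u x + -φ x ≤ u y + -φ y := hymax hx
  have h2 : ‖y‖ ≤ R := hR y hy
  have h3 : ‖y‖ ^ 2 ≤ R ^ 2 := by gcongr
  simp only [hφ, sub_zero] at h1
  nlinarith [sq_nonneg ‖x‖]

lemma HasC2Boundary.exists_defining {N : ℕ} {Ω : Set (Euc N)} (hΩ : HasC2Boundary Ω) :
    ∃ ρ : Euc N → ℝ, ContDiff ℝ 2 ρ ∧ Ω = {x | ρ x < 0} ∧ closure Ω = {x | ρ x ≤ 0} ∧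
      ∀ x ∈ frontier Ω, ρ x = 0 ∧ gradient ρ x ≠ 0 := by
  obtain ⟨ρ, hρ, h1, h2, h3⟩ := hΩ
  refine ⟨ρ, hρ, h1, ?_, fun x hx => ⟨by rw [h2] at hx; exact hx, h3 x hx⟩⟩
  rw [closure_eq_self_union_frontier, h2]
  ext x
  conv_lhs => rw [h1]
  simp [le_iff_lt_or_eq]

lemma barrier_arith {c G B s D T g l : ℝ} (hc : 0 < c) (hG : 0 < G) (hBpos : 0 < B)
    (hB : B = c ^ 2 / (8 * G ^ 2)) (hs : 0 < s) (hs1 : s ≤ 1) (hs2 : s ≤ c ^ 2 / (4 * G))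
    (hD : 0 ≤ D) (hs3 : s ≤ B * c ^ 2 / (2 * (|T| + D + 1))) (hg : c ≤ g) (hl : |l| ≤ G) :
    T + D + 2 * B ^ 2 * G ^ 2 / s ^ 2 ≤ -(B * (s⁻¹ * (-l) + -(s ^ 2)⁻¹ * g ^ 2)) := by
  have hs2' : G * s ≤ c ^ 2 / 4 := by
    rw [le_div_iff₀ (by positivity)] at hs2
    linarith
  have hs3' : (|T| + D + 1) * s ≤ B * c ^ 2 / 2 := by
    rw [le_div_iff₀ (by positivity)] at hs3
    linarith
  have hBG : 2 * B * G ^ 2 = c ^ 2 / 4 := by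
    rw [hB]; field_simp; norm_num
  have h1 : c ^ 2 / 2 ≤ c ^ 2 - G * s - 2 * B * G ^ 2 := by rw [hBG]; linarith
  have h2 : |T| + D + 1 ≤ (B / s ^ 2) * (c ^ 2 / 2) := by
    rw [div_mul_eq_mul_div, le_div_iff₀ (by positivity)]
    have : (|T| + D + 1) * s ^ 2 ≤ (|T| + D + 1) * s := by
      have : s ^ 2 ≤ s := by nlinarith
      gcongr
    linarith
  have h3 : (B / s ^ 2) * (c ^ 2 / 2) ≤ (B / s ^ 2) * (c ^ 2 - G * s - 2 * B * G ^ 2) := by gcongr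
  have e : -(B * (s⁻¹ * (-l) + -(s ^ 2)⁻¹ * g ^ 2)) = (B / s ^ 2) * (g ^ 2 + l * s) := by
    field_simp; ring
  have h4 : c ^ 2 ≤ g ^ 2 := by gcongr
  have h5 : -(G * s) ≤ l * s := by
    have := (abs_le.1 hl).1
    nlinarith
  have h6 : (B / s ^ 2) * (c ^ 2 - G * s) ≤ (B / s ^ 2) * (g ^ 2 + l * s) :=
    mul_le_mul_of_nonneg_left (by linarith) (by positivity)
  have e2 : (B / s ^ 2) * (c ^ 2 - G * s - 2 * B * G ^ 2) =
      (B / s ^ 2) * (c ^ 2 - G * s) - 2 * B ^ 2 * G ^ 2 / s ^ 2 := by ring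
  rw [e]
  have := le_abs_self T
  linarith

set_option maxHeartbeats 800000 in
/-- A function vanishing at `z`, whose sublevel sets in `closure Ω` concentrate at `z` and on which
`-Δφ - |Dφ|²` is as large as we please. -/
lemma HasC2Boundary.exists_barrier {N : ℕ} {Ω : Set (Euc N)} (hΩ : HasC2Boundary Ω) {z : Euc N}
    (hz : z ∈ frontier Ω) {r : ℝ} (hr : 0 < r) {R : ℝ} (hR : 0 ≤ R) (T : ℝ) :
    ∃ φ : Euc N → ℝ, φ z = 0 ∧ (∀ x ∈ closure Ω, 0 ≤ φ x ∧ ContDiffAt ℝ 2 φ x) ∧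
      ∀ x ∈ closure Ω, φ x ≤ R → dist x z < r ∧ T + ‖gradient φ x‖ ^ 2 ≤ -lapl φ x := by
  obtain ⟨ρ, hρ, -, hcl, hfr⟩ := hΩ.exists_defining
  obtain ⟨hρz, hgz⟩ := hfr z hz
  have hgpos : 0 < ‖gradient ρ z‖ := norm_pos_iff.2 hgz
  set c := ‖gradient ρ z‖ / 2 with hc
  have hcpos : 0 < c := half_pos hgpos
  set G := ‖gradient ρ z‖ + |lapl ρ z| + 1 with hG
  have hGpos : 0 < G := by positivity
  have hgc : Continuous fun x => ‖gradient ρ x‖ := hρ.continuous_gradient.norm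
  have hlc : Continuous fun x => |lapl ρ x| := hρ.continuous_lapl.abs
  have hev : ∀ᶠ x in 𝓝 z, c < ‖gradient ρ x‖ ∧ ‖gradient ρ x‖ < G ∧ |lapl ρ x| < G := by
    refine (continuousAt_const.eventually_lt hgc.continuousAt (by linarith)).and
      ((hgc.continuousAt.eventually_lt continuousAt_const ?_).and
        (hlc.continuousAt.eventually_lt continuousAt_const ?_))
    · have := abs_nonneg (lapl ρ z); linarith
    · linarith
  obtain ⟨r₁, hr₁, hball⟩ := Metric.eventually_nhds_iff.1 hev
  set r₀ := min r r₁ with hr₀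
  have hr₀pos : 0 < r₀ := lt_min hr hr₁
  set A := (R + 1) / r₀ ^ 2 with hA
  have hApos : 0 < A := by positivity
  set B := c ^ 2 / (8 * G ^ 2) with hB
  have hBpos : 0 < B := by positivity
  set D := 2 * N * A + 8 * A ^ 2 * r₀ ^ 2 with hD
  have hDpos : 0 ≤ D := by positivity
  set s₀ := min 1 (min (c ^ 2 / (4 * G)) (B * c ^ 2 / (2 * (|T| + D + 1)))) with hs₀
  have hs₀pos : 0 < s₀ := by
    refine lt_min one_pos (lt_min (by positivity) (by positivity))
  set σ := s₀ * Real.exp (-(R / B)) with hσ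
  have hσpos : 0 < σ := by positivity
  set φ : Euc N → ℝ := fun x => A * ‖x - z‖ ^ 2 + B * (Real.log (σ - ρ x) - Real.log σ) with hφ
  have hsq : ContDiff ℝ 2 fun x : Euc N => ‖x - z‖ ^ 2 := contDiff_norm_sub_sq z
  have hlog0 : ∀ x ∈ closure Ω, 0 < σ - ρ x ∧ 0 ≤ Real.log (σ - ρ x) - Real.log σ := by
    intro x hx
    have hx' : ρ x ≤ 0 := by rw [hcl] at hx; exact hx
    refine ⟨by linarith, sub_nonneg.2 (Real.log_le_log hσpos (by linarith))⟩
  have hqc : ContDiff ℝ 2 fun x => σ - ρ x := contDiff_const.sub hρ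
  have hlogc : ∀ x ∈ closure Ω, ContDiffAt ℝ 2 (fun x => Real.log (σ - ρ x)) x := fun x hx =>
    hqc.contDiffAt.log (hlog0 x hx).1.ne'
  have hlogc' : ∀ x ∈ closure Ω,
      ContDiffAt ℝ 2 (fun x => Real.log (σ - ρ x) - Real.log σ) x := fun x hx =>
    (hlogc x hx).sub contDiffAt_const
  refine ⟨φ, by simp [hφ, hρz], fun x hx => ⟨?_, ?_⟩, fun x hx hxR => ?_⟩
  · have := (hlog0 x hx).2
    simp only [hφ]; positivity
  · exact (contDiffAt_const.mul hsq.contDiffAt).add (contDiffAt_const.mul (hlogc' x hx))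
  obtain ⟨hs, hlog⟩ := hlog0 x hx
  have hxr : ‖x - z‖ < r₀ := by
    have h1 : A * ‖x - z‖ ^ 2 ≤ R := by
      have : 0 ≤ B * (Real.log (σ - ρ x) - Real.log σ) := by positivity
      simp only [hφ] at hxR; linarith
    by_contra! hcon
    have h2 : r₀ ^ 2 ≤ ‖x - z‖ ^ 2 := by gcongr
    have h3 : R + 1 ≤ A * ‖x - z‖ ^ 2 := by
      calc R + 1 = A * r₀ ^ 2 := by rw [hA]; field_simp
        _ ≤ _ := by gcongr
    linarith
  refine ⟨by rw [dist_eq_norm]; exact hxr.trans_le (min_le_left _ _), ?_⟩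
  obtain ⟨hg1, hg2, hl⟩ := hball (by rw [dist_eq_norm]; exact hxr.trans_le (min_le_right _ _))
  set s := σ - ρ x with hsdef
  have hss₀ : s ≤ s₀ := by
    have h1 : B * (Real.log s - Real.log σ) ≤ R := by
      have : 0 ≤ A * ‖x - z‖ ^ 2 := by positivity
      simp only [hφ] at hxR; linarith
    have h2 : Real.log s - Real.log σ ≤ R / B := by rw [le_div_iff₀ hBpos]; linarith
    have h3 : Real.log σ = Real.log s₀ + -(R / B) := by
      rw [hσ, Real.log_mul hs₀pos.ne' (Real.exp_pos _).ne', Real.log_exp]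
    exact (Real.log_le_log_iff hs hs₀pos).1 (by linarith)
  have hlogd : HasDerivAt Real.log s⁻¹ s := Real.hasDerivAt_log hs.ne'
  have hgrad : gradient φ x = A • ((2 : ℝ) • (x - z)) + B • (s⁻¹ • -gradient ρ x) := by
    rw [hφ, gradient_add ((hsq.differentiable (by norm_num) x).const_mul A)
      (((hlogc' x hx).differentiableAt (by norm_num)).const_mul B),
      gradient_const_mul _ (hsq.differentiable (by norm_num) x), gradient_norm_sub_sq,
      gradient_const_mul _ ((hlogc' x hx).differentiableAt (by norm_num)),
      gradient_sub ((hlogc x hx).differentiableAt (by norm_num)) (by fun_prop),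
      gradient_comp (hqc.differentiable (by norm_num) x) hlogd,
      gradient_sub (by fun_prop) (hρ.differentiable (by norm_num) x)]
    simp
  have hnorm : ‖gradient φ x‖ ^ 2 ≤ 8 * A ^ 2 * r₀ ^ 2 + 2 * B ^ 2 * G ^ 2 / s ^ 2 := by
    have h1 : ‖gradient φ x‖ ≤ 2 * A * r₀ + B * G / s := by
      rw [hgrad]
      refine (norm_add_le _ _).trans (add_le_add ?_ ?_)
      · rw [norm_smul, norm_smul]
        simp only [Real.norm_eq_abs, abs_of_pos hApos]
        have : A * ‖x - z‖ ≤ A * r₀ := by gcongr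
        norm_num; linarith
      · rw [norm_smul, norm_smul, norm_neg]
        simp only [Real.norm_eq_abs, abs_of_pos hBpos, abs_inv, abs_of_pos hs]
        rw [div_eq_mul_inv, mul_assoc, mul_comm G]
        gcongr
    have h2 : ‖gradient φ x‖ ^ 2 ≤ (2 * A * r₀ + B * G / s) ^ 2 := by gcongr
    have h3 : 2 * B ^ 2 * G ^ 2 / s ^ 2 = 2 * (B * G / s) ^ 2 := by field_simp
    rw [h3]
    nlinarith [sq_nonneg (2 * A * r₀ - B * G / s)]
  have hlap : lapl φ x =
      A * (2 * N) + B * (s⁻¹ * (-lapl ρ x) + -(s ^ 2)⁻¹ * ‖gradient ρ x‖ ^ 2) := by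
    rw [hφ, lapl_add (contDiffAt_const.mul hsq.contDiffAt) (contDiffAt_const.mul (hlogc' x hx)),
      lapl_const_mul _ hsq.contDiffAt, lapl_norm_sub_sq, lapl_const_mul _ (hlogc' x hx),
      lapl_sub (hlogc x hx) contDiffAt_const, lapl_const,
      lapl_comp (ψ := Real.log) (ψ' := fun t => t⁻¹) (ψ'' := -(s ^ 2)⁻¹) hqc.contDiffAt ?_
        (hasDerivAt_inv hs.ne'), lapl_sub contDiffAt_const hρ.contDiffAt, lapl_const,
      gradient_sub (by fun_prop) (hρ.differentiable (by norm_num) x)]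
    · simp [hsdef]
    · filter_upwards [eventually_ne_nhds hs.ne'] with t ht using Real.hasDerivAt_log ht
  have hs1 : s ≤ 1 := hss₀.trans (min_le_left _ _)
  have hs2 : s ≤ c ^ 2 / (4 * G) := hss₀.trans ((min_le_right _ _).trans (min_le_left _ _))
  have hs3 : s ≤ B * c ^ 2 / (2 * (|T| + D + 1)) :=
    hss₀.trans ((min_le_right _ _).trans (min_le_right _ _))
  have hfin := barrier_arith hcpos hGpos hBpos hB hs hs1 hs2 hDpos hs3 hg1.le hl.le
  rw [hlap]
  linarith

/-- Subsolutions satisfy the boundary condition in the classical sense. -/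
lemma IsStatSub.le_frontier {N : ℕ} (hN : 1 ≤ N) {Ω : Set (Euc N)}
    (hΩb : Bornology.IsBounded Ω) (hΩ : HasC2Boundary Ω) {h k u : Euc N → ℝ} (hh : Continuous h)
    (hk : Continuous k) {lam m : ℝ} (hlam : 0 ≤ lam) (hu : IsStatSub Ω h k lam m u) {z : Euc N}
    (hz : z ∈ frontier Ω) : u z ≤ k z := by
  by_contra! hcon
  have hc : IsCompact (closure Ω) := hΩb.isCompact_closure
  obtain ⟨C, hC⟩ := IsStatSub.exists_upper_bound hN hΩb hh hk (m := m) hlam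
  obtain ⟨H, hH⟩ := hc.exists_bound_of_continuousOn hh.continuousOn
  have hzc : z ∈ closure Ω := frontier_subset_closure hz
  obtain ⟨r, hr, hkr⟩ := Metric.eventually_nhds_iff.1
    (hk.continuousAt.eventually_lt continuousAt_const hcon : ∀ᶠ x in 𝓝 z, k x < u z)
  obtain ⟨φ, hφz, hφ, hφR⟩ := hΩ.exists_barrier hz hr
    (sub_nonneg.2 (hC u hu z hzc)) (H + 1 - lam * u z)
  have husc : UpperSemicontinuousOn (fun y => u y + -φ y) (closure Ω) :=
    hu.1.add (ContinuousOn.upperSemicontinuousOn fun x hx =>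
      (hφ x hx).2.continuousAt.neg.continuousWithinAt)
  obtain ⟨y, hy, hymax⟩ := UpperSemicontinuousOn.exists_isMaxOn ⟨z, hzc⟩ hc husc
  have hloc : IsLocalMaxOn (u - φ) (closure Ω) y := by
    filter_upwards [hymax.localize] with y' hy'
    simpa only [Pi.sub_apply, ← sub_eq_add_neg] using hy'
  have h1 : u z + -φ z ≤ u y + -φ y := hymax hzc
  have h2 := (hφ y hy).1
  have h3 := hC u hu y hy
  obtain ⟨hyr, hlap⟩ := hφR y hy (by linarith)
  have hop : 0 < statOp h lam m φ (u y) y := by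
    have h4 : lam * u z ≤ lam * u y := mul_le_mul_of_nonneg_left (by linarith) hlam
    have h5 : 0 ≤ ‖gradient φ y‖ ^ m := by positivity
    have h6 : h y ≤ H := (le_abs_self _).trans (hH y hy)
    have h7 := sq_nonneg ‖gradient φ y‖
    rw [statOp]; linarith
  obtain ⟨hin, hbd⟩ := hu.of_contDiffAt (hφ y hy).2 hy hloc
  rcases mem_or_mem_frontier_of_mem_closure hy with hyΩ | hyF
  · exact absurd (hin hyΩ) (not_le.2 hop)
  · rcases min_le_iff.1 (hbd hyF) with h4 | h4
    · exact absurd h4 (not_le.2 hop)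
    · have := hkr hyr
      linarith

lemma rpow_le_one_add_sq {t m : ℝ} (ht : 0 ≤ t) (hm : 0 ≤ m) (hm2 : m ≤ 2) :
    t ^ m ≤ 1 + t ^ 2 := by
  rcases le_total t 1 with h | h
  · have := Real.rpow_le_one ht h hm
    nlinarith [sq_nonneg t]
  · have := Real.rpow_le_rpow_of_exponent_le h hm2
    rw [Real.rpow_two] at this
    linarith

/-- For `m ≤ 2`, supersolutions satisfy the boundary condition in the classical sense. -/
lemma IsStatSuper.le_frontier {N : ℕ} {Ω : Set (Euc N)}
    (hΩb : Bornology.IsBounded Ω) (hΩ : HasC2Boundary Ω) {h k v : Euc N → ℝ} (hh : Continuous h)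
    (hk : Continuous k) {lam m : ℝ} (hlam : 0 ≤ lam) (hm : 0 ≤ m) (hm2 : m ≤ 2)
    (hv : IsStatSuper Ω h k lam m v) {z : Euc N} (hz : z ∈ frontier Ω) : k z ≤ v z := by
  by_contra! hcon
  have hc : IsCompact (closure Ω) := hΩb.isCompact_closure
  have hzc : z ∈ closure Ω := frontier_subset_closure hz
  obtain ⟨x₁, hx₁, hx₁min⟩ := LowerSemicontinuousOn.exists_isMinOn ⟨z, hzc⟩ hc hv.1
  obtain ⟨H, hH⟩ := hc.exists_bound_of_continuousOn hh.continuousOn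
  obtain ⟨r, hr, hkr⟩ := Metric.eventually_nhds_iff.1
    (continuousAt_const.eventually_lt hk.continuousAt hcon : ∀ᶠ x in 𝓝 z, v z < k x)
  have hvz : v x₁ ≤ v z := hx₁min hzc
  obtain ⟨φ, hφz, hφ, hφR⟩ := hΩ.exists_barrier hz hr (sub_nonneg.2 hvz) (H + 2 + lam * v z)
  have hlsc : LowerSemicontinuousOn (fun y => v y + φ y) (closure Ω) :=
    hv.1.add (ContinuousOn.lowerSemicontinuousOn fun x hx =>
      (hφ x hx).2.continuousAt.continuousWithinAt)
  obtain ⟨y, hy, hymin⟩ := LowerSemicontinuousOn.exists_isMinOn ⟨z, hzc⟩ hc hlsc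
  have hloc : IsLocalMinOn (v - fun x => -φ x) (closure Ω) y := by
    filter_upwards [hymin.localize] with y' hy'
    simpa using hy'
  have h1 : v y + φ y ≤ v z + φ z := hymin hzc
  have h2 := (hφ y hy).1
  have h3 : v x₁ ≤ v y := hx₁min hy
  obtain ⟨hyr, hlap⟩ := hφR y hy (by linarith)
  have hop : statOp h lam m (fun x => -φ x) (v y) y < 0 := by
    have h4 : lam * v y ≤ lam * v z := mul_le_mul_of_nonneg_left (by linarith) hlam
    have h5 := rpow_le_one_add_sq (norm_nonneg (gradient φ y)) hm hm2
    have h6 : -H ≤ h y := neg_le.1 ((neg_le_abs _).trans (hH y hy))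
    rw [statOp, lapl_neg (hφ y hy).2, gradient_neg, norm_neg]; linarith
  obtain ⟨hin, hbd⟩ := hv.of_contDiffAt (hφ y hy).2.neg hy hloc
  rcases mem_or_mem_frontier_of_mem_closure hy with hyΩ | hyF
  · exact absurd (hin hyΩ) (not_le.2 hop)
  · rcases le_max_iff.1 (hbd hyF) with h4 | h4
    · exact absurd h4 (not_le.2 hop)
    · have := hkr hyr
      linarith

/-! ### The Perron method -/

/-- Existence of upper semicontinuous envelopes of bounded functions. -/
lemma exists_usc_envelope {X : Type*} [TopologicalSpace X] {s : Set X} {f : X → ℝ} {C : ℝ}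
    (hC : ∀ x ∈ s, f x ≤ C) :
    ∃ g : X → ℝ, UpperSemicontinuousOn g s ∧ (∀ x ∈ s, f x ≤ g x) ∧
      ∀ x ∈ s, ∀ ε > 0, ∃ᶠ y in 𝓝[s] x, g x - ε < f y := by
  set S : X → Set ℝ := fun x => {a | ∀ᶠ y in 𝓝[s] x, f y ≤ a} with hS
  have hlow : ∀ x ∈ s, ∀ a ∈ S x, f x ≤ a := fun x hx a ha => ha.self_of_nhdsWithin hx
  have hbdd : ∀ x ∈ s, BddBelow (S x) := fun x hx => ⟨f x, fun a ha => hlow x hx a ha⟩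
  have hne : ∀ x, (S x).Nonempty := fun x =>
    ⟨C, eventually_nhdsWithin_of_forall fun y hy => hC y hy⟩
  refine ⟨fun x => sInf (S x), ?_, fun x hx => le_csInf (hne x) (hlow x hx), ?_⟩
  · intro x hx y hy
    obtain ⟨a, ha, hay⟩ := exists_lt_of_csInf_lt (hne x) hy
    filter_upwards [eventually_eventually_nhdsWithin.2 ha, self_mem_nhdsWithin] with z hz hzs
    exact (csInf_le (hbdd z hzs) hz).trans_lt hay
  · intro x hx ε hε
    by_contra hcon
    have h1 : sInf (S x) - ε ∈ S x := by
      rw [not_frequently] at hcon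
      filter_upwards [hcon] with y hy using not_lt.1 hy
    have := csInf_le (hbdd x hx) h1
    linarith

lemma exists_lsc_envelope {X : Type*} [TopologicalSpace X] {s : Set X} {f : X → ℝ} {C : ℝ}
    (hC : ∀ x ∈ s, C ≤ f x) :
    ∃ g : X → ℝ, LowerSemicontinuousOn g s ∧ (∀ x ∈ s, g x ≤ f x) ∧
      ∀ x ∈ s, ∀ ε > 0, ∃ᶠ y in 𝓝[s] x, f y < g x + ε := by
  obtain ⟨g, hg, hfg, hfr⟩ := exists_usc_envelope (f := fun x => -f x) (C := -C) (s := s)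
    fun x hx => neg_le_neg (hC x hx)
  refine ⟨fun x => -g x, fun x hx y hy => ?_, fun x hx => neg_le.1 (hfg x hx), fun x hx ε hε => ?_⟩
  · filter_upwards [hg x hx (-y) (lt_neg.1 hy)] with z hz using lt_neg.1 hz
  · refine (hfr x hx ε hε).mono fun y hy => ?_
    linarith

lemma isStatSub_iff {N : ℕ} {Ω : Set (Euc N)} (hΩo : IsOpen Ω) {h k u : Euc N → ℝ} {lam m : ℝ} :
    IsStatSub Ω h k lam m u ↔ UpperSemicontinuousOn u (closure Ω) ∧
      ∀ φ : Euc N → ℝ, ContDiff ℝ 2 φ → ∀ x₀ ∈ closure Ω, IsLocalMaxOn (u - φ) (closure Ω) x₀ →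
        ¬ (0 < statOp h lam m φ (u x₀) x₀ ∧ (x₀ ∈ frontier Ω → k x₀ < u x₀)) := by
  refine and_congr_right fun _ => forall₅_congr fun φ _ x hx _ => ?_
  have hfr : x ∈ frontier Ω → x ∉ Ω := fun hxf => by
    rw [hΩo.frontier_eq] at hxf; exact hxf.2
  rcases mem_or_mem_frontier_of_mem_closure hx with hx' | hx'
  · have : x ∉ frontier Ω := fun h => hfr h hx'
    simp [hx', this]
  · have := hfr hx'
    simp only [this, hx', false_imp_iff, true_imp_iff, true_and, min_le_iff, not_and_or, not_lt,
      sub_nonpos]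

lemma isStatSuper_iff {N : ℕ} {Ω : Set (Euc N)} (hΩo : IsOpen Ω) {h k v : Euc N → ℝ} {lam m : ℝ} :
    IsStatSuper Ω h k lam m v ↔ LowerSemicontinuousOn v (closure Ω) ∧
      ∀ φ : Euc N → ℝ, ContDiff ℝ 2 φ → ∀ x₀ ∈ closure Ω, IsLocalMinOn (v - φ) (closure Ω) x₀ →
        ¬ (statOp h lam m φ (v x₀) x₀ < 0 ∧ (x₀ ∈ frontier Ω → v x₀ < k x₀)) := by
  refine and_congr_right fun _ => forall₅_congr fun φ _ x hx _ => ?_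
  have hfr : x ∈ frontier Ω → x ∉ Ω := fun hxf => by
    rw [hΩo.frontier_eq] at hxf; exact hxf.2
  rcases mem_or_mem_frontier_of_mem_closure hx with hx' | hx'
  · have : x ∉ frontier Ω := fun h => hfr h hx'
    simp [hx', this]
  · have := hfr hx'
    simp only [this, hx', false_imp_iff, true_imp_iff, true_and, le_max_iff, not_and_or, not_lt,
      sub_nonneg]

lemma continuous_statOp {N : ℕ} {h φ : Euc N → ℝ} (hh : Continuous h) (hφ : ContDiff ℝ 2 φ)
    (lam : ℝ) {m : ℝ} (hm : 0 ≤ m) :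
    Continuous fun q : Euc N × ℝ => statOp h lam m φ q.2 q.1 := by
  have h1 := hφ.continuous_lapl
  have h2 : Continuous fun x => ‖gradient φ x‖ ^ m :=
    hφ.continuous_gradient.norm.rpow_const fun _ => Or.inr hm
  exact (((h1.comp continuous_fst).neg.add (h2.comp continuous_fst)).add
    (continuous_const.mul continuous_snd)).sub (hh.comp continuous_fst)

lemma statOp_mono {N : ℕ} {h φ : Euc N → ℝ} {lam m r s : ℝ} (hlam : 0 ≤ lam) (hrs : r ≤ s)
    (x : Euc N) : statOp h lam m φ r x ≤ statOp h lam m φ s x := by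
  have := mul_le_mul_of_nonneg_left hrs hlam
  simp only [statOp]; linarith

lemma exists_nhds_sub_fails {N : ℕ} (Ω : Set (Euc N)) {h k φ : Euc N → ℝ} (hh : Continuous h)
    (hk : Continuous k) (hφ : ContDiff ℝ 2 φ) {lam m : ℝ} (hlam : 0 ≤ lam) (hm : 0 ≤ m)
    {x₀ : Euc N} {t₀ : ℝ} (hop : 0 < statOp h lam m φ t₀ x₀)
    (hbd : x₀ ∈ frontier Ω → k x₀ < t₀) :
    ∃ η > 0, ∀ x, dist x x₀ < η → ∀ t, t₀ - η < t →
      0 < statOp h lam m φ t x ∧ (x ∈ frontier Ω → k x < t) := by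
  have h1 : ∀ᶠ q in 𝓝 (x₀, t₀), 0 < statOp h lam m φ q.2 q.1 :=
    continuousAt_const.eventually_lt (continuous_statOp hh hφ lam hm).continuousAt hop
  have h2 : ∀ᶠ q : Euc N × ℝ in 𝓝 (x₀, t₀), q.1 ∈ frontier Ω → k q.1 < q.2 := by
    by_cases hx : x₀ ∈ frontier Ω
    · filter_upwards [(hk.comp continuous_fst).continuousAt.eventually_lt
        continuous_snd.continuousAt (hbd hx)] with q hq _ using hq
    · have : ∀ᶠ q : Euc N × ℝ in 𝓝 (x₀, t₀), q.1 ∈ (frontier Ω)ᶜ :=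
        continuous_fst.continuousAt.eventually_mem
          (isClosed_frontier.isOpen_compl.mem_nhds (show (x₀, t₀).1 ∈ _ from hx))
      filter_upwards [this] with q hq hq' using absurd hq' hq
  obtain ⟨η, hη, hball⟩ := Metric.eventually_nhds_iff.1 (h1.and h2)
  refine ⟨η / 2, half_pos hη, fun x hx t ht => ?_⟩
  have h3 := @hball (x, t₀ - η / 2) (by
    rw [Prod.dist_eq, max_lt_iff]
    refine ⟨hx.trans (half_lt_self hη), ?_⟩
    simp only [Real.dist_eq]
    rw [abs_lt]; constructor <;> linarith)
  exact ⟨h3.1.trans_le (statOp_mono hlam ht.le x), fun hxf => (h3.2 hxf).trans ht⟩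

lemma exists_nhds_super_fails {N : ℕ} (Ω : Set (Euc N)) {h k φ : Euc N → ℝ} (hh : Continuous h)
    (hk : Continuous k) (hφ : ContDiff ℝ 2 φ) {lam m : ℝ} (hlam : 0 ≤ lam) (hm : 0 ≤ m)
    {x₀ : Euc N} {t₀ : ℝ} (hop : statOp h lam m φ t₀ x₀ < 0)
    (hbd : x₀ ∈ frontier Ω → t₀ < k x₀) :
    ∃ η > 0, ∀ x, dist x x₀ < η → ∀ t, t < t₀ + η →
      statOp h lam m φ t x < 0 ∧ (x ∈ frontier Ω → t < k x) := by
  have h1 : ∀ᶠ q in 𝓝 (x₀, t₀), statOp h lam m φ q.2 q.1 < 0 :=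
    (continuous_statOp hh hφ lam hm).continuousAt.eventually_lt continuousAt_const hop
  have h2 : ∀ᶠ q : Euc N × ℝ in 𝓝 (x₀, t₀), q.1 ∈ frontier Ω → q.2 < k q.1 := by
    by_cases hx : x₀ ∈ frontier Ω
    · filter_upwards [continuous_snd.continuousAt.eventually_lt
        (hk.comp continuous_fst).continuousAt (hbd hx)] with q hq _ using hq
    · have : ∀ᶠ q : Euc N × ℝ in 𝓝 (x₀, t₀), q.1 ∈ (frontier Ω)ᶜ :=
        continuous_fst.continuousAt.eventually_mem
          (isClosed_frontier.isOpen_compl.mem_nhds (show (x₀, t₀).1 ∈ _ from hx))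
      filter_upwards [this] with q hq hq' using absurd hq' hq
  obtain ⟨η, hη, hball⟩ := Metric.eventually_nhds_iff.1 (h1.and h2)
  refine ⟨η / 2, half_pos hη, fun x hx t ht => ?_⟩
  have h3 := @hball (x, t₀ + η / 2) (by
    rw [Prod.dist_eq, max_lt_iff]
    refine ⟨hx.trans (half_lt_self hη), ?_⟩
    simp only [Real.dist_eq]
    rw [abs_lt]; constructor <;> linarith)
  exact ⟨(statOp_mono hlam ht.le x).trans_lt h3.1, fun hxf => ht.trans (h3.2 hxf)⟩

lemma statOp_add_const_mul_pow_four {N : ℕ} {h φ : Euc N → ℝ} (hφ : ContDiff ℝ 2 φ)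
    (c lam m r : ℝ) (z : Euc N) :
    statOp h lam m (fun y => φ y + c * (‖y - z‖ ^ 2) ^ 2) r z = statOp h lam m φ r z := by
  have h4 : ContDiff ℝ 2 fun y : Euc N => (‖y - z‖ ^ 2) ^ 2 := contDiff_norm_sub_pow_four z
  rw [statOp, lapl_add hφ.contDiffAt (contDiff_const.mul h4).contDiffAt,
    lapl_const_mul _ h4.contDiffAt, lapl_norm_sub_pow_four,
    gradient_add (hφ.differentiable (by norm_num) z)
      ((h4.differentiable (by norm_num) z).const_mul c),
    gradient_const_mul _ (h4.differentiable (by norm_num) z), gradient_norm_sub_pow_four, statOp]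
  simp

/-- The upper semicontinuous envelope of the supremum of a family of subsolutions is a
subsolution. -/
lemma isStatSub_envelope {N : ℕ} {Ω : Set (Euc N)} (hΩo : IsOpen Ω)
    {h k : Euc N → ℝ} (hh : Continuous h)
    (hk : Continuous k) {lam m : ℝ} (hlam : 0 ≤ lam) (hm : 0 ≤ m) {S : Set (Euc N → ℝ)}
    (hS : ∀ u ∈ S, IsStatSub Ω h k lam m u) {W : Euc N → ℝ}
    (hW : UpperSemicontinuousOn W (closure Ω)) (hSW : ∀ u ∈ S, ∀ x ∈ closure Ω, u x ≤ W x)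
    (hfr : ∀ x ∈ closure Ω, ∀ ε > 0, ∃ᶠ y in 𝓝[closure Ω] x, ∃ u ∈ S, W x - ε < u y) :
    IsStatSub Ω h k lam m W := by
  refine (isStatSub_iff hΩo).2 ⟨hW, fun φ hφ x₀ hx₀ hmax => ?_⟩
  rintro ⟨hop, hbd⟩
  set ψ : Euc N → ℝ := fun y => φ y + 1 * (‖y - x₀‖ ^ 2) ^ 2 with hψ
  have hψc : ContDiff ℝ 2 ψ := hφ.add (contDiff_const.mul (contDiff_norm_sub_pow_four x₀))
  rw [← statOp_add_const_mul_pow_four hφ 1] at hop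
  obtain ⟨η, hη, hfail⟩ := exists_nhds_sub_fails Ω hh hk hψc hlam hm hop hbd
  obtain ⟨r₁, hr₁, hloc⟩ := Metric.eventually_nhds_iff.1 (eventually_nhdsWithin_iff.1 hmax)
  obtain ⟨r₂, hr₂, hψr⟩ := Metric.continuousAt_iff.1 hψc.continuous.continuousAt (η / 2)
    (half_pos hη)
  set r := min (r₁ / 2) (min η r₂ / 2) with hr
  have hrpos : 0 < r := by positivity
  set ε := min (η / 4) (r ^ 4 / 4) with hε
  have hεpos : 0 < ε := by positivity
  have hev : ∀ᶠ y in 𝓝[closure Ω] x₀, ψ y < ψ x₀ + ε ∧ y ∈ closedBall x₀ r ∧ y ∈ closure Ω := by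
    refine ((hψc.continuous.continuousAt.eventually_lt continuousAt_const ?_).filter_mono
      nhdsWithin_le_nhds).and ((eventually_nhdsWithin_of_eventually_nhds
        (closedBall_mem_nhds x₀ hrpos)).and self_mem_nhdsWithin)
    linarith
  obtain ⟨y, ⟨u, huS, huy⟩, hψy, hyr, hyc⟩ := ((hfr x₀ hx₀ ε hεpos).and_eventually hev).exists
  have hu := (isStatSub_iff hΩo).1 (hS u huS)
  have hKc : IsCompact (closure Ω ∩ closedBall x₀ r) :=
    (isCompact_closedBall x₀ r).inter_left isClosed_closure
  have husc : UpperSemicontinuousOn (fun y => u y + -ψ y) (closure Ω ∩ closedBall x₀ r) :=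
    (hu.1.mono inter_subset_left).add hψc.continuous.neg.continuousOn.upperSemicontinuousOn
  have hne : (closure Ω ∩ closedBall x₀ r).Nonempty := ⟨y, hyc, hyr⟩
  obtain ⟨x, ⟨hxc, hxr⟩, hxmax⟩ := husc.exists_isMaxOn hne hKc
  have h1 : u y + -ψ y ≤ u x + -ψ x := hxmax ⟨hyc, hyr⟩
  rw [mem_closedBall] at hxr
  have hxr₁ : dist x x₀ < r₁ := hxr.trans_lt ((min_le_left _ _).trans_lt (half_lt_self hr₁))
  have hxr₂ : dist x x₀ < min η r₂ :=
    hxr.trans_lt ((min_le_right _ _).trans_lt (half_lt_self (by positivity)))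
  have h2 : W x - φ x ≤ W x₀ - φ x₀ := hloc hxr₁ hxc
  have h3 := hSW u huS x hxc
  have hψ₀ : ψ x₀ = φ x₀ := by simp [hψ]
  have hψx : ψ x = φ x + (‖x - x₀‖ ^ 2) ^ 2 := by simp [hψ]
  have hε1 : ε ≤ η / 4 := min_le_left _ _
  have hε2 : ε ≤ r ^ 4 / 4 := min_le_right _ _
  have h4 : (‖x - x₀‖ ^ 2) ^ 2 ≤ 2 * ε := by linarith
  have h5 : dist x x₀ < r := by
    rw [dist_eq_norm]
    by_contra! hcon
    have : r ^ 4 ≤ ‖x - x₀‖ ^ 4 := by gcongr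
    have h6 : ‖x - x₀‖ ^ 4 = (‖x - x₀‖ ^ 2) ^ 2 := by ring
    have : 0 < r ^ 4 := by positivity
    linarith
  have hloc' : IsLocalMaxOn (u - ψ) (closure Ω) x := by
    have : ∀ᶠ x' in 𝓝[closure Ω] x, x' ∈ ball x₀ r :=
      eventually_nhdsWithin_of_eventually_nhds (isOpen_ball.mem_nhds h5)
    filter_upwards [this, self_mem_nhdsWithin] with x' hx' hx'c
    have h6 : u x' + -ψ x' ≤ u x + -ψ x := hxmax ⟨hx'c, ball_subset_closedBall hx'⟩
    simpa only [Pi.sub_apply, sub_eq_add_neg] using h6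
  have h7 := abs_lt.1 (hψr (hxr₂.trans_le (min_le_right _ _)))
  exact hu.2 ψ hψc x hxc hloc' (hfail x (hxr₂.trans_le (min_le_left _ _)) (u x) (by linarith))

/-- The lower semicontinuous envelope of a maximal subsolution is a supersolution. -/
lemma isStatSuper_envelope {N : ℕ} {Ω : Set (Euc N)} (hΩo : IsOpen Ω)
    {h k : Euc N → ℝ} (hh : Continuous h)
    (hk : Continuous k) {lam m : ℝ} (hlam : 0 ≤ lam) (hm : 0 ≤ m) {w v : Euc N → ℝ}
    (hw : IsStatSub Ω h k lam m w)
    (hmaximal : ∀ u, IsStatSub Ω h k lam m u → (∀ x ∈ closure Ω, w x ≤ u x) →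
      ∀ x ∈ closure Ω, u x ≤ w x)
    (hv : LowerSemicontinuousOn v (closure Ω)) (hvw : ∀ x ∈ closure Ω, v x ≤ w x)
    (hfr : ∀ x ∈ closure Ω, ∀ ε > 0, ∃ᶠ y in 𝓝[closure Ω] x, w y < v x + ε) :
    IsStatSuper Ω h k lam m v := by
  classical
  refine (isStatSuper_iff hΩo).2 ⟨hv, fun φ hφ x₀ hx₀ hmin => ?_⟩
  rintro ⟨hop, hbd⟩
  have hw' := (isStatSub_iff hΩo).1 hw
  set ψ : Euc N → ℝ := fun y => φ y + (-1) * (‖y - x₀‖ ^ 2) ^ 2 with hψ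
  have hψc : ContDiff ℝ 2 ψ := hφ.add (contDiff_const.mul (contDiff_norm_sub_pow_four x₀))
  have hψ₀ : ψ x₀ = φ x₀ := by simp [hψ]
  rw [← statOp_add_const_mul_pow_four hφ (-1)] at hop
  obtain ⟨η, hη, hfail⟩ := exists_nhds_super_fails Ω hh hk hψc hlam hm hop hbd
  obtain ⟨r₁, hr₁, hloc⟩ := Metric.eventually_nhds_iff.1 (eventually_nhdsWithin_iff.1 hmin)
  obtain ⟨r₂, hr₂, hψr⟩ := Metric.continuousAt_iff.1 hψc.continuous.continuousAt (η / 2)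
    (half_pos hη)
  set r := min r₁ (min η r₂) with hr
  have hrpos : 0 < r := by positivity
  set δ := min (η / 2) ((r / 2) ^ 4) with hδ
  have hδpos : 0 < δ := by positivity
  set g : Euc N → ℝ := fun x => ψ x + (v x₀ - φ x₀ + δ) with hg
  have hgc : ContDiff ℝ 2 g := hψc.add contDiff_const
  have hgw : ∀ x ∈ closure Ω, dist x x₀ < r → r / 2 ≤ dist x x₀ → g x ≤ w x := by
    intro x hx hxr hxr'
    have h1 : v x₀ - φ x₀ ≤ v x - φ x := hloc (hxr.trans_le (min_le_left _ _)) hx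
    have h2 := hvw x hx
    have h3 : (r / 2) ^ 4 ≤ dist x x₀ ^ 4 := by gcongr
    have h4 : dist x x₀ ^ 4 = (‖x - x₀‖ ^ 2) ^ 2 := by rw [dist_eq_norm]; ring
    have h5 : δ ≤ (r / 2) ^ 4 := min_le_right _ _
    simp only [hg, hψ]; linarith
  set U : Euc N → ℝ := fun x => if dist x x₀ < r then max (w x) (g x) else w x with hU
  have hwU : ∀ x, w x ≤ U x := by
    intro x; simp only [hU]; split_ifs
    · exact le_max_left _ _
    · exact le_rfl
  have hgU : ∀ x, dist x x₀ < r → g x ≤ U x := by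
    intro x hx; simp only [hU, if_pos hx]; exact le_max_right _ _
  have hUw : ∀ x ∈ closure Ω, r / 2 ≤ dist x x₀ → U x = w x := by
    intro x hx hxr; simp only [hU]; split_ifs with hlt
    · exact max_eq_left (hgw x hx hlt hxr)
    · rfl
  have hUusc : UpperSemicontinuousOn U (closure Ω) := by
    intro x hx y hy
    have hw1 : ∀ᶠ x' in 𝓝[closure Ω] x, w x' < y := hw.1 x hx y ((hwU x).trans_lt hy)
    rcases lt_or_ge (dist x x₀) r with hlt | hge
    · have hg1 : ∀ᶠ x' in 𝓝[closure Ω] x, g x' < y :=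
        (hgc.continuous.continuousAt.eventually_lt continuousAt_const
          ((hgU x hlt).trans_lt hy)).filter_mono nhdsWithin_le_nhds
      filter_upwards [hw1, hg1] with x' h1 h2
      simp only [hU]; split_ifs
      · exact max_lt h1 h2
      · exact h1
    · have hfar : ∀ᶠ x' in 𝓝[closure Ω] x, r / 2 < dist x' x₀ :=
        (continuousAt_const.eventually_lt (continuous_id.dist continuous_const).continuousAt
          (show r / 2 < dist x x₀ by linarith)).filter_mono nhdsWithin_le_nhds
      filter_upwards [hw1, hfar, self_mem_nhdsWithin] with x' h1 h2 h3
      rwa [hUw x' h3 h2.le]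
  have hUsub : IsStatSub Ω h k lam m U := by
    refine (isStatSub_iff hΩo).2 ⟨hUusc, fun χ hχ x hx hmaxU => ?_⟩
    rcases (hwU x).eq_or_lt with heq | hlt
    · rw [← heq]
      refine hw'.2 χ hχ x hx ?_
      filter_upwards [hmaxU] with x' hx'
      simp only [Pi.sub_apply, ← heq] at hx' ⊢
      have := hwU x'
      linarith
    have hxr : dist x x₀ < r / 2 := by
      by_contra! hcon
      exact hlt.ne' (hUw x hx hcon)
    have hxr' : dist x x₀ < r := by linarith
    have hUg : U x = g x := by
      simp only [hU, if_pos hxr'] at hlt ⊢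
      exact max_eq_right ((lt_max_iff.1 hlt).resolve_left (lt_irrefl _)).le
    have hgloc : IsLocalMaxOn (g - χ) (closure Ω) x := by
      have : ∀ᶠ x' in 𝓝[closure Ω] x, x' ∈ ball x₀ r :=
        eventually_nhdsWithin_of_eventually_nhds (isOpen_ball.mem_nhds hxr')
      filter_upwards [hmaxU, this] with x' hx' hx'r
      have := hgU x' hx'r
      simp only [Pi.sub_apply, hUg] at hx' ⊢
      linarith
    have hxη : dist x x₀ < η :=
      hxr'.trans_le ((min_le_right _ _).trans (min_le_left _ _))
    have h7 := abs_lt.1 (hψr (hxr'.trans_le ((min_le_right _ _).trans (min_le_right _ _))))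
    have hδη : δ ≤ η / 2 := min_le_left _ _
    obtain ⟨hf1, hf2⟩ := hfail x hxη (g x) (by simp only [hg]; linarith)
    rw [hUg]
    rintro ⟨hpos, hfront⟩
    rcases mem_or_mem_frontier_of_mem_closure hx with hxΩ | hxF
    · have hgl : IsLocalMax (g - χ) x :=
        hgloc.isLocalMax (mem_of_superset (hΩo.mem_nhds hxΩ) subset_closure)
      obtain ⟨e1, e2⟩ := gradient_eq_and_lapl_le_of_isLocalMax hgl hgc.contDiffAt hχ.contDiffAt
      have e3 : lapl g x = lapl ψ x := by
        rw [hg, lapl_add hψc.contDiffAt contDiffAt_const, lapl_const, add_zero]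
      have e4 : gradient g x = gradient ψ x := by
        rw [hg, gradient_add (hψc.differentiable (by norm_num) x) (by fun_prop)]
        simp
      rw [e3] at e2
      rw [e4] at e1
      rw [statOp, e1] at hpos
      rw [statOp] at hf1
      linarith
    · exact absurd (hfront hxF) (not_lt.2 (hf2 hxF).le)
  have hUle := hmaximal U hUsub fun x _ => hwU x
  have hev : ∀ᶠ y in 𝓝[closure Ω] x₀, v x₀ + δ / 2 < g y ∧ dist y x₀ < r ∧ y ∈ closure Ω := by
    refine ((continuousAt_const.eventually_lt hgc.continuous.continuousAt ?_).filter_mono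
      nhdsWithin_le_nhds).and ((eventually_nhdsWithin_of_eventually_nhds
        (ball_mem_nhds x₀ hrpos)).and self_mem_nhdsWithin)
    simp only [hg, hψ₀]; linarith
  obtain ⟨y, hy1, hy2, hy3, hy4⟩ :=
    ((hfr x₀ hx₀ (δ / 2) (half_pos hδpos)).and_eventually hev).exists
  have := hUle y hy4
  have := hgU y hy3
  linarith

/-- The Perron method: above a bounded subsolution there are a subsolution whose lower semicontinuous
envelope is a supersolution. -/
lemma exists_perron {N : ℕ} (hN : 1 ≤ N) {Ω : Set (Euc N)} (hΩo : IsOpen Ω)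
    (hΩb : Bornology.IsBounded Ω) {h k : Euc N → ℝ} (hh : Continuous h)
    (hk : Continuous k) {lam m : ℝ} (hlam : 0 ≤ lam) (hm : 0 ≤ m) {w₀ : Euc N → ℝ}
    (hw₀ : IsStatSub Ω h k lam m w₀) {C : ℝ} (hC : ∀ x ∈ closure Ω, |w₀ x| ≤ C) :
    ∃ w v : Euc N → ℝ, IsStatSub Ω h k lam m w ∧ IsStatSuper Ω h k lam m v ∧
      (∀ x ∈ closure Ω, v x ≤ w x) ∧ (∀ x ∈ closure Ω, -C ≤ w x) ∧
      ∀ x ∈ closure Ω, ∀ ε > 0, ∃ᶠ y in 𝓝[closure Ω] x, w y < v x + ε := by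
  obtain ⟨C₁, hC₁⟩ := IsStatSub.exists_upper_bound hN hΩb hh hk (m := m) hlam
  set S : Set (Euc N → ℝ) := {u | IsStatSub Ω h k lam m u ∧ ∀ x ∈ closure Ω, w₀ x ≤ u x} with hS
  have hw₀S : w₀ ∈ S := ⟨hw₀, fun _ _ => le_rfl⟩
  set W : Euc N → ℝ := fun x => sSup ((fun u => u x) '' S) with hW
  have hbdd : ∀ x ∈ closure Ω, BddAbove ((fun u : Euc N → ℝ => u x) '' S) := by
    rintro x hx
    refine ⟨C₁, ?_⟩
    rintro _ ⟨u, hu, rfl⟩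
    exact hC₁ u hu.1 x hx
  have hne : ∀ x, ((fun u : Euc N → ℝ => u x) '' S).Nonempty := fun x => ⟨_, w₀, hw₀S, rfl⟩
  have hSW : ∀ u ∈ S, ∀ x ∈ closure Ω, u x ≤ W x := fun u hu x hx =>
    le_csSup (hbdd x hx) ⟨u, hu, rfl⟩
  have hWC : ∀ x ∈ closure Ω, W x ≤ C₁ := fun x hx => csSup_le (hne x) (by
    rintro _ ⟨u, hu, rfl⟩
    exact hC₁ u hu.1 x hx)
  obtain ⟨w, hwusc, hWw, hwfr⟩ := exists_usc_envelope hWC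
  have hSw : ∀ u ∈ S, ∀ x ∈ closure Ω, u x ≤ w x := fun u hu x hx =>
    (hSW u hu x hx).trans (hWw x hx)
  have hwsub : IsStatSub Ω h k lam m w := by
    refine isStatSub_envelope hΩo hh hk hlam hm (S := S) (fun u hu => hu.1) hwusc hSw ?_
    intro x hx ε hε
    refine (hwfr x hx ε hε).mono fun y hy => ?_
    obtain ⟨_, ⟨u, hu, rfl⟩, huy⟩ := exists_lt_of_lt_csSup (hne y) hy
    exact ⟨u, hu, huy⟩
  have hwlow : ∀ x ∈ closure Ω, -C ≤ w x := fun x hx =>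
    (abs_le.1 (hC x hx)).1.trans (hSw w₀ hw₀S x hx)
  obtain ⟨v, hv, hvw, hvfr⟩ := exists_lsc_envelope hwlow
  refine ⟨w, v, hwsub, ?_, hvw, hwlow, hvfr⟩
  refine isStatSuper_envelope hΩo hh hk hlam hm hwsub ?_ hv hvw hvfr
  exact fun u hu hwu x hx => hSw u ⟨hu, fun y hy => (hSw w₀ hw₀S y hy).trans (hwu y hy)⟩ x hx

lemma IsStatSub.neg_lapl_le {N : ℕ} {Ω : Set (Euc N)} {h k u φ : Euc N → ℝ} {lam m : ℝ}
    (hu : IsStatSub Ω h k lam m u) {y : Euc N} (hy : y ∈ Ω) (hφ : ContDiff ℝ 2 φ)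
    (hmax : IsLocalMaxOn (u - φ) (closure Ω) y) :
    -lapl φ y ≤ h y - lam * u y - ‖gradient φ y‖ ^ m := by
  have := (hu.2 φ hφ y (subset_closure hy) hmax).1 hy
  simp only [statOp] at this
  linarith

lemma IsStatSuper.neg_lapl_le {N : ℕ} {Ω : Set (Euc N)} {h k v φ : Euc N → ℝ} {lam m : ℝ}
    (hv : IsStatSuper Ω h k lam m v) {y : Euc N} (hyc : y ∈ closure Ω)
    (hy : y ∈ frontier Ω → v y < k y) (hφ : ContDiff ℝ 2 φ)
    (hmax : IsLocalMaxOn (-v - φ) (closure Ω) y) :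
    -lapl φ y ≤ ‖gradient φ y‖ ^ m - lam * (-v y) - h y := by
  have hmin : IsLocalMinOn (v - -φ) (closure Ω) y := by
    have e : v - -φ = fun x => -((-v - φ) x) := by
      funext x; simp only [Pi.sub_apply, Pi.neg_apply]; ring
    rw [e]
    exact hmax.neg
  have key := hv.2 (-φ) hφ.neg y hyc hmin
  have hop : 0 ≤ statOp h lam m (-φ) (v y) y := by
    rcases mem_or_mem_frontier_of_mem_closure hyc with h1 | h1
    · exact key.1 h1
    · rcases le_max_iff.1 (key.2 h1) with h2 | h2
      · exact h2
      · linarith [hy h1]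
  have e1 : lapl (-φ) y = -lapl φ y := lapl_neg hφ.contDiffAt
  have e2 : gradient (-φ) y = -gradient φ y := gradient_neg φ y
  simp only [statOp, e1, e2, norm_neg] at hop
  linarith

lemma exists_forall_dist_lt_abs_sub_lt {N : ℕ} {K : Set (Euc N)} (hK : IsCompact K)
    {h : Euc N → ℝ} (hh : Continuous h) {ε : ℝ} (hε : 0 < ε) :
    ∃ δ > 0, ∀ x ∈ K, ∀ y ∈ K, dist x y < δ → |h x - h y| < ε := by
  obtain ⟨δ, hδ, H⟩ := Metric.uniformContinuousOn_iff.1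
    (hK.uniformContinuousOn_of_continuous hh.continuousOn) ε hε
  exact ⟨δ, hδ, fun x hx y hy hxy => H x hx y hy hxy⟩

lemma continuous_subQ {N : ℕ} {h : Euc N → ℝ} (hh : Continuous h) (lam : ℝ) {m : ℝ}
    (hm : 0 ≤ m) :
    Continuous fun q : Euc N × ℝ × Euc N => h q.1 - lam * q.2.1 - ‖q.2.2‖ ^ m :=
  ((hh.comp continuous_fst).sub (continuous_const.mul (continuous_fst.comp continuous_snd))).sub
    ((continuous_snd.comp continuous_snd).norm.rpow_const fun _ => Or.inr hm)

lemma continuous_superQ {N : ℕ} {h : Euc N → ℝ} (hh : Continuous h) (lam : ℝ) {m : ℝ}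
    (hm : 0 ≤ m) :
    Continuous fun q : Euc N × ℝ × Euc N => ‖q.2.2‖ ^ m - lam * q.2.1 - h q.1 :=
  (((continuous_snd.comp continuous_snd).norm.rpow_const fun _ => Or.inr hm).sub
    (continuous_const.mul (continuous_fst.comp continuous_snd))).sub (hh.comp continuous_fst)

lemma norm_rpow_add_le {E : Type*} [NormedAddCommGroup E] [NormedSpace ℝ E] {m a b : ℝ}
    (hm : 1 ≤ m) (ha : 0 ≤ a) (hb : 0 ≤ b) (hab : a + b = 1) (x y : E) :
    ‖a • x + b • y‖ ^ m ≤ a * ‖x‖ ^ m + b * ‖y‖ ^ m := by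
  have h1 : ‖a • x + b • y‖ ≤ a * ‖x‖ + b * ‖y‖ := by
    refine (norm_add_le _ _).trans_eq ?_
    rw [norm_smul, norm_smul, Real.norm_of_nonneg ha, Real.norm_of_nonneg hb]
  refine (Real.rpow_le_rpow (norm_nonneg _) h1 (by linarith)).trans ?_
  exact (convexOn_rpow hm).2 (norm_nonneg x) (norm_nonneg y) ha hb hab

lemma le_of_isStatSub_of_isStatSuper_of_pos {N : ℕ} (hN : 1 ≤ N) {Ω : Set (Euc N)}
    (hΩo : IsOpen Ω) (hΩb : Bornology.IsBounded Ω) {h k u v : Euc N → ℝ} {lam m : ℝ}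
    (hh : Continuous h) (hlam : 0 < lam) (hm : 0 ≤ m)
    (hu : IsStatSub Ω h k lam m u) (hv : IsStatSuper Ω h k lam m v)
    (huk : ∀ z ∈ frontier Ω, u z ≤ k z) (hkv : ∀ z ∈ frontier Ω, k z ≤ v z) :
    ∀ x ∈ closure Ω, u x ≤ v x := by
  by_contra! ⟨x₀, hx₀, hlt⟩
  have hKc : IsCompact (closure Ω) := hΩb.isCompact_closure
  obtain ⟨δ, hδ, hunif⟩ := exists_forall_dist_lt_abs_sub_lt hKc hh
    (mul_pos hlam (sub_pos.2 hlt))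
  obtain ⟨z, hz, hzmax, y, p, hyA, hyz, hp, hsum, hQ⟩ := exists_sum_viscosity_nonneg hN
    (J := Fin 2) (A := fun _ => closure Ω) (O := fun _ => Ω) (fun _ => hKc) (fun _ => hΩo)
    (f := ![u, -v]) (Fin.forall_fin_two.2 ⟨hu.1, hv.1.neg⟩)
    (μ := fun _ => 1) (fun _ => one_pos)
    (Q := ![fun y r p => h y - lam * r - ‖p‖ ^ m, fun y r p => ‖p‖ ^ m - lam * r - h y])
    (Fin.forall_fin_two.2 ⟨continuous_subQ hh lam hm, continuous_superQ hh lam hm⟩)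
    (Fin.forall_fin_two.2 ⟨fun y hy φ hφ hmax => hu.neg_lapl_le hy.2 hφ hmax,
      fun y hy φ hφ hmax => hv.neg_lapl_le hy.1
        (fun hf => ((hΩo.frontier_eq ▸ hf : y ∈ closure Ω \ Ω).2 hy.2).elim) hφ hmax⟩)
    (x₀ := x₀) (fun _ => hx₀)
    (by
      intro z hz hmax _
      have hzx := hmax x₀ fun _ => hx₀
      simp only [Fin.sum_univ_two, Matrix.cons_val_zero, Matrix.cons_val_one, one_mul,
        Pi.neg_apply] at hzx
      rcases mem_or_mem_frontier_of_mem_closure (hz 0) with h1 | h1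
      · exact h1
      · linarith [huk z h1, hkv z h1])
    (half_pos hδ)
  have hzx := hzmax x₀ fun _ => hx₀
  simp only [Fin.sum_univ_two, Matrix.cons_val_zero, Matrix.cons_val_one, one_mul, one_smul,
    Pi.neg_apply] at hzx hp hsum hQ
  have hpn : ‖p 0‖ = ‖p 1‖ := by rw [eq_neg_of_add_eq_zero_left hp, norm_neg]
  have hd : dist (y 0) (y 1) < δ := by
    linarith [dist_triangle_right (y 0) (y 1) z, hyz 0, hyz 1]
  have h1 := (abs_lt.1 (hunif _ (hyA 0) _ (hyA 1) hd)).2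
  have h2 : lam * (u x₀ - v x₀) ≤ lam * (u (y 0) - v (y 1)) :=
    mul_le_mul_of_nonneg_left (by linarith) hlam.le
  rw [hpn] at hQ
  linarith

lemma exists_lt_one_convex_lt {a b c : ℝ} (hab : c < a) :
    ∃ κ > 0, κ < 1 ∧ c < (1 - κ) * a + κ * b := by
  have h1 : Tendsto (fun κ : ℝ => (1 - κ) * a + κ * b) (𝓝[>] 0) (𝓝 ((1 - 0) * a + 0 * b)) :=
    Tendsto.mono_left (Continuous.tendsto (by fun_prop) 0) nhdsWithin_le_nhds
  have h2 := h1.eventually (lt_mem_nhds (show c < (1 - 0) * a + 0 * b by linarith))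
  obtain ⟨κ, hκ, h3, h4⟩ := (h2.and (Ioo_mem_nhdsGT (zero_lt_one' ℝ))).exists
  exact ⟨κ, h3, h4, hκ⟩

lemma le_of_isStatSub_of_isStatSuper_of_strict {N : ℕ} (hN : 1 ≤ N) {Ω : Set (Euc N)}
    (hΩo : IsOpen Ω) (hΩb : Bornology.IsBounded Ω) {h k k' u v w : Euc N → ℝ} {m η : ℝ}
    (hh : Continuous h) (hm : 1 ≤ m) (hη : 0 < η)
    (hu : IsStatSub Ω h k 0 m u) (hw : IsStatSub Ω (fun x => h x - η) k' 0 m w)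
    (hv : IsStatSuper Ω h k 0 m v)
    (huk : ∀ z ∈ frontier Ω, u z ≤ k z) (hwk : ∀ z ∈ frontier Ω, w z ≤ k z)
    (hkv : ∀ z ∈ frontier Ω, k z ≤ v z) :
    ∀ x ∈ closure Ω, u x ≤ v x := by
  by_contra! ⟨x₀, hx₀, hlt⟩
  obtain ⟨κ, hκ, hκ1, hκlt⟩ := exists_lt_one_convex_lt (b := w x₀) hlt
  have hκ' : 0 < 1 - κ := sub_pos.2 hκ1
  have hKc : IsCompact (closure Ω) := hΩb.isCompact_closure
  obtain ⟨δ, hδ, hunif⟩ := exists_forall_dist_lt_abs_sub_lt hKc hh (mul_pos hκ hη)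
  have hm0 : 0 ≤ m := by linarith
  have hhη : Continuous fun x => h x - η := hh.sub continuous_const
  obtain ⟨z, hz, hzmax, y, p, hyA, hyz, hp, hsum, hQ⟩ := exists_sum_viscosity_nonneg hN
    (J := Fin 3) (A := fun _ => closure Ω) (O := fun _ => Ω) (fun _ => hKc) (fun _ => hΩo)
    (f := ![u, w, -v]) (by
      intro j; fin_cases j
      exacts [hu.1, hw.1, hv.1.neg])
    (μ := ![1 - κ, κ, 1]) (by intro j; fin_cases j; exacts [hκ', hκ, one_pos])
    (Q := ![fun y r p => h y - 0 * r - ‖p‖ ^ m, fun y r p => h y - η - 0 * r - ‖p‖ ^ m,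
      fun y r p => ‖p‖ ^ m - 0 * r - h y])
    (by
      intro j; fin_cases j
      exacts [continuous_subQ hh 0 hm0, continuous_subQ hhη 0 hm0, continuous_superQ hh 0 hm0])
    (by
      intro j y hy φ hφ hmax
      fin_cases j
      · exact hu.neg_lapl_le hy.2 hφ hmax
      · exact hw.neg_lapl_le hy.2 hφ hmax
      · exact hv.neg_lapl_le hy.1
          (fun hf => ((hΩo.frontier_eq ▸ hf : y ∈ closure Ω \ Ω).2 hy.2).elim) hφ hmax)
    (x₀ := x₀) (fun _ => hx₀)
    (by
      intro z hz hmax _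
      have hzx := hmax x₀ fun _ => hx₀
      simp only [Fin.sum_univ_three, Matrix.cons_val_zero, Matrix.cons_val_one, Matrix.cons_val,
        one_mul, Pi.neg_apply] at hzx
      rcases mem_or_mem_frontier_of_mem_closure (hz 0) with h1 | h1
      · exact h1
      · nlinarith [huk z h1, hkv z h1, hwk z h1])
    (half_pos hδ)
  simp only [Fin.sum_univ_three, Matrix.cons_val_zero, Matrix.cons_val_one, Matrix.cons_val,
    one_mul, one_smul, Pi.neg_apply, zero_mul, sub_zero] at hp hQ
  have hpn : ‖p 2‖ ^ m ≤ (1 - κ) * ‖p 0‖ ^ m + κ * ‖p 1‖ ^ m := by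
    rw [← neg_neg (p 2), ← eq_neg_of_add_eq_zero_left hp, norm_neg]
    exact norm_rpow_add_le hm hκ'.le hκ.le (by ring) _ _
  have hd : ∀ i j, dist (y i) (y j) < δ := fun i j => by
    linarith [dist_triangle_right (y i) (y j) z, hyz i, hyz j]
  have h1 := (abs_lt.1 (hunif _ (hyA 0) _ (hyA 2) (hd 0 2))).2
  have h2 := (abs_lt.1 (hunif _ (hyA 1) _ (hyA 2) (hd 1 2))).2
  have h3 := mul_lt_mul_of_pos_left h1 hκ'
  have h4 := mul_lt_mul_of_pos_left h2 hκ
  linarith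

/-! ### Hölder regularity of subsolutions in the superquadratic case -/

lemma holder_barrier_arith {n C C₂ a m s P b : ℝ} (hn : 0 ≤ n) (hC : 0 ≤ C) (hm : 2 ≤ m)
    (hC₂ : C₂ = n + 4) (ha : a = n + (C + 8 * n * C₂ + 32 * C₂) + 1)
    (hs : 0 < s) (hs1 : s < 1) (hP : 1 ≤ P) (hPm : (√s * P) ^ m = P) (hb : b = (1 - s)⁻¹) :
    C + n * (a * P + 2 * C₂ * b ^ 2) + 8 * C₂ * s * b ^ 3 <
      (√s * (a * P + 2 * C₂ * b ^ 2)) ^ m := by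
  have hC₂pos : 0 < C₂ := by linarith
  have hE : 0 ≤ C + 8 * n * C₂ + 32 * C₂ := by positivity
  have ha1 : 1 ≤ a := by linarith
  have hb1 : 1 ≤ b := by rw [hb]; exact (one_le_inv₀ (by linarith)).2 (by linarith)
  have hsq : 0 < √s := Real.sqrt_pos.2 hs
  have ham : a ^ 2 ≤ a ^ m := by
    rw [← Real.rpow_natCast]
    exact Real.rpow_le_rpow_of_exponent_le ha1 (by exact_mod_cast hm)
  have haE : n * a + (C + 8 * n * C₂ + 32 * C₂) < a ^ m := by
    refine lt_of_lt_of_le ?_ ham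
    nlinarith [mul_le_mul_of_nonneg_left ha1 hE]
  have hsum : a ^ m * P + (√s * (2 * C₂ * b ^ 2)) ^ m ≤
      (√s * (a * P + 2 * C₂ * b ^ 2)) ^ m := by
    rw [mul_add]
    refine le_trans ?_ (Real.add_rpow_le_rpow_add (by positivity) (by positivity) (by linarith))
    rw [show √s * (a * P) = a * (√s * P) by ring,
      Real.mul_rpow (x := a) (y := √s * P) (by positivity) (by positivity), hPm]
  refine lt_of_lt_of_le ?_ hsum
  have hmain : (n * a + (C + 8 * n * C₂ + 32 * C₂)) * P < a ^ m * P :=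
    mul_lt_mul_of_pos_right haE (by linarith)
  rcases le_or_gt s (1 / 2) with hs2 | hs2
  · have hb2 : b ≤ 2 := by
      rw [hb, inv_le_comm₀ (by linarith) two_pos]; linarith
    have h1 : b ^ 2 ≤ 4 := by nlinarith
    have h2 : s * b ^ 3 ≤ 4 := by
      have : b ^ 3 ≤ 8 := by nlinarith
      nlinarith [pow_nonneg (zero_le_one.trans hb1) 3]
    have h3 : 0 ≤ (√s * (2 * C₂ * b ^ 2)) ^ m := by positivity
    have h4 : C + 8 * n * C₂ + 32 * C₂ ≤ (C + 8 * n * C₂ + 32 * C₂) * P :=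
      le_mul_of_one_le_right hE hP
    have h5 : n * C₂ * b ^ 2 ≤ n * C₂ * 4 := mul_le_mul_of_nonneg_left h1 (by positivity)
    have h6 : C₂ * (s * b ^ 3) ≤ C₂ * 4 := mul_le_mul_of_nonneg_left h2 hC₂pos.le
    nlinarith
  · set X := √s * (2 * C₂ * b ^ 2) with hX
    have hX0 : 0 ≤ X := by positivity
    have hX2 : X ^ 2 = 4 * C₂ ^ 2 * s * b ^ 4 := by
      rw [hX, mul_pow, Real.sq_sqrt hs.le]; ring
    have hb4 : 1 ≤ b ^ 4 := one_le_pow₀ hb1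
    have h1 : 2 * C₂ ^ 2 * b ^ 4 ≤ X ^ 2 := by
      rw [hX2]
      have : 0 ≤ C₂ ^ 2 * b ^ 4 := by positivity
      nlinarith
    have hX1 : 1 ≤ X := by
      by_contra! hcon
      have : X ^ 2 < 1 := by nlinarith
      nlinarith [mul_le_mul_of_nonneg_left hb4 (by positivity : 0 ≤ 2 * C₂ ^ 2)]
    have hXm : X ^ 2 ≤ X ^ m := by
      rw [← Real.rpow_natCast]
      exact Real.rpow_le_rpow_of_exponent_le hX1 (by exact_mod_cast hm)
    have h2 : b ^ 2 ≤ b ^ 4 := pow_le_pow_right₀ hb1 (by norm_num)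
    have h3 : s * b ^ 3 ≤ b ^ 4 := by
      have : b ^ 3 ≤ b ^ 4 := pow_le_pow_right₀ hb1 (by norm_num)
      nlinarith [pow_nonneg (zero_le_one.trans hb1) 3]
    have h5 : n * C₂ * b ^ 2 ≤ n * C₂ * b ^ 4 := mul_le_mul_of_nonneg_left h2 (by positivity)
    have h6 : C₂ * (s * b ^ 3) ≤ C₂ * b ^ 4 := mul_le_mul_of_nonneg_left h3 hC₂pos.le
    have h7 : C ≤ C * P := le_mul_of_one_le_right hC hP
    have h8 : 0 ≤ (8 * n * C₂ + 32 * C₂) * P := by positivity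
    have h9 : 2 * C₂ ^ 2 * b ^ 4 = 2 * (n * C₂ * b ^ 4) + 8 * (C₂ * b ^ 4) := by
      rw [hC₂]; ring
    linarith

lemma lapl_const_mul_norm_sub_sq {N : ℕ} (c : ℝ) (z x : Euc N) :
    lapl (fun y => c * ‖y - z‖ ^ 2) x = c * (2 * N) := by
  rw [lapl_const_mul c (contDiff_norm_sub_sq z).contDiffAt, lapl_norm_sub_sq]

lemma gradient_const_mul_norm_sub_sq {N : ℕ} (c : ℝ) (z x : Euc N) :
    gradient (fun y => c * ‖y - z‖ ^ 2) x = (c * 2) • (x - z) := by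
  rw [gradient_const_mul c ((contDiff_norm_sub_sq (n := 1) z).differentiable one_ne_zero x),
    gradient_norm_sub_sq, smul_smul]

/-- A supersolution on `ball x r` which is singular at the centre and blows up at the boundary. -/
lemma exists_holder_barrier (N : ℕ) {m C : ℝ} (hm : 2 < m) (hC : 0 ≤ C) :
    ∃ K > 0, ∀ (x : Euc N) (r : ℝ), 0 < r → r ≤ 1 → ∃ Φ : Euc N → ℝ,
      Φ x = 0 ∧ ContinuousOn Φ (ball x r) ∧
      (∀ y, dist y x = r / 2 → Φ y ≤ K * (r / 2) ^ ((m - 2) / (m - 1))) ∧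
      (∀ M : ℝ, ∃ r' < r, ∀ y, r' ≤ dist y x → dist y x < r → M ≤ Φ y) ∧
      ∀ y ∈ ball x r, y ≠ x → ContDiffAt ℝ 2 Φ y ∧
        C < -lapl Φ y + ‖gradient Φ y‖ ^ m := by
  set α := (m - 2) / (m - 1) with hα
  have hm1 : 0 < m - 1 := by linarith
  have hα0 : 0 < α := div_pos (by linarith) hm1
  have hα1 : α < 1 := by rw [hα, div_lt_one hm1]; linarith
  have hαm : (α - 1) * m = α - 2 := by rw [hα]; field_simp; ring
  set C₂ : ℝ := N + 4 with hC₂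
  set a : ℝ := N + (C + 8 * N * C₂ + 32 * C₂) + 1 with ha
  have hC₂pos : 0 < C₂ := by positivity
  have hapos : 0 < a := by positivity
  set L := a / α with hL
  have hLpos : 0 < L := div_pos hapos hα0
  refine ⟨L + C₂, by positivity, fun x r hr hr1 => ?_⟩
  set f : Euc N → ℝ := fun y => (r⁻¹) ^ 2 * ‖y - x‖ ^ 2 with hf
  have hfc : ContDiff ℝ 2 f := contDiff_const.mul (contDiff_norm_sub_sq x)
  set ψ : ℝ → ℝ := fun s => r ^ α * (L * s ^ (α / 2) + C₂ * ((1 - s)⁻¹ - 1)) with hψ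
  have hfd : ∀ y, f y = (dist y x / r) ^ 2 := fun y => by
    rw [hf, dist_eq_norm]; ring
  have hf1 : ∀ y ∈ ball x r, f y < 1 := fun y hy => by
    rw [hfd]
    exact pow_lt_one₀ (by positivity) ((div_lt_one hr).2 hy) two_ne_zero
  have hrα : 0 < r ^ α := Real.rpow_pos_of_pos hr _
  refine ⟨fun y => ψ (f y), ?_, ?_, ?_, ?_, ?_⟩
  · simp [hf, hψ, Real.zero_rpow (by positivity : α / 2 ≠ 0)]
  · intro y hy
    have h1 : ContinuousAt f y := hfc.continuous.continuousAt
    have h2 : 1 - f y ≠ 0 := by linarith [hf1 y hy]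
    refine ContinuousAt.continuousWithinAt ?_
    exact continuousAt_const.mul ((continuousAt_const.mul
      (h1.rpow_const (Or.inr (by positivity)))).add
      (continuousAt_const.mul (((continuousAt_const.sub h1).inv₀ h2).sub continuousAt_const)))
  · intro y hy
    have h1 : f y = (1 / 2) ^ 2 := by rw [hfd, hy]; field_simp
    have h2 : ((1 / 2 : ℝ) ^ 2) ^ (α / 2) = (1 / 2) ^ α := by
      rw [← Real.rpow_natCast, ← Real.rpow_mul (by norm_num)]; congr 1; push_cast; ring
    have h3 : (r / 2) ^ α = r ^ α * (1 / 2) ^ α := by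
      rw [← Real.mul_rpow hr.le (by norm_num)]; congr 1; ring
    have h4 : (1 / 3 : ℝ) ≤ (1 / 2) ^ α := by
      have : (1 / 2 : ℝ) ^ (1 : ℝ) ≤ (1 / 2) ^ α :=
        Real.rpow_le_rpow_of_exponent_ge (by norm_num) (by norm_num) hα1.le
      rw [Real.rpow_one] at this
      linarith
    simp only [hψ]
    rw [h1, h2, h3, show (1 - (1 / 2 : ℝ) ^ 2)⁻¹ - 1 = 1 / 3 by norm_num,
      show (L + C₂) * (r ^ α * (1 / 2 : ℝ) ^ α) = r ^ α * (L * (1 / 2) ^ α + C₂ * (1 / 2) ^ α) by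
        ring]
    gcongr
  · intro M
    set b := |M| / (r ^ α * C₂) + 2 with hb
    have hbpos : 1 < b := by
      have : 0 ≤ |M| / (r ^ α * C₂) := by positivity
      linarith
    have hs1 : 1 - b⁻¹ < 1 := by simp; linarith
    have hs0 : 0 ≤ 1 - b⁻¹ := by
      have := inv_le_one_of_one_le₀ hbpos.le; linarith
    refine ⟨r * √(1 - b⁻¹), ?_, fun y hy hyr => ?_⟩
    · have : √(1 - b⁻¹) < 1 := by rw [Real.sqrt_lt' one_pos]; linarith
      nlinarith
    · have h1 : 1 - b⁻¹ ≤ f y := by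
        rw [hfd]
        refine Real.sqrt_le_left (by positivity) |>.1 ?_
        rw [le_div_iff₀ hr]; linarith
      have h2 := hf1 y hyr
      have h3 : b ≤ (1 - f y)⁻¹ := by
        rw [le_inv_comm₀ (by linarith) (by linarith)]; linarith
      have h4 : 0 ≤ f y := by rw [hfd]; positivity
      have h5 : 0 ≤ L * f y ^ (α / 2) := by positivity
      calc M ≤ |M| := le_abs_self M
        _ = r ^ α * (C₂ * (b - 2)) := by rw [hb]; field_simp; ring
        _ ≤ ψ (f y) := by
          simp only [hψ]
          refine mul_le_mul_of_nonneg_left ?_ hrα.le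
          nlinarith
  · intro y hy hyx
    have hs1 := hf1 y hy
    have hs0 : 0 < f y := by
      have := dist_pos.2 hyx
      rw [hfd]; positivity
    set s := f y with hs
    set ψ' : ℝ → ℝ := fun s => r ^ α * (L * (α / 2 * s ^ (α / 2 - 1)) + C₂ * ((1 - s)⁻¹) ^ 2)
      with hψ'
    set ψ'' : ℝ := r ^ α * (L * (α / 2 * ((α / 2 - 1) * s ^ (α / 2 - 1 - 1))) +
      C₂ * (2 * ((1 - s)⁻¹) ^ 3)) with hψ''
    have hinv : ∀ t : ℝ, t < 1 → HasDerivAt (fun t : ℝ => (1 - t)⁻¹) (((1 - t)⁻¹) ^ 2) t := by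
      intro t ht
      have h1 : HasDerivAt (fun t : ℝ => 1 - t) (-1) t := by
        simpa using (hasDerivAt_id t).const_sub 1
      exact (h1.inv (by linarith)).congr_deriv (by rw [neg_neg, inv_pow, one_div])
    have hd1 : ∀ᶠ t in 𝓝 s, HasDerivAt ψ (ψ' t) t := by
      filter_upwards [Ioo_mem_nhds hs0 hs1] with t ht
      have h1 := (Real.hasDerivAt_rpow_const (p := α / 2) (Or.inl ht.1.ne')).const_mul L
      have h2 := ((hinv t ht.2).sub_const 1).const_mul C₂
      exact (h1.add h2).const_mul (r ^ α)
    have hd2 : HasDerivAt ψ' ψ'' s := by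
      have h1 := ((Real.hasDerivAt_rpow_const (p := α / 2 - 1)
        (Or.inl hs0.ne')).const_mul (α / 2)).const_mul L
      have h2 := ((hinv s hs1).pow 2).const_mul C₂
      exact ((h1.add h2).const_mul (r ^ α)).congr_deriv (by rw [hψ'']; push_cast; ring)
    have hcψ : ContDiffAt ℝ 2 ψ s := by
      have h1 : ContDiffAt ℝ 2 (fun s : ℝ => s ^ (α / 2)) s :=
        Real.contDiffAt_rpow_const_of_ne hs0.ne'
      have h2 : ContDiffAt ℝ 2 (fun s : ℝ => (1 - s)⁻¹) s :=
        (contDiffAt_const.sub contDiffAt_id).inv (by simp only [id]; linarith)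
      exact contDiffAt_const.mul ((contDiffAt_const.mul h1).add
        (contDiffAt_const.mul (h2.sub contDiffAt_const)))
    refine ⟨ContDiffAt.comp (g := ψ) (f := f) y hcψ hfc.contDiffAt, ?_⟩
    have hψ'0 : 0 ≤ ψ' s := by simp only [hψ']; positivity
    rw [lapl_comp hfc.contDiffAt hd1 hd2,
      gradient_comp (hfc.differentiable two_ne_zero y) hd1.self_of_nhds,
      show lapl f y = r⁻¹ ^ 2 * (2 * N) from lapl_const_mul_norm_sub_sq _ _ _,
      show gradient f y = (r⁻¹ ^ 2 * 2) • (y - x) from gradient_const_mul_norm_sub_sq _ _ _]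
    have hsn : ‖y - x‖ = r * √s := by
      rw [hs, hfd, Real.sqrt_sq (by positivity), dist_eq_norm]; field_simp
    have hnorm : ‖(r⁻¹ ^ 2 * 2) • (y - x)‖ = r⁻¹ * (2 * √s) := by
      rw [norm_smul, hsn, Real.norm_of_nonneg (by positivity)]; field_simp
    rw [← hs, norm_smul (ψ' s) ((r⁻¹ ^ 2 * 2) • (y - x)), Real.norm_of_nonneg hψ'0, hnorm]
    set P := s ^ (α / 2 - 1) with hP
    have hP1 : 1 ≤ P := Real.one_le_rpow_of_pos_of_le_one_of_nonpos hs0 hs1.le (by linarith)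
    have hPm : (√s * P) ^ m = P := by
      rw [hP, Real.sqrt_eq_rpow, ← Real.rpow_add hs0, ← Real.rpow_mul hs0.le]
      congr 1; linarith
    have hr2 : 1 ≤ r ^ (α - 2) :=
      Real.one_le_rpow_of_pos_of_le_one_of_nonpos hr hr1 (by linarith)
    have hrm : (r ^ (α - 1)) ^ m = r ^ (α - 2) := by
      rw [← Real.rpow_mul hr.le, hαm]
    have hr1' : r ^ α * r⁻¹ = r ^ (α - 1) := by
      rw [Real.rpow_sub_one hr.ne', div_eq_mul_inv]
    have hr2' : r ^ α * r⁻¹ ^ 2 = r ^ (α - 2) := by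
      rw [Real.rpow_sub hr, show r ^ (2 : ℝ) = r ^ 2 by exact_mod_cast Real.rpow_natCast r 2,
        inv_pow, div_eq_mul_inv]
    set b := (1 - s)⁻¹ with hb
    have hbpos : 0 < b := inv_pos.2 (by linarith)
    have key := holder_barrier_arith (Nat.cast_nonneg N) hC hm.le hC₂ ha hs0 hs1 hP1 hPm hb
    have hLα : L * α = a := by rw [hL]; field_simp
    have e1 : ψ' s * (r⁻¹ * (2 * √s)) = r ^ (α - 1) * (√s * (a * P + 2 * C₂ * b ^ 2)) := by
      simp only [hψ', ← hr1', ← hLα]; ring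
    have e2 : ψ' s * (r⁻¹ ^ 2 * (2 * N)) = r ^ (α - 2) * (N * (a * P + 2 * C₂ * b ^ 2)) := by
      simp only [hψ', ← hr2', ← hLα]; ring
    have e3 : ψ'' * (r⁻¹ * (2 * √s)) ^ 2 ≤ r ^ (α - 2) * (8 * C₂ * s * b ^ 3) := by
      have h1 : ψ'' * (r⁻¹ * (2 * √s)) ^ 2 = r ^ (α - 2) * (4 * s *
          (L * (α / 2 * ((α / 2 - 1) * s ^ (α / 2 - 1 - 1))) + C₂ * (2 * b ^ 3))) := by
        rw [mul_pow, mul_pow, Real.sq_sqrt hs0.le, hψ'', ← hr2']; ring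
      rw [h1]
      refine mul_le_mul_of_nonneg_left ?_ (by positivity)
      have h2 : 0 ≤ L * (α / 2) * s ^ (α / 2 - 1 - 1) * s * (1 - α / 2) :=
        mul_nonneg (by positivity) (by linarith)
      linarith
    rw [e1, e2, Real.mul_rpow (by positivity) (by positivity), hrm]
    have h1 : C ≤ r ^ (α - 2) * C := le_mul_of_one_le_left hC hr2
    have h2 := mul_lt_mul_of_pos_left key (by linarith : 0 < r ^ (α - 2))
    linarith

lemma IsStatSub.exists_interior_holder {N : ℕ} {Ω : Set (Euc N)}
    (hΩb : Bornology.IsBounded Ω) {h k u : Euc N → ℝ} (hh : Continuous h) {lam m M : ℝ}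
    (hm : 2 < m) (hu : IsStatSub Ω h k lam m u) (hM : ∀ x ∈ closure Ω, |u x| ≤ M) :
    ∃ K > 0, ∀ x y, ball x (2 * dist y x) ⊆ Ω → 2 * dist y x ≤ 1 →
      u y ≤ u x + K * dist y x ^ ((m - 2) / (m - 1)) := by
  have hα : (m - 2) / (m - 1) ≠ 0 := (div_pos (by linarith) (by linarith)).ne'
  obtain ⟨H, hH⟩ := hΩb.isCompact_closure.exists_bound_of_continuousOn hh.continuousOn
  obtain ⟨K, hK, hbar⟩ := exists_holder_barrier N hm (C := |H| + |lam| * |M|) (by positivity)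
  refine ⟨K, hK, fun x y hball hle => ?_⟩
  rcases eq_or_ne y x with rfl | hyx
  · simp [Real.zero_rpow hα]
  have hd : 0 < dist y x := dist_pos.2 hyx
  obtain ⟨Φ, hΦx, hΦc, hΦy, hΦM, hΦ⟩ := hbar x (2 * dist y x) (by positivity) hle
  have hΦy' := hΦy y (by ring)
  rw [mul_div_cancel_left₀ _ two_ne_zero] at hΦy'
  refine le_trans ?_ (add_le_add_right hΦy' _)
  by_contra! hcon
  obtain ⟨r', hr', hr'Φ⟩ := hΦM (2 * M + 1)
  set R := max r' (dist y x) with hR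
  have hRlt : R < 2 * dist y x := max_lt hr' (by linarith)
  have hsub : closedBall x R ⊆ ball x (2 * dist y x) := closedBall_subset_ball hRlt
  have husc : UpperSemicontinuousOn (fun y => u y + -Φ y) (closedBall x R) :=
    (hu.1.mono (hsub.trans (hball.trans subset_closure))).add
      (hΦc.mono hsub).neg.upperSemicontinuousOn
  have hyR : y ∈ closedBall x R := mem_closedBall.2 (le_max_right _ _)
  obtain ⟨z, hz, hzmax⟩ := husc.exists_isMaxOn ⟨y, hyR⟩ (isCompact_closedBall x R)
  have hzΩ : z ∈ Ω := hball (hsub hz)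
  have hxΩ : x ∈ Ω := hball (mem_ball_self (by positivity))
  have h1 : u y + -Φ y ≤ u z + -Φ z := hzmax hyR
  have h2 := abs_le.1 (hM z (subset_closure hzΩ))
  have h3 := abs_le.1 (hM x (subset_closure hxΩ))
  have hzR : dist z x < R := by
    by_contra! hge
    linarith [hr'Φ z ((le_max_left _ _).trans hge) (hsub hz)]
  have hzx : z ≠ x := by
    rintro rfl
    linarith
  obtain ⟨hΦd, hΦop⟩ := hΦ z (hsub hz) hzx
  have hloc : IsLocalMaxOn (u - Φ) (closure Ω) z := by
    refine eventually_nhdsWithin_of_eventually_nhds ?_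
    filter_upwards [isOpen_ball.mem_nhds (mem_ball.2 hzR)] with t ht
    have : u t + -Φ t ≤ u z + -Φ z := hzmax (ball_subset_closedBall ht)
    simp only [Pi.sub_apply]; linarith
  have h4 := (hu.of_contDiffAt hΦd (subset_closure hzΩ) hloc).1 hzΩ
  have h5 := hH z (subset_closure hzΩ)
  have h6 : |lam * u z| ≤ |lam| * |M| := by
    rw [abs_mul]
    exact mul_le_mul_of_nonneg_left ((hM z (subset_closure hzΩ)).trans (le_abs_self M))
      (abs_nonneg _)
  rw [Real.norm_eq_abs] at h5
  simp only [statOp] at h4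
  linarith [(abs_le.1 h6).1, le_abs_self (h z), le_abs_self H]

/-- Interior cone condition at a boundary point. -/
lemma HasC2Boundary.exists_cone {N : ℕ} {Ω : Set (Euc N)} (hΩ : HasC2Boundary Ω) {z : Euc N}
    (hz : z ∈ frontier Ω) :
    ∃ ν : Euc N, ∃ c > 0, ∃ r > 0, ∃ t₀ > 0, ∀ x ∈ closure Ω, dist x z < r →
      ∀ t, 0 < t → t ≤ t₀ → ball (x + t • ν) (c * t) ⊆ Ω := by
  obtain ⟨ρ, hρ, hΩρ, hcl, hfr⟩ := hΩ.exists_defining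
  obtain ⟨hρz, hgz⟩ := hfr z hz
  set g := ‖gradient ρ z‖ with hg
  have hgpos : 0 < g := norm_pos_iff.2 hgz
  have hstrict := (hρ.contDiffAt (x := z)).hasStrictFDerivAt two_ne_zero
  have hev := hstrict.isLittleO.def (by positivity : 0 < g / 4)
  obtain ⟨r, hr, hball⟩ := Metric.eventually_nhds_iff.1 hev
  have hgrad : ∀ v, fderiv ℝ ρ z v = inner ℝ (gradient ρ z) v := fun v => by
    simp [gradient]
  refine ⟨-gradient ρ z, g / 2, by positivity, r / 2, by positivity, r / (4 * g), by positivity,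
    fun x hx hxz t ht ht₀ a ha => ?_⟩
  set e := a - (x + t • -gradient ρ z) with he
  have hen : ‖e‖ < g / 2 * t := by rw [he, ← dist_eq_norm]; exact ha
  have htg : t * g ≤ r / 4 := by
    rw [le_div_iff₀ (by positivity)] at ht₀
    linarith
  have hax : a - x = t • -gradient ρ z + e := by rw [he]; abel
  have hnax : ‖a - x‖ ≤ 3 / 2 * (t * g) := by
    rw [hax]
    refine (norm_add_le _ _).trans ?_
    rw [norm_smul, norm_neg, Real.norm_of_nonneg ht.le, ← hg]
    linarith
  have haz : dist a z < r := by
    have h1 := dist_triangle a x z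
    rw [dist_eq_norm a x] at h1
    linarith
  have h1 := hball (y := (a, x)) (by
    rw [Prod.dist_eq]; exact max_lt haz (by linarith : dist x z < r))
  simp only [hgrad] at h1
  rw [hax, inner_add_right, inner_smul_right, inner_neg_right, real_inner_self_eq_norm_sq,
    ← hg, ← hax, Real.norm_eq_abs] at h1
  have h2 : inner ℝ (gradient ρ z) e ≤ g * ‖e‖ := real_inner_le_norm _ _
  have h3 : ρ x ≤ 0 := by rw [hcl] at hx; exact hx
  have h4 := (abs_le.1 h1).2
  have h5 : g * ‖e‖ ≤ g * (g / 2 * t) := mul_le_mul_of_nonneg_left hen.le hgpos.le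
  have h6 : g / 4 * ‖a - x‖ ≤ g / 4 * (3 / 2 * (t * g)) :=
    mul_le_mul_of_nonneg_left hnax (by positivity)
  have h7 : 0 < g * g * t := by positivity
  rw [hΩρ]
  show ρ a < 0
  nlinarith

lemma le_of_le_add_rpow_of_tendsto {D : ℝ → ℝ} {C α θ t₀ : ℝ} (hα : 0 < α) (hθ : 0 < θ)
    (hθ1 : θ < 1) (hD : ∀ t, 0 < t → t ≤ t₀ → D t ≤ C * t ^ α + D (θ * t))
    (hlim : Tendsto D (𝓝[>] 0) (𝓝 0)) {t : ℝ} (ht : 0 < t) (htt₀ : t ≤ t₀) :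
    D t ≤ C / (1 - θ ^ α) * t ^ α := by
  have hθα : θ ^ α < 1 := Real.rpow_lt_one hθ.le hθ1 hα
  set B := C / (1 - θ ^ α) with hB
  have hBC : B - B * θ ^ α = C := by
    have : 1 - θ ^ α ≠ 0 := by linarith
    rw [hB]; field_simp
  have hstep : ∀ n : ℕ, D t - B * t ^ α ≤ D (θ ^ n * t) - B * (θ ^ n * t) ^ α := by
    intro n
    induction n with
    | zero => simp
    | succ n ih =>
      refine ih.trans ?_
      have hp : 0 < θ ^ n * t := by positivity
      have hle : θ ^ n * t ≤ t₀ :=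
        (mul_le_of_le_one_left ht.le (pow_le_one₀ hθ.le hθ1.le)).trans htt₀
      have h1 := hD _ hp hle
      have h2 : θ ^ (n + 1) * t = θ * (θ ^ n * t) := by ring
      rw [h2, Real.mul_rpow hθ.le hp.le]
      rw [← hBC] at h1
      linarith
  have hθn : Tendsto (fun n : ℕ => θ ^ n * t) atTop (𝓝[>] 0) := by
    refine tendsto_nhdsWithin_iff.2 ⟨?_, Eventually.of_forall fun n => ?_⟩
    · simpa using (tendsto_pow_atTop_nhds_zero_of_lt_one hθ.le hθ1).mul_const t
    · exact mem_Ioi.2 (by positivity)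
  have hpow : Tendsto (fun s : ℝ => s ^ α) (𝓝[>] 0) (𝓝 0) := by
    have : Tendsto (fun s : ℝ => s ^ α) (𝓝 0) (𝓝 (0 ^ α)) :=
      (Real.continuousAt_rpow_const 0 α (Or.inr hα.le))
    rw [Real.zero_rpow hα.ne'] at this
    exact this.mono_left nhdsWithin_le_nhds
  have hlim2 : Tendsto (fun n : ℕ => D (θ ^ n * t) - B * (θ ^ n * t) ^ α) atTop (𝓝 (0 - B * 0)) :=
    (hlim.comp hθn).sub ((hpow.comp hθn).const_mul B)
  have := ge_of_tendsto' hlim2 hstep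
  linarith

lemma IsStatSub.exists_tendsto {N : ℕ} {Ω : Set (Euc N)} (hΩo : IsOpen Ω)
    (hΩb : Bornology.IsBounded Ω) (hΩ : HasC2Boundary Ω) {h k u : Euc N → ℝ}
    (hh : Continuous h) {lam m M : ℝ} (hm : 2 < m) (hu : IsStatSub Ω h k lam m u)
    (hM : ∀ x ∈ closure Ω, |u x| ≤ M) :
    ContinuousOn u Ω ∧ ∀ z ∈ closure Ω, ∃ l, Tendsto u (𝓝[Ω] z) (𝓝 l) := by
  obtain ⟨K, hK, hhol⟩ := hu.exists_interior_holder hΩb hh hm hM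
  set α := (m - 2) / (m - 1) with hαdef
  have hα : 0 < α := div_pos (by linarith) (by linarith)
  have hrpow : Tendsto (fun s : ℝ => K * s ^ α) (𝓝 0) (𝓝 0) := by
    have : Tendsto (fun s : ℝ => s ^ α) (𝓝 0) (𝓝 (0 ^ α)) :=
      (Real.continuousAt_rpow_const 0 α (Or.inr hα.le))
    rw [Real.zero_rpow hα.ne'] at this
    simpa using this.const_mul K
  have hholabs : ∀ x y, ball x (2 * dist y x) ⊆ Ω → ball y (2 * dist y x) ⊆ Ω →
      2 * dist y x ≤ 1 → |u x - u y| ≤ K * dist y x ^ α := by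
    intro x y h1 h2 h3
    have h4 := hhol x y h1 h3
    rw [dist_comm] at h2 h3
    have h5 := hhol y x h2 h3
    rw [dist_comm] at h5
    exact abs_le.2 ⟨by linarith, by linarith⟩
  have hcont : ContinuousOn u Ω := by
    intro x hx
    refine ContinuousAt.continuousWithinAt ?_
    obtain ⟨r, hr, hrΩ⟩ := Metric.isOpen_iff.1 hΩo x hx
    have h0 : Tendsto (fun y => dist y x) (𝓝 x) (𝓝 0) :=
      tendsto_iff_dist_tendsto_zero.1 tendsto_id
    rw [ContinuousAt, tendsto_iff_dist_tendsto_zero]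
    refine squeeze_zero' (Eventually.of_forall fun _ => dist_nonneg) ?_ (hrpow.comp h0)
    filter_upwards [ball_mem_nhds x (by positivity : 0 < min (r / 3) (1 / 2))] with y hy
    have hy1 : dist y x < r / 3 := lt_of_lt_of_le hy (min_le_left _ _)
    have hy2 : dist y x < 1 / 2 := lt_of_lt_of_le hy (min_le_right _ _)
    rw [Real.dist_eq, abs_sub_comm]
    refine hholabs x y ((ball_subset_ball (by linarith)).trans hrΩ) ?_ (by linarith)
    exact (ball_subset_ball' (by linarith)).trans hrΩ
  refine ⟨hcont, fun z hz => ?_⟩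
  rcases mem_or_mem_frontier_of_mem_closure hz with hzΩ | hzf
  · exact ⟨u z, hcont z hzΩ⟩
  have hne : (𝓝[Ω] z).NeBot := mem_closure_iff_nhdsWithin_neBot.1 hz
  obtain ⟨ν, c, hc, r, hr, t₀, ht₀, hcone⟩ := hΩ.exists_cone hzf
  set θ := 1 - c / (4 * (‖ν‖ + c)) with hθ
  have hden : 0 < 4 * (‖ν‖ + c) := by positivity
  have hc4 : c / (4 * (‖ν‖ + c)) ≤ 1 / 4 := by
    rw [div_le_iff₀ hden]; linarith [norm_nonneg ν]
  have hcpos : 0 < c / (4 * (‖ν‖ + c)) := by positivity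
  have hθν : 2 * ((1 - θ) * ‖ν‖) ≤ c / 2 := by
    rw [hθ, sub_sub_cancel, div_mul_eq_mul_div, mul_div_assoc', div_le_iff₀ hden]
    nlinarith [norm_nonneg ν]
  set t₁ := min t₀ (1 / c) with ht₁
  have ht₁pos : 0 < t₁ := by positivity
  have hradial : ∀ x ∈ Ω, dist x z < r → ∀ t, 0 < t → t ≤ t₁ →
      |u x - u (x + t • ν)| ≤ K * ((1 - θ) * ‖ν‖) ^ α / (1 - θ ^ α) * t ^ α := by
    intro x hx hxz t ht htt
    refine le_of_le_add_rpow_of_tendsto (D := fun t => |u x - u (x + t • ν)|) hα (by linarith)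
      (by linarith) (fun s hs hst => ?_) ?_ ht htt
    · have hst₀ : s ≤ t₀ := hst.trans (min_le_left _ _)
      have hsc : c * s ≤ 1 := by
        have := hst.trans (min_le_right _ _)
        rw [le_div_iff₀ hc] at this
        linarith
      have hdist : dist (x + (θ * s) • ν) (x + s • ν) = (1 - θ) * ‖ν‖ * s := by
        rw [dist_add_left, dist_eq_norm, ← sub_smul, norm_smul,
          show θ * s - s = -((1 - θ) * s) by ring, norm_neg, Real.norm_of_nonneg (by
            have : 0 < 1 - θ := by linarith
            positivity)]
        ring
      have hds : 2 * dist (x + (θ * s) • ν) (x + s • ν) ≤ c * s / 2 := by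
        rw [hdist]; nlinarith
      have hcs : 0 < c * s := mul_pos hc hs
      have hcθ : c * s / 2 ≤ c * (θ * s) := by nlinarith
      have hθs : θ * s ≤ s := mul_le_of_le_one_left hs.le (by linarith)
      have h1 := hholabs (x + s • ν) (x + (θ * s) • ν)
        ((ball_subset_ball (by linarith)).trans (hcone x (subset_closure hx) hxz s hs hst₀))
        ((ball_subset_ball (by linarith)).trans (hcone x (subset_closure hx) hxz (θ * s)
          (mul_pos (by linarith) hs) (by linarith))) (by linarith)
      have h0 : 0 ≤ (1 - θ) * ‖ν‖ := mul_nonneg (by linarith) (norm_nonneg _)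
      rw [hdist, Real.mul_rpow h0 hs.le] at h1
      have h2 := abs_sub_le (u x) (u (x + (θ * s) • ν)) (u (x + s • ν))
      rw [abs_sub_comm (u (x + (θ * s) • ν))] at h2
      linarith
    · have h1 : ContinuousAt (fun t : ℝ => |u x - u (x + t • ν)|) 0 := by
        have h2 : ContinuousAt (fun t : ℝ => u (x + t • ν)) 0 := by
          refine ContinuousAt.comp (g := u) (f := fun t : ℝ => x + t • ν) ?_ (by fun_prop)
          simpa using hcont.continuousAt (hΩo.mem_nhds hx)
        exact (continuousAt_const.sub h2).abs
      have h3 := h1.tendsto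
      simp only [zero_smul, add_zero, sub_self, abs_zero] at h3
      exact h3.mono_left nhdsWithin_le_nhds
  refine CompleteSpace.complete (Metric.cauchy_iff.2 ⟨hne.map u, fun ε hε => ?_⟩)
  set B := K * ((1 - θ) * ‖ν‖) ^ α / (1 - θ ^ α) with hB
  have hBlim : Tendsto (fun s : ℝ => B * s ^ α) (𝓝[>] 0) (𝓝 0) := by
    have : Tendsto (fun s : ℝ => s ^ α) (𝓝 0) (𝓝 (0 ^ α)) :=
      (Real.continuousAt_rpow_const 0 α (Or.inr hα.le))
    rw [Real.zero_rpow hα.ne'] at this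
    simpa using (this.const_mul B).mono_left nhdsWithin_le_nhds
  obtain ⟨t, ht, htpos, htle⟩ := ((hBlim.eventually (gt_mem_nhds (by positivity : 0 < ε / 3))).and
    (Ioc_mem_nhdsGT ht₁pos)).exists
  obtain ⟨r₁, hr₁, hr₁K⟩ := Metric.eventually_nhds_iff.1
    (hrpow.eventually (gt_mem_nhds (by positivity : 0 < ε / 3)))
  have htc : c * t ≤ 1 := by
    have := htle.trans (min_le_right _ _)
    rw [le_div_iff₀ hc] at this
    linarith
  set r₂ := min r (min (r₁ / 2) (c * t / 4)) with hr₂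
  have hr₂pos : 0 < r₂ := by positivity
  refine ⟨u '' (Ω ∩ ball z r₂), image_mem_map (inter_mem self_mem_nhdsWithin
    (mem_nhdsWithin_of_mem_nhds (ball_mem_nhds z hr₂pos))), ?_⟩
  rintro _ ⟨x, ⟨hx, hxz⟩, rfl⟩ _ ⟨y, ⟨hy, hyz⟩, rfl⟩
  rw [mem_ball] at hxz hyz
  have hmin1 : r₂ ≤ r := min_le_left _ _
  have hmin2 : r₂ ≤ r₁ / 2 := (min_le_right _ _).trans (min_le_left _ _)
  have hmin3 : r₂ ≤ c * t / 4 := (min_le_right _ _).trans (min_le_right _ _)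
  have hxy : dist y x < 2 * r₂ := by linarith [dist_triangle_right y x z]
  have h1 := hradial x hx (by linarith) t htpos htle
  have h2 := hradial y hy (by linarith) t htpos htle
  have htt₀ : t ≤ t₀ := htle.trans (min_le_left _ _)
  have h3 := hholabs (x + t • ν) (y + t • ν)
    ((ball_subset_ball (by rw [dist_add_right]; linarith)).trans
      (hcone x (subset_closure hx) (by linarith) t htpos htt₀))
    ((ball_subset_ball (by rw [dist_add_right]; linarith)).trans
      (hcone y (subset_closure hy) (by linarith) t htpos htt₀))
    (by rw [dist_add_right]; linarith)
  rw [dist_add_right] at h3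
  have h4 := hr₁K (y := dist y x) (by
    rw [Real.dist_eq, sub_zero, abs_of_nonneg dist_nonneg]; linarith)
  rw [Real.dist_eq]
  rw [abs_le] at h1 h2 h3
  exact abs_lt.2 ⟨by linarith, by linarith⟩

lemma IsStatSub.exists_continuousOn {N : ℕ} (hN : 1 ≤ N) {Ω : Set (Euc N)} (hΩo : IsOpen Ω)
    (hΩb : Bornology.IsBounded Ω) (hΩ : HasC2Boundary Ω) {h k u : Euc N → ℝ}
    (hh : Continuous h) (hk : Continuous k) {lam m M : ℝ} (hlam : 0 ≤ lam) (hm : 2 < m)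
    (hu : IsStatSub Ω h k lam m u) (hM : ∀ x ∈ closure Ω, |u x| ≤ M) :
    ∃ w, ContinuousOn w (closure Ω) ∧ IsStatSub Ω h k lam m w ∧ (∀ x ∈ Ω, w x = u x) ∧
      ∀ x ∈ closure Ω, w x ≤ u x := by
  obtain ⟨hcont, hlim⟩ := hu.exists_tendsto hΩo hΩb hΩ hh hm hM
  have hwc : ContinuousOn (extendFrom Ω u) (closure Ω) := continuousOn_extendFrom subset_rfl hlim
  have hwu : ∀ x ∈ Ω, extendFrom Ω u x = u x := fun x hx =>
    extendFrom_eq (subset_closure hx) (hcont x hx)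
  have hwle : ∀ x ∈ closure Ω, extendFrom Ω u x ≤ u x := by
    intro x hx
    obtain ⟨l, hl⟩ := hlim x hx
    rw [extendFrom_eq hx hl]
    have hne : (𝓝[Ω] x).NeBot := mem_closure_iff_nhdsWithin_neBot.1 hx
    refine le_of_forall_gt_imp_ge_of_dense fun b hb => ?_
    exact le_of_tendsto hl (((hu.1 x hx b hb).filter_mono
      (nhdsWithin_mono x subset_closure)).mono fun _ => le_of_lt)
  refine ⟨extendFrom Ω u, hwc, ⟨hwc.upperSemicontinuousOn, fun φ hφ x hx hmax => ⟨fun hxΩ => ?_,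
    fun hxf => ?_⟩⟩, hwu, hwle⟩
  · rw [hwu x hxΩ]
    refine (hu.2 φ hφ x hx ?_).1 hxΩ
    have hΩx : ∀ᶠ y in 𝓝[closure Ω] x, y ∈ Ω := mem_nhdsWithin_of_mem_nhds (hΩo.mem_nhds hxΩ)
    filter_upwards [hmax, hΩx] with y hy hyΩ
    simpa only [Pi.sub_apply, hwu y hyΩ, hwu x hxΩ] using hy
  · refine min_le_of_right_le ?_
    linarith [hwle x hx, hu.le_frontier hN hΩb hΩ hh hk hlam hxf]

/-! ### Comparison of continuous sub- and supersolutions -/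

lemma IsStatSub.neg_lapl_le_translate {N : ℕ} {Ω : Set (Euc N)} {h k u φ : Euc N → ℝ} {lam m : ℝ}
    (hu : IsStatSub Ω h k lam m u) {y τ : Euc N} (hy : y + τ ∈ Ω) (hφ : ContDiff ℝ 2 φ)
    (hmax : IsLocalMaxOn ((fun y => u (y + τ)) - φ) {y | y + τ ∈ closure Ω} y) :
    -lapl φ y ≤ h (y + τ) - lam * u (y + τ) - ‖gradient φ y‖ ^ m := by
  have ht : Tendsto (fun x => x + -τ) (𝓝[closure Ω] (y + τ)) (𝓝[{y | y + τ ∈ closure Ω}] y) := by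
    refine tendsto_nhdsWithin_iff.2 ⟨?_, ?_⟩
    · have : Tendsto (fun x => x + -τ) (𝓝 (y + τ)) (𝓝 (y + τ + -τ)) :=
        Continuous.tendsto (by fun_prop) _
      rw [add_neg_cancel_right] at this
      exact this.mono_left nhdsWithin_le_nhds
    · filter_upwards [self_mem_nhdsWithin] with x hx
      simpa using hx
  have hmax' : IsLocalMaxOn (u - fun x => φ (x + -τ)) (closure Ω) (y + τ) := by
    filter_upwards [ht.eventually hmax] with x hx
    simpa using hx
  have hφτ : ContDiff ℝ 2 fun x => φ (x + -τ) := hφ.comp (contDiff_id.add contDiff_const)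
  have key := hu.neg_lapl_le hy hφτ hmax'
  rwa [lapl_comp_add_right, gradient_comp_add_right, add_neg_cancel_right] at key

lemma neg_lapl_le_of_isLocalMaxOn_quadratic {N : ℕ} {z y : Euc N} {C R m : ℝ} (hC : 0 ≤ C)
    (hm : 0 ≤ m) {φ : Euc N → ℝ} (hφ : ContDiff ℝ 2 φ) (hy : y ∈ ball z R)
    (hmax : IsLocalMaxOn ((fun x => -C * ‖x - z‖ ^ 2) - φ) (closedBall z R) y) :
    -lapl φ y ≤ C * (2 * N) + (C * 2 * R) ^ m - ‖gradient φ y‖ ^ m := by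
  have hloc : IsLocalMax ((fun x => -C * ‖x - z‖ ^ 2) - φ) y :=
    hmax.isLocalMax (mem_of_superset (isOpen_ball.mem_nhds hy) ball_subset_closedBall)
  obtain ⟨h1, h2⟩ := gradient_eq_and_lapl_le_of_isLocalMax hloc
    (contDiff_const.mul (contDiff_norm_sub_sq z)).contDiffAt hφ.contDiffAt
  rw [lapl_const_mul_norm_sub_sq] at h2
  rw [gradient_const_mul_norm_sub_sq] at h1
  have h3 : ‖gradient φ y‖ ≤ C * 2 * R := by
    rw [h1, norm_smul, Real.norm_eq_abs, show -C * 2 = -(C * 2) by ring, abs_neg,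
      abs_of_nonneg (by positivity), ← dist_eq_norm]
    exact mul_le_mul_of_nonneg_left (le_of_lt hy) (by positivity)
  have h4 := Real.rpow_le_rpow (norm_nonneg _) h3 hm
  linarith

lemma HasC2Boundary.exists_inward_shift {N : ℕ} {Ω : Set (Euc N)} (hΩ : HasC2Boundary Ω)
    (hΩo : IsOpen Ω) {k v : Euc N → ℝ} (hk : Continuous k) (hv : ContinuousOn v (closure Ω))
    {z : Euc N} (hz : z ∈ closure Ω) (hvk : z ∈ frontier Ω → v z < k z) :
    ∃ ν : Euc N, ∃ r > 0, ∃ t₀ > (0 : ℝ), ∀ x ∈ closure Ω, dist x z < r →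
      (∀ t, 0 < t → t ≤ t₀ → x + t • ν ∈ Ω) ∧ (x ∈ frontier Ω → v x < k x) := by
  rcases mem_or_mem_frontier_of_mem_closure hz with hzΩ | hzf
  · obtain ⟨r, hr, hrΩ⟩ := Metric.isOpen_iff.1 hΩo z hzΩ
    refine ⟨0, r, hr, 1, one_pos, fun x _ hxr => ⟨fun t _ _ => by simpa using hrΩ hxr,
      fun hf => ?_⟩⟩
    rw [hΩo.frontier_eq] at hf
    exact (hf.2 (hrΩ hxr)).elim
  · obtain ⟨ν, c, hc, r, hr, t₀, ht₀, hcone⟩ := hΩ.exists_cone hzf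
    have hev : ∀ᶠ x in 𝓝[closure Ω] z, v x < k x :=
      (hv z hz).eventually_lt hk.continuousWithinAt (hvk hzf)
    obtain ⟨r₁, hr₁, hlt⟩ := Metric.eventually_nhds_iff.1 (eventually_nhdsWithin_iff.1 hev)
    refine ⟨ν, min r r₁, by positivity, t₀, ht₀, fun x hx hxr => ⟨fun t ht htt₀ => ?_, fun _ => ?_⟩⟩
    · exact hcone x hx (hxr.trans_le (min_le_left _ _)) t ht htt₀ (mem_ball_self (by positivity))
    · exact hlt (hxr.trans_le (min_le_right _ _)) hx

lemma exists_pos_lt_half_mul_lt {a b c d : ℝ} (hb : 0 < b) (hd : 0 < d) :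
    ∃ κ > 0, κ < 1 / 2 ∧ κ * a < b ∧ κ * c < d := by
  have h1 : ∀ a b : ℝ, 0 < b → ∀ᶠ κ in 𝓝[>] (0 : ℝ), κ * a < b := fun a b hb => by
    have h2 : Tendsto (fun κ : ℝ => κ * a) (𝓝[>] 0) (𝓝 (0 * a)) :=
      (Continuous.tendsto (by fun_prop) 0).mono_left nhdsWithin_le_nhds
    rw [zero_mul] at h2
    exact h2.eventually (gt_mem_nhds hb)
  obtain ⟨κ, ⟨h2, h3⟩, h4, h5⟩ := (((h1 a b hb).and (h1 c d hd)).and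
    (Ioo_mem_nhdsGT (by norm_num : (0 : ℝ) < 1 / 2))).exists
  exact ⟨κ, h4, h5, h2, h3⟩

set_option maxHeartbeats 1000000 in
/-- Comparison for continuous functions when a continuous strict subsolution is available. -/
lemma le_of_isStatSub_of_isStatSuper_of_continuousOn {N : ℕ} (hN : 1 ≤ N) {Ω : Set (Euc N)}
    (hΩo : IsOpen Ω) (hΩb : Bornology.IsBounded Ω) (hΩ : HasC2Boundary Ω)
    {h k k' u v w : Euc N → ℝ} {lam m η : ℝ} (hh : Continuous h) (hk : Continuous k)
    (hlam : 0 ≤ lam) (hm : 1 ≤ m) (hη : 0 < η)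
    (hu : IsStatSub Ω h k lam m u) (hw : IsStatSub Ω (fun x => h x - η) k' lam m w)
    (hv : IsStatSuper Ω h k lam m v) (huc : ContinuousOn u (closure Ω))
    (hwc : ContinuousOn w (closure Ω)) (hvc : ContinuousOn v (closure Ω))
    (huk : ∀ z ∈ frontier Ω, u z ≤ k z) (hwk : ∀ z ∈ frontier Ω, w z ≤ k z) :
    ∀ x ∈ closure Ω, u x ≤ v x := by
  by_contra! ⟨x₀, hx₀, hlt⟩
  obtain ⟨κ, hκ, hκ1, hκlt⟩ := exists_lt_one_convex_lt (b := w x₀) hlt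
  have hκ' : 0 < 1 - κ := sub_pos.2 hκ1
  have hm0 : 0 ≤ m := by linarith
  have hKc : IsCompact (closure Ω) := hΩb.isCompact_closure
  set G : Euc N → ℝ := fun x => (1 - κ) * u x + κ * w x with hG
  have hGc : ContinuousOn G (closure Ω) :=
    (continuousOn_const.mul huc).add (continuousOn_const.mul hwc)
  obtain ⟨z, hz, hzmax⟩ := hKc.exists_isMaxOn ⟨x₀, hx₀⟩ (hGc.sub hvc)
  have hzmax' : ∀ x ∈ closure Ω, G x - v x ≤ G z - v z := fun x hx => hzmax hx
  have hMpos : 0 < G z - v z := by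
    have := hzmax' x₀ hx₀
    simp only [hG] at this ⊢
    linarith
  have hvk : z ∈ frontier Ω → v z < k z := fun hf => by
    have h1 := mul_le_mul_of_nonneg_left (huk z hf) hκ'.le
    have h2 := mul_le_mul_of_nonneg_left (hwk z hf) hκ.le
    simp only [hG] at hMpos
    linarith
  obtain ⟨ν, r, hr, t₀, ht₀, hshift⟩ := hΩ.exists_inward_shift hΩo hk hvc hz hvk
  obtain ⟨R, hRpos, hR⟩ := (hΩb.closure).subset_ball_lt 0 z
  obtain ⟨S, hS⟩ := hKc.exists_bound_of_continuousOn hGc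
  obtain ⟨H, hH⟩ := hKc.exists_bound_of_continuousOn hh.continuousOn
  have hS0 : 0 ≤ S := (norm_nonneg _).trans (hS z hz)
  set C := (2 * S + 1) / r ^ 2 with hC
  have hC0 : 0 ≤ C := by positivity
  have hCr : C * r ^ 2 = 2 * S + 1 := by rw [hC]; field_simp
  set B := C * (2 * N) + (C * 2 * R) ^ m with hB
  obtain ⟨ε, hε, hε2, hεB, hεM⟩ := exists_pos_lt_half_mul_lt (a := B + H) (b := κ * η / 8)
    (c := S + 1) (d := G z - v z) (by positivity) hMpos
  have hε1 : 0 < 1 - ε := by linarith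
  obtain ⟨δ₁, hδ₁, hunif⟩ := exists_forall_dist_lt_abs_sub_lt hKc hh
    (by positivity : 0 < κ * η / 8)
  obtain ⟨δ₂, hδ₂, hGunif⟩ := Metric.uniformContinuousOn_iff.1
    (hKc.uniformContinuousOn_of_continuous hGc) (ε / 4) (by positivity)
  obtain ⟨t, ht, htt₀, htν⟩ : ∃ t > 0, t ≤ t₀ ∧ ‖t • ν‖ < min δ₂ (δ₁ / 3) := by
    have h1 : Tendsto (fun t : ℝ => ‖t • ν‖) (𝓝[>] 0) (𝓝 ‖(0 : ℝ) • ν‖) :=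
      (Continuous.tendsto (by fun_prop) 0).mono_left nhdsWithin_le_nhds
    rw [zero_smul, norm_zero] at h1
    obtain ⟨t, h2, h3, h4⟩ := ((h1.eventually (gt_mem_nhds
      (by positivity : 0 < min δ₂ (δ₁ / 3)))).and (Ioc_mem_nhdsGT ht₀)).exists
    exact ⟨t, h3, h4, h2⟩
  set τ := t • ν with hτ
  have hτ2 : ‖τ‖ < δ₂ := htν.trans_le (min_le_left _ _)
  have hτ1 : ‖τ‖ < δ₁ / 3 := htν.trans_le (min_le_right _ _)
  set ψ : Euc N → ℝ := fun x => -C * ‖x - z‖ ^ 2 with hψ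
  have hψc : Continuous ψ := (contDiff_const.mul (contDiff_norm_sub_sq (n := 1) z)).continuous
  have hGτ : ∀ x ∈ closure Ω, x + τ ∈ closure Ω → |G (x + τ) - G x| < ε / 4 := fun x hx hxτ =>
    hGunif _ hxτ _ hx (by simpa [dist_eq_norm] using hτ2)
  have hzτ : z + τ ∈ closure Ω := subset_closure ((hshift z hz (by simpa)).1 t ht htt₀)
  have hFz : (1 - ε) * G z - v z - ε / 4 < (1 - ε) * G (z + τ) + ε * ψ z - v z := by
    have h1 := (abs_lt.1 (hGτ z hz hzτ)).1
    have h2 : ψ z = 0 := by simp [hψ]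
    rw [h2]
    nlinarith
  have hnear : ∀ x ∈ closure Ω, x + τ ∈ closure Ω →
      (1 - ε) * G (z + τ) + ε * ψ z - v z ≤ (1 - ε) * G (x + τ) + ε * ψ x - v x →
      dist x z < r := by
    intro x hx hxτ hle
    by_contra! hge
    have h1 := (abs_lt.1 (hGτ x hx hxτ)).2
    have h2 := hzmax' x hx
    have h3 : ψ x ≤ -(2 * S + 1) := by
      rw [← hCr]
      have : r ^ 2 ≤ ‖x - z‖ ^ 2 := by rw [← dist_eq_norm]; gcongr
      simp only [hψ]
      nlinarith
    have h4 := mul_le_mul_of_nonneg_left h3 hε.le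
    have h5 := hS x hx
    have h6 := hS z hz
    rw [Real.norm_eq_abs, abs_le] at h5 h6
    have h7 : ε * (G z - G x) ≤ ε * (2 * S) := mul_le_mul_of_nonneg_left (by linarith) hε.le
    have h8 : (1 - ε) * G (x + τ) ≤ (1 - ε) * (G x + ε / 4) :=
      mul_le_mul_of_nonneg_left (by linarith) hε1.le
    linarith [mul_pos hε hε]
  have hAτ : IsCompact {y | y + τ ∈ closure Ω} :=
    (Homeomorph.addRight τ).isCompact_preimage.2 hKc
  have hOτ : IsOpen {y | y + τ ∈ Ω} := hΩo.preimage (Homeomorph.addRight τ).continuous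
  have hmaps : MapsTo (fun y => y + τ) {y | y + τ ∈ closure Ω} (closure Ω) := fun _ hy => hy
  have hcτ : ContinuousOn (fun y => y + τ) {y | y + τ ∈ closure Ω} :=
    (continuous_id.add continuous_const).continuousOn
  have hhτ : Continuous fun y => h (y + τ) := hh.comp (continuous_id.add continuous_const)
  have hzA : z ∈ closedBall z R := mem_closedBall_self hRpos.le
  obtain ⟨z', hz', hz'max, y, p, hyA, hyz, hp, hsum, hQ⟩ := exists_sum_viscosity_nonneg hN
    (J := Fin 4)
    (A := ![{y | y + τ ∈ closure Ω}, {y | y + τ ∈ closure Ω}, closedBall z R, closure Ω])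
    (O := ![{y | y + τ ∈ Ω}, {y | y + τ ∈ Ω}, ball z R, ball z r])
    (by intro j; fin_cases j; exacts [hAτ, hAτ, isCompact_closedBall z R, hKc])
    (by intro j; fin_cases j; exacts [hOτ, hOτ, isOpen_ball, isOpen_ball])
    (f := ![fun y => u (y + τ), fun y => w (y + τ), ψ, -v])
    (by
      intro j; fin_cases j
      exacts [(huc.comp hcτ hmaps).upperSemicontinuousOn,
        (hwc.comp hcτ hmaps).upperSemicontinuousOn, hψc.continuousOn.upperSemicontinuousOn,
        hvc.neg.upperSemicontinuousOn])
    (μ := ![(1 - ε) * (1 - κ), (1 - ε) * κ, ε, 1])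
    (by intro j; fin_cases j; exacts [mul_pos hε1 hκ', mul_pos hε1 hκ, hε, one_pos])
    (Q := ![fun y r p => h (y + τ) - lam * r - ‖p‖ ^ m,
      fun y r p => h (y + τ) - η - lam * r - ‖p‖ ^ m, fun _ r p => B - 0 * r - ‖p‖ ^ m,
      fun y r p => ‖p‖ ^ m - lam * r - h y])
    (by
      intro j; fin_cases j
      exacts [continuous_subQ hhτ lam hm0, continuous_subQ (hhτ.sub continuous_const) lam hm0,
        continuous_subQ (h := fun _ => B) continuous_const 0 hm0, continuous_superQ hh lam hm0])
    (by
      intro j y hy φ hφ hmax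
      fin_cases j
      · exact hu.neg_lapl_le_translate hy.2 hφ hmax
      · exact hw.neg_lapl_le_translate hy.2 hφ hmax
      · have := neg_lapl_le_of_isLocalMaxOn_quadratic hC0 hm0 hφ hy.2 hmax
        show -lapl φ y ≤ B - 0 * ψ y - ‖gradient φ y‖ ^ m
        rwa [zero_mul, sub_zero]
      · exact hv.neg_lapl_le hy.1 (hshift y hy.1 hy.2).2 hφ hmax)
    (x₀ := z) (by intro j; fin_cases j; exacts [hzτ, hzτ, hzA, hz])
    (by
      intro x hx hmax
      have hxz := hmax z (by intro j; fin_cases j; exacts [hzτ, hzτ, hzA, hz])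
      simp only [Fin.sum_univ_four, Matrix.cons_val_zero, Matrix.cons_val_one, Matrix.cons_val,
        one_mul, Pi.neg_apply] at hxz
      have hxr := hnear x (hx 3) (hx 0) (by simp only [hG]; linarith)
      have hxτ : x + τ ∈ Ω := (hshift x (hx 3) hxr).1 t ht htt₀
      intro j; fin_cases j
      exacts [hxτ, hxτ, hR (hx 3), hxr])
    (by positivity : 0 < δ₁ / 3)
  have hxz := hz'max z (by intro j; fin_cases j; exacts [hzτ, hzτ, hzA, hz])
  simp only [Fin.sum_univ_four, Matrix.cons_val_zero, Matrix.cons_val_one, Matrix.cons_val,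
    one_mul, one_smul, Pi.neg_apply, zero_mul, sub_zero] at hxz hp hsum hQ
  have hpn : ‖p 3‖ ^ m ≤ (1 - ε) * ((1 - κ) * ‖p 0‖ ^ m + κ * ‖p 1‖ ^ m) + ε * ‖p 2‖ ^ m := by
    rw [← neg_neg (p 3), ← eq_neg_of_add_eq_zero_left hp, norm_neg, mul_smul, mul_smul,
      ← smul_add]
    refine (norm_rpow_add_le hm hε1.le hε.le (by ring) _ _).trans ?_
    gcongr
    exact norm_rpow_add_le hm hκ'.le hκ.le (by ring) _ _
  have hd : ∀ i, dist (y i + τ) (y 3) < δ₁ := fun i => by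
    have h1 : dist (y i + τ) (y i) = ‖τ‖ := by simp [dist_eq_norm]
    linarith [dist_triangle (y i + τ) (y i) (y 3), dist_triangle_right (y i) (y 3) z', hyz i,
      hyz 3]
  have h1 := (abs_lt.1 (hunif _ (hyA 0) _ (hyA 3) (hd 0))).2
  have h2 := (abs_lt.1 (hunif _ (hyA 1) _ (hyA 3) (hd 1))).2
  have h3 := mul_lt_mul_of_pos_left h1 (mul_pos hε1 hκ')
  have h4 := mul_lt_mul_of_pos_left h2 (mul_pos hε1 hκ)
  have hψy : ε * ψ (y 2) ≤ 0 := by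
    refine mul_nonpos_of_nonneg_of_nonpos hε.le ?_
    simp only [hψ]
    nlinarith [mul_nonneg hC0 (sq_nonneg ‖y 2 - z‖)]
  have hGz := hS z hz
  rw [Real.norm_eq_abs, abs_le] at hGz
  have h5 : 0 ≤ (1 - ε) * (1 - κ) * u (y 0 + τ) + (1 - ε) * κ * w (y 1 + τ) - v (y 3) := by
    have h6 : ε * G z ≤ ε * S := mul_le_mul_of_nonneg_left hGz.2 hε.le
    have h7 : (1 - ε) * G (z + τ) =
        (1 - ε) * (1 - κ) * u (z + τ) + (1 - ε) * κ * w (z + τ) := by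
      simp only [hG]; ring
    rw [h7] at hFz
    linarith
  have h6 := mul_nonneg hlam h5
  have h7 := hH _ (hyA 3)
  rw [Real.norm_eq_abs, abs_le] at h7
  have h8 : ε * -h (y 3) ≤ ε * H := mul_le_mul_of_nonneg_left (by linarith) hε.le
  have h9 : κ * η * ε ≤ κ * η * (1 / 2) := mul_le_mul_of_nonneg_left hε2.le (by positivity)
  have h10 : 0 < κ * η := by positivity
  linarith

/-! ### Existence and uniqueness -/

lemma IsStatSub.congr {N : ℕ} {Ω : Set (Euc N)} {h h' k k' u : Euc N → ℝ} {lam m : ℝ}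
    (hu : IsStatSub Ω h k lam m u) (hh : EqOn h h' (closure Ω)) (hk : EqOn k k' (frontier Ω)) :
    IsStatSub Ω h' k' lam m u := by
  refine ⟨hu.1, fun φ hφ x hx hmax => ?_⟩
  have key := hu.2 φ hφ x hx hmax
  simp only [statOp, hh hx] at key ⊢
  exact ⟨key.1, fun hf => hk hf ▸ key.2 hf⟩

lemma IsStatSuper.congr {N : ℕ} {Ω : Set (Euc N)} {h h' k k' v : Euc N → ℝ} {lam m : ℝ}
    (hv : IsStatSuper Ω h k lam m v) (hh : EqOn h h' (closure Ω)) (hk : EqOn k k' (frontier Ω)) :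
    IsStatSuper Ω h' k' lam m v := by
  refine ⟨hv.1, fun φ hφ x hx hmin => ?_⟩
  have key := hv.2 φ hφ x hx hmin
  simp only [statOp, hh hx] at key ⊢
  exact ⟨key.1, fun hf => hk hf ▸ key.2 hf⟩

lemma IsStatSuper.congr_fun {N : ℕ} {Ω : Set (Euc N)} {h k v w : Euc N → ℝ} {lam m : ℝ}
    (hv : IsStatSuper Ω h k lam m v) (hvw : EqOn v w (closure Ω)) :
    IsStatSuper Ω h k lam m w := by
  refine ⟨fun x hx b hb => ?_, fun φ hφ x hx hmin => ?_⟩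
  · have hb' : b < v x := by rw [hvw hx]; exact hb
    filter_upwards [hv.1 x hx b hb', self_mem_nhdsWithin] with y hy hyc
    show b < w y
    rw [← hvw hyc]
    exact hy
  · rw [← hvw hx]
    refine hv.2 φ hφ x hx ?_
    filter_upwards [hmin, self_mem_nhdsWithin] with y hy hyc
    simpa only [Pi.sub_apply, hvw hyc, hvw hx] using hy

lemma IsStatSub.of_strict {N : ℕ} {Ω : Set (Euc N)} {h k u : Euc N → ℝ} {lam m η δ : ℝ}
    (hη : 0 ≤ η) (hδ : 0 ≤ δ)
    (hu : IsStatSub Ω (fun x => h x - η) (fun x => k x - δ) lam m u) :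
    IsStatSub Ω h k lam m u := by
  refine ⟨hu.1, fun φ hφ x hx hmax => ?_⟩
  obtain ⟨h1, h2⟩ := hu.2 φ hφ x hx hmax
  simp only [statOp, min_le_iff] at h1 h2 ⊢
  refine ⟨fun hxΩ => by linarith [h1 hxΩ], fun hxf => (h2 hxf).imp ?_ ?_⟩ <;>
    intro h3 <;> linarith

lemma exists_isStatSub_const {N : ℕ} {Ω : Set (Euc N)} (hΩo : IsOpen Ω)
    (hΩb : Bornology.IsBounded Ω) {h k : Euc N → ℝ} (hh : Continuous h) (hk : Continuous k)
    {lam m : ℝ} (hlam : 0 < lam) (hm : 0 < m) :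
    ∃ c : ℝ, IsStatSub Ω h k lam m fun _ => c := by
  obtain ⟨H, hH⟩ := hΩb.isCompact_closure.exists_bound_of_continuousOn hh.continuousOn
  obtain ⟨K, hK⟩ := hΩb.isCompact_closure.exists_bound_of_continuousOn hk.continuousOn
  refine ⟨-(|H| / lam + |K|), upperSemicontinuousOn_const, fun φ hφ x hx hmax =>
    ⟨fun hxΩ => ?_, fun _ => min_le_of_right_le ?_⟩⟩
  · have hloc := hmax.isLocalMax (mem_of_superset (hΩo.mem_nhds hxΩ) subset_closure)
    obtain ⟨h1, h2⟩ := gradient_eq_and_lapl_le_of_isLocalMax hloc contDiffAt_const hφ.contDiffAt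
    rw [lapl_const] at h2
    rw [show gradient (fun _ : Euc N => -(|H| / lam + |K|)) x = 0 by simp [gradient]] at h1
    have h3 := hH x hx
    rw [Real.norm_eq_abs] at h3
    have h4 : lam * (|H| / lam) = |H| := by field_simp
    have h5 : 0 ≤ lam * |K| := by positivity
    simp only [statOp, h1, norm_zero, Real.zero_rpow hm.ne']
    linarith [neg_abs_le (h x), le_abs_self H]
  · have h3 := hK x hx
    rw [Real.norm_eq_abs] at h3
    have : 0 ≤ |H| / lam := by positivity
    linarith [neg_abs_le (k x), le_abs_self K]

lemma eqOn_of_isStatSuper_of_frequently {N : ℕ} {Ω : Set (Euc N)} {v w s : Euc N → ℝ}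
    (hv : LowerSemicontinuousOn v (closure Ω)) (hs : ContinuousOn s (closure Ω))
    (hvw : ∀ x ∈ closure Ω, v x ≤ w x) (hsw : ∀ x ∈ closure Ω, s x ≤ w x)
    (hsΩ : ∀ x ∈ Ω, s x = w x)
    (hfr : ∀ x ∈ closure Ω, ∀ ε > 0, ∃ᶠ y in 𝓝[closure Ω] x, w y < v x + ε) :
    EqOn v s (closure Ω) := by
  intro x hx
  have hne : (𝓝[Ω] x).NeBot := mem_closure_iff_nhdsWithin_neBot.1 hx
  refine le_antisymm (le_of_forall_lt_imp_le_of_dense fun b hb => ?_)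
    (le_of_forall_pos_le_add fun ε hε => ?_)
  · refine ge_of_tendsto ((hs x hx).mono subset_closure) ?_
    filter_upwards [(hv x hx b hb).filter_mono (nhdsWithin_mono x subset_closure),
      self_mem_nhdsWithin] with y hy hyΩ
    rw [hsΩ y hyΩ]
    exact hy.le.trans (hvw y (subset_closure hyΩ))
  · have hev : ∀ᶠ y in 𝓝[closure Ω] x, s x - ε / 2 < s y :=
      (hs x hx).eventually (lt_mem_nhds (by linarith))
    obtain ⟨y, hy1, hy2, hy3⟩ := ((hfr x hx (ε / 2) (half_pos hε)).and_eventually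
      (hev.and self_mem_nhdsWithin)).exists
    linarith [hsw y hy3]

lemma exists_unique_stat_of_continuous {N : ℕ} (hN : 1 ≤ N) {Ω : Set (Euc N)}
    (hΩo : IsOpen Ω) (hΩb : Bornology.IsBounded Ω) (hΩ : HasC2Boundary Ω)
    {m lam η δ C : ℝ} {h k w₀ : Euc N → ℝ} (hh : Continuous h) (hk : Continuous k)
    (hm : 0 < m) (hlam : 0 < lam ∨ 1 < m ∧ lam = 0) (hη : 0 < η) (hδ : 0 < δ)
    (hw₀ : IsStatSub Ω (fun x => h x - η) (fun x => k x - δ) lam m w₀)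
    (hC : ∀ x ∈ closure Ω, |w₀ x| ≤ C) :
    ∃ w : Euc N → ℝ, ContinuousOn w (closure Ω) ∧
      IsStatSub Ω h k lam m w ∧ IsStatSuper Ω h k lam m w ∧
      ∀ w' : Euc N → ℝ, ContinuousOn w' (closure Ω) →
        IsStatSub Ω h k lam m w' → IsStatSuper Ω h k lam m w' → EqOn w' w (closure Ω) := by
  have hlam0 : 0 ≤ lam := hlam.elim le_of_lt fun h => h.2.ge
  have hhη : Continuous fun x => h x - η := hh.sub continuous_const
  have hkδ : Continuous fun x => k x - δ := hk.sub continuous_const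
  obtain ⟨w, v, hw, hv, hvw, hCw, hfr⟩ :=
    exists_perron hN hΩo hΩb hh hk hlam0 hm.le (hw₀.of_strict hη.le hδ.le) hC
  have hsubk : ∀ u, IsStatSub Ω h k lam m u → ∀ z ∈ frontier Ω, u z ≤ k z := fun u hu z hz =>
    hu.le_frontier hN hΩb hΩ hh hk hlam0 hz
  rcases le_or_gt m 2 with hm2 | hm2
  · have hcmp : ∀ u v, IsStatSub Ω h k lam m u → IsStatSuper Ω h k lam m v →
        ∀ x ∈ closure Ω, u x ≤ v x := by
      intro u v hu hv
      have hkv : ∀ z ∈ frontier Ω, k z ≤ v z := fun z hz =>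
        hv.le_frontier hΩb hΩ hh hk hlam0 hm.le hm2 hz
      rcases hlam with hlam | ⟨hm1, rfl⟩
      · exact le_of_isStatSub_of_isStatSuper_of_pos hN hΩo hΩb hh hlam hm.le hu hv
          (hsubk u hu) hkv
      · exact le_of_isStatSub_of_isStatSuper_of_strict hN hΩo hΩb hh hm1.le hη hu hw₀ hv
          (hsubk u hu) (hsubk w₀ (hw₀.of_strict hη.le hδ.le)) hkv
    have hvw' : EqOn v w (closure Ω) := fun x hx =>
      le_antisymm (hvw x hx) (hcmp w v hw hv x hx)
    have hws := hv.congr_fun hvw'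
    refine ⟨w, continuousOn_iff_lower_upperSemicontinuousOn.2 ⟨hws.1, hw.1⟩, hw, hws,
      fun w' _ hw'1 hw'2 x hx => le_antisymm (hcmp w' w hw'1 hws x hx) (hcmp w w' hw hw'2 x hx)⟩
  · obtain ⟨M, hM⟩ := IsStatSub.exists_upper_bound hN hΩb hh hk (m := m) hlam0
    have hwM : ∀ x ∈ closure Ω, |w x| ≤ max C M := fun x hx => by
      refine abs_le.2 ⟨?_, (hM w hw x hx).trans (le_max_right _ _)⟩
      linarith [hCw x hx, le_max_left C M]
    obtain ⟨s, hsc, hs, hsΩ, hsw⟩ := hw.exists_continuousOn hN hΩo hΩb hΩ hh hk hlam0 hm2 hwM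
    obtain ⟨s₀, hs₀c, hs₀, -, -⟩ :=
      hw₀.exists_continuousOn hN hΩo hΩb hΩ hhη hkδ hlam0 hm2 hC
    have hss := hv.congr_fun (eqOn_of_isStatSuper_of_frequently hv.1 hsc hvw hsw hsΩ hfr)
    have hcmp : ∀ u v, ContinuousOn u (closure Ω) → ContinuousOn v (closure Ω) →
        IsStatSub Ω h k lam m u → IsStatSuper Ω h k lam m v → ∀ x ∈ closure Ω, u x ≤ v x :=
      fun u v huc hvc hu hv => le_of_isStatSub_of_isStatSuper_of_continuousOn hN hΩo hΩb hΩ hh hk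
        hlam0 (by linarith) hη hu hs₀ hv huc hs₀c hvc (hsubk u hu)
        (hsubk s₀ (hs₀.of_strict hη.le hδ.le))
    exact ⟨s, hsc, hs, hss, fun w' hw'c hw'1 hw'2 x hx => le_antisymm
      (hcmp w' s hw'c hsc hw'1 hss x hx) (hcmp s w' hsc hw'c hs hw'2 x hx)⟩

lemma ContinuousOn.exists_continuous_eqOn {X : Type*} [TopologicalSpace X] [NormalSpace X]
    {s : Set X} (hs : IsClosed s) {f : X → ℝ} (hf : ContinuousOn f s) :
    ∃ g : X → ℝ, Continuous g ∧ EqOn f g s := by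
  obtain ⟨g, hg⟩ := ContinuousMap.exists_restrict_eq hs ⟨s.domRestrict f, hf.domRestrict⟩
  exact ⟨g, g.continuous, fun x hx => (DFunLike.congr_fun hg ⟨x, hx⟩).symm⟩

/-- Existence and uniqueness for the stationary generalized
Dirichlet problem, Theorem 2.11 of the paper. -/
theorem stmt5 {N : ℕ} (hN : 1 ≤ N) (Ω : Set (Euc N))
    (hΩo : IsOpen Ω) (hΩb : Bornology.IsBounded Ω) (hΩc : IsConnected Ω)
    (hΩ2 : HasC2Boundary Ω)
    (m lam : ℝ) (h k : Euc N → ℝ)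
    (hh : ContinuousOn h (closure Ω)) (hk : ContinuousOn k (frontier Ω))
    (hAlt : (0 < m ∧ 0 < lam) ∨
      (1 < m ∧ lam = 0 ∧ ∃ w : Euc N → ℝ,
        (∃ C : ℝ, ∀ x ∈ closure Ω, |w x| ≤ C) ∧
        ∃ η > (0 : ℝ), ∃ δ' > (0 : ℝ),
          IsStatSub Ω (fun x => h x - η) (fun x => k x - δ') 0 m w)) :
    ∃ w : Euc N → ℝ, ContinuousOn w (closure Ω) ∧
      IsStatSub Ω h k lam m w ∧ IsStatSuper Ω h k lam m w ∧
      ∀ w' : Euc N → ℝ, ContinuousOn w' (closure Ω) →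
        IsStatSub Ω h k lam m w' → IsStatSuper Ω h k lam m w' →
        Set.EqOn w' w (closure Ω) := by
  obtain ⟨h', hh', heq⟩ := hh.exists_continuous_eqOn isClosed_closure
  obtain ⟨k', hk', keq⟩ := hk.exists_continuous_eqOn isClosed_frontier
  have key : ∃ w : Euc N → ℝ, ContinuousOn w (closure Ω) ∧
      IsStatSub Ω h' k' lam m w ∧ IsStatSuper Ω h' k' lam m w ∧
      ∀ w' : Euc N → ℝ, ContinuousOn w' (closure Ω) →
        IsStatSub Ω h' k' lam m w' → IsStatSuper Ω h' k' lam m w' → EqOn w' w (closure Ω) := by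
    rcases hAlt with ⟨hm, hlam⟩ | ⟨hm, rfl, w₀, ⟨C, hC⟩, η, hη, δ, hδ, hw₀⟩
    · obtain ⟨c, hc⟩ := exists_isStatSub_const hΩo hΩb (hh'.sub (continuous_const (y := (1 : ℝ))))
        (hk'.sub (continuous_const (y := (1 : ℝ)))) hlam hm
      exact exists_unique_stat_of_continuous hN hΩo hΩb hΩ2 hh' hk' hm (Or.inl hlam) one_pos
        one_pos hc (C := |c|) fun _ _ => le_rfl
    · exact exists_unique_stat_of_continuous hN hΩo hΩb hΩ2 hh' hk' (by linarith)
        (Or.inr ⟨hm, rfl⟩) hη hδ (hw₀.congr (fun x hx => by simp only [heq hx])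
          (fun x hx => by simp only [keq hx])) hC
  obtain ⟨w, hwc, hw1, hw2, huniq⟩ := key
  exact ⟨w, hwc, hw1.congr heq.symm keq.symm, hw2.congr heq.symm keq.symm,
    fun w' hw'c h1 h2 => huniq w' hw'c (h1.congr heq keq) (h2.congr heq keq)⟩
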